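/- For every α ∈ (0,1) and every β ∈ (1,2] with α·β > 1, the Hausdorff dimension of the graph {(x, T_{α,β}(x)) : x ∈ [0,1]} ⊂ ℝ² of the generalized (α,β)-Takagi function equals 2 + log α / log β. -/

import Mathlib

/-- The distance from `x` to the nearest integer. -/
noncomputable def distInt (x : ℝ) : ℝ := |x - round x|

/-- The base map `B_β : [0,1] → [0,1]`, `B_β(x) = βx` on `[0,1/2]` and
`B_β(x) = 1 - β(1-x)` on `(1/2,1]`. -/
noncomputable def Bmap (β : ℝ) (x : ℝ) : ℝ := if x ≤ 1 / 2 then β * x else 1 - β * (1 - x)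

/-- The generalized `(α,β)`-Takagi function `T_{α,β}(x) = Σ_{k=0}^∞ α^k ψ(B_β^k(x))`. -/
noncomputable def genTakagi (α β : ℝ) (x : ℝ) : ℝ := ∑' k : ℕ, α ^ k * distInt ((Bmap β)^[k] x)

section

open MeasureTheory Filter Topology

/-- The average of `f` over all words of length `j` in the alphabet `ι`. -/
noncomputable def wavg {ι : Type} [Fintype ι] (j : ℕ) (f : List ι → ℝ) : ℝ :=
  (∑ v : Fin j → ι, f (List.ofFn v)) / (Fintype.card ι : ℝ) ^ j

section wavg
variable {ι : Type} [Fintype ι]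

lemma wavg_zero (f : List ι → ℝ) : wavg 0 f = f [] := by
  simp [wavg]

lemma wavg_succ (j : ℕ) (f : List ι → ℝ) :
    wavg (j + 1) f = (∑ a, wavg j (fun w => f (a :: w))) / Fintype.card ι := by
  unfold wavg
  rw [← Finset.sum_div, div_div, ← pow_succ, ← Fintype.sum_prod_type',
    ← (Fin.consEquiv (fun _ : Fin (j + 1) => ι)).sum_comp]
  simp [Fin.consEquiv, List.ofFn_succ]

lemma wavg_congr {j : ℕ} {f g : List ι → ℝ} (h : ∀ w, w.length = j → f w = g w) :
    wavg j f = wavg j g := by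
  unfold wavg
  congr 1
  exact Finset.sum_congr rfl fun v _ => h _ (by simp)

lemma wavg_mono {j : ℕ} {f g : List ι → ℝ} (h : ∀ w, w.length = j → f w ≤ g w) :
    wavg j f ≤ wavg j g := by
  unfold wavg
  gcongr with v
  exact h _ (by simp)

lemma wavg_add (j : ℕ) (f g : List ι → ℝ) :
    wavg j (fun w => f w + g w) = wavg j f + wavg j g := by
  simp [wavg, Finset.sum_add_distrib, add_div]

lemma wavg_sub (j : ℕ) (f g : List ι → ℝ) :
    wavg j (fun w => f w - g w) = wavg j f - wavg j g := by
  simp [wavg, Finset.sum_sub_distrib, sub_div]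

lemma wavg_mul_left (j : ℕ) (r : ℝ) (f : List ι → ℝ) :
    wavg j (fun w => r * f w) = r * wavg j f := by
  rw [wavg, wavg, mul_div_assoc', Finset.mul_sum]

lemma wavg_mul_right (j : ℕ) (r : ℝ) (f : List ι → ℝ) :
    wavg j (fun w => f w * r) = wavg j f * r := by
  simp_rw [mul_comm _ r, wavg_mul_left]

lemma wavg_finset_sum {κ : Type} (s : Finset κ) (j : ℕ) (f : κ → List ι → ℝ) :
    wavg j (fun w => ∑ t ∈ s, f t w) = ∑ t ∈ s, wavg j (f t) := by
  simp only [wavg]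
  rw [Finset.sum_comm, Finset.sum_div]

lemma wavg_const [Nonempty ι] (j : ℕ) (r : ℝ) : wavg j (fun _ : List ι => r) = r := by
  simp [wavg]

lemma wavg_nonneg {j : ℕ} {f : List ι → ℝ} (h : ∀ w, w.length = j → 0 ≤ f w) :
    0 ≤ wavg j f := by
  unfold wavg
  exact div_nonneg (Finset.sum_nonneg fun v _ => h _ (by simp)) (by positivity)

lemma wavg_le [Nonempty ι] {j : ℕ} {f : List ι → ℝ} {r : ℝ} (h : ∀ w, w.length = j → f w ≤ r) :
    wavg j f ≤ r := by
  simpa [wavg_const] using wavg_mono (g := fun _ => r) h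

lemma le_wavg [Nonempty ι] {j : ℕ} {f : List ι → ℝ} {r : ℝ} (h : ∀ w, w.length = j → r ≤ f w) :
    r ≤ wavg j f := by
  simpa [wavg_const] using wavg_mono (f := fun _ => r) h

lemma wavg_pos [Nonempty ι] {j : ℕ} {f : List ι → ℝ} (h : ∀ w, w.length = j → 0 < f w) :
    0 < wavg j f := by
  unfold wavg
  refine div_pos (Finset.sum_pos (fun v _ => h _ (by simp)) Finset.univ_nonempty) ?_
  have : 0 < Fintype.card ι := Fintype.card_pos
  positivity

lemma abs_wavg_le [Nonempty ι] {j : ℕ} {f : List ι → ℝ} {r : ℝ}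
    (h : ∀ w, w.length = j → |f w| ≤ r) : |wavg j f| ≤ r :=
  abs_le.2 ⟨le_wavg fun w hw => (abs_le.1 (h w hw)).1, wavg_le fun w hw => (abs_le.1 (h w hw)).2⟩

lemma wavg_append (i j : ℕ) (f : List ι → ℝ) :
    wavg (i + j) f = wavg i (fun u => wavg j (fun v => f (u ++ v))) := by
  induction i generalizing f with
  | zero => simp [wavg_zero]
  | succ i ih =>
    rw [show i + 1 + j = (i + j) + 1 by ring, wavg_succ, wavg_succ]
    simp_rw [ih]
    rfl

lemma integral_wavg {j : ℕ} {f : List ι → ℝ → ℝ}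
    (h : ∀ w, w.length = j → MeasureTheory.Integrable (f w)) :
    ∫ z, wavg j (fun w => f w z) = wavg j (fun w => ∫ z, f w z) := by
  simp only [wavg]
  rw [MeasureTheory.integral_div, MeasureTheory.integral_finsetSum]
  exact fun v _ => h _ (by simp)

lemma integrable_wavg {j : ℕ} {f : List ι → ℝ → ℝ}
    (h : ∀ w, w.length = j → MeasureTheory.Integrable (f w)) :
    MeasureTheory.Integrable (fun z => wavg j (fun w => f w z)) := by
  simp only [wavg]
  exact (MeasureTheory.integrable_finsetSum _ fun v _ => h _ (by simp)).div_const _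

lemma continuous_wavg {j : ℕ} {f : List ι → ℝ → ℝ} (h : ∀ w, Continuous (f w)) :
    Continuous (fun z => wavg j (fun w => f w z)) := by
  simp only [wavg]
  exact (continuous_finsetSum _ fun v _ => h _).div_const _

end wavg

/-- A finite family of affine maps `y ↦ b y + t a` of `[-1, 1]` into itself with separated images,
together with a function `T` which is self-affine along these maps. -/
structure GraphIFS (ι : Type) where
  b : ℝ
  A : ℝ
  t : ι → ℝ
  s : ι → ℝ
  T : ℝ → ℝ
  sep : ℝ
  b_pos : 0 < b
  b_lt_A : b < A
  A_lt_one : A < 1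
  T_zero : T 0 = 0
  maps : ∀ a y, |y| ≤ 1 → |b * y + t a| ≤ 1
  T_map : ∀ a y, |y| ≤ 1 → T (b * y + t a) = A * T y + s a * y + T (t a)
  T_cont : ContinuousOn T (Set.Icc (-1) 1)
  sep_pos : 0 < sep
  separated : ∀ a a' y y', a ≠ a' → |y| ≤ 1 → |y'| ≤ 1 →
    sep ≤ |(b * y + t a) - (b * y' + t a')|

namespace GraphIFS
variable {ι : Type} (S : GraphIFS ι)

lemma A_pos : 0 < S.A := S.b_pos.trans S.b_lt_A

lemma b_lt_one : S.b < 1 := S.b_lt_A.trans S.A_lt_one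

/-- The contraction ratio of the action on slopes. -/
noncomputable def γ : ℝ := S.b / S.A

lemma γ_pos : 0 < S.γ := div_pos S.b_pos S.A_pos

lemma γ_lt_one : S.γ < 1 := (div_lt_one S.A_pos).2 S.b_lt_A

lemma γ_mul_A : S.γ * S.A = S.b := div_mul_cancel₀ _ S.A_pos.ne'

/-- The action of words on slopes. -/
noncomputable def act : ℝ → List ι → ℝ
  | c, [] => c
  | c, a :: w => act (S.γ * c - S.s a / S.A) w

/-- The image of `0` under the composition of the maps along a word. -/
noncomputable def pt : List ι → ℝ
  | [] => 0
  | a :: w => S.b * pt w + S.t a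

/-- The slope of the affine cocycle along a word. -/
noncomputable def sl : List ι → ℝ
  | [] => 0
  | a :: w => S.A * sl w + S.s a * S.b ^ w.length

/-- The skewed function `T x - c x`. -/
noncomputable def U (c x : ℝ) : ℝ := S.T x - c * x

@[simp] lemma act_nil (c : ℝ) : S.act c [] = c := rfl
@[simp] lemma act_cons (c : ℝ) (a : ι) (w : List ι) :
    S.act c (a :: w) = S.act (S.γ * c - S.s a / S.A) w := rfl
@[simp] lemma pt_nil : S.pt [] = 0 := rfl
@[simp] lemma pt_cons (a : ι) (w : List ι) : S.pt (a :: w) = S.b * S.pt w + S.t a := rfl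
@[simp] lemma sl_nil : S.sl [] = 0 := rfl
@[simp] lemma sl_cons (a : ι) (w : List ι) :
    S.sl (a :: w) = S.A * S.sl w + S.s a * S.b ^ w.length := rfl

lemma U_zero (c : ℝ) : S.U c 0 = 0 := by simp [U, S.T_zero]

lemma act_append (c : ℝ) (u v : List ι) : S.act c (u ++ v) = S.act (S.act c u) v := by
  induction u generalizing c with
  | nil => rfl
  | cons a u ih => simp [ih]

lemma act_add (c τ : ℝ) (w : List ι) : S.act (c + τ) w = S.act c w + S.γ ^ w.length * τ := by
  induction w generalizing c τ with
  | nil => simp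
  | cons a w ih =>
    have := ih (S.γ * c - S.s a / S.A) (S.γ * τ)
    rw [act_cons, act_cons, List.length_cons, pow_succ, mul_assoc, ← this]
    congr 1; ring

lemma pt_append (u v : List ι) : S.pt (u ++ v) = S.b ^ u.length * S.pt v + S.pt u := by
  induction u with
  | nil => simp
  | cons a u ih => simp [ih, pow_succ]; ring

lemma abs_map_le (w : List ι) (y : ℝ) (hy : |y| ≤ 1) : |S.b ^ w.length * y + S.pt w| ≤ 1 := by
  induction w with
  | nil => simpa
  | cons a w ih =>
    have := S.maps a _ ih
    rw [List.length_cons, pt_cons, pow_succ]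
    convert this using 2; ring

lemma abs_pt_le (w : List ι) : |S.pt w| ≤ 1 := by
  simpa using S.abs_map_le w 0 (by simp)

lemma T_word (w : List ι) (y : ℝ) (hy : |y| ≤ 1) :
    S.T (S.b ^ w.length * y + S.pt w) = S.A ^ w.length * S.T y + S.sl w * y + S.T (S.pt w) := by
  induction w with
  | nil => simp [S.T_zero]
  | cons a w ih =>
    have h1 := S.T_map a _ (S.abs_map_le w y hy)
    have h2 := S.T_map a _ (S.abs_pt_le w)
    rw [List.length_cons, pt_cons, sl_cons, h2,
      show S.b ^ (w.length + 1) * y + (S.b * S.pt w + S.t a)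
        = S.b * (S.b ^ w.length * y + S.pt w) + S.t a by ring, h1, ih]
    ring

lemma act_eq (c : ℝ) (w : List ι) :
    S.A ^ w.length * S.act c w = S.b ^ w.length * c - S.sl w := by
  induction w generalizing c with
  | nil => simp
  | cons a w ih =>
    have hA := S.A_pos.ne'
    rw [act_cons, List.length_cons, pow_succ', mul_assoc, ih, sl_cons, γ]
    field_simp
    ring

lemma U_word (c : ℝ) (w : List ι) (y : ℝ) (hy : |y| ≤ 1) :
    S.U c (S.b ^ w.length * y + S.pt w)
      = S.A ^ w.length * S.U (S.act c w) y + S.U c (S.pt w) := by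
  have := S.act_eq c w
  simp only [U, S.T_word w y hy]
  linear_combination y * this

lemma U_append (c : ℝ) (u v : List ι) :
    S.U c (S.pt (u ++ v)) = S.A ^ u.length * S.U (S.act c u) (S.pt v) + S.U c (S.pt u) := by
  rw [pt_append, S.U_word c u _ (S.abs_pt_le v)]

lemma U_add (c τ x : ℝ) : S.U (c + τ) x = S.U c x - τ * x := by simp [U]; ring

lemma separated_words (u v : List ι) (huv : u.length = v.length) (hne : u ≠ v) (y y' : ℝ)
    (hy : |y| ≤ 1) (hy' : |y'| ≤ 1) :
    S.b ^ (u.length - 1) * S.sep ≤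
      |(S.b ^ u.length * y + S.pt u) - (S.b ^ v.length * y' + S.pt v)| := by
  induction u generalizing v with
  | nil => cases v <;> simp_all
  | cons a u ih =>
    cases v with
    | nil => simp at huv
    | cons a' v =>
      simp only [List.length_cons, Nat.add_right_cancel_iff] at huv
      by_cases haa : a = a'
      · subst haa
        have hne' : u ≠ v := by simpa using hne
        have h1 := ih v huv hne'
        have hlen : 1 ≤ u.length := by
          cases u with
          | nil => cases v <;> simp_all
          | cons _ _ => simp
        obtain ⟨n, hn⟩ : ∃ n, u.length = n + 1 := ⟨u.length - 1, by omega⟩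
        rw [hn] at huv
        simp only [List.length_cons, hn, ← huv, pt_cons, Nat.add_sub_cancel] at h1 ⊢
        rw [show S.b ^ (n + 1 + 1) * y + (S.b * S.pt u + S.t a)
          - (S.b ^ (n + 1 + 1) * y' + (S.b * S.pt v + S.t a))
          = S.b * (S.b ^ (n + 1) * y + S.pt u - (S.b ^ (n + 1) * y' + S.pt v)) by ring,
          abs_mul, abs_of_pos S.b_pos, pow_succ' S.b n, mul_assoc]
        rw [pow_succ' S.b n] at h1
        exact mul_le_mul_of_nonneg_left h1 S.b_pos.le
      · have h1 := S.separated a a' _ _ haa (S.abs_map_le u y hy) (S.abs_map_le v y' hy')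
        have h2 : S.b ^ ((a :: u).length - 1) * S.sep ≤ S.sep :=
          mul_le_of_le_one_left S.sep_pos.le (pow_le_one₀ S.b_pos.le S.b_lt_one.le)
        refine (h2.trans h1).trans_eq ?_
        simp only [List.length_cons, pt_cons]
        congr 1; ring

/-- A bound for the slopes that is preserved by the action of words. -/
def SlopeBound (C : ℝ) : Prop := 0 < C ∧ ∀ a, |S.s a| / S.A ≤ (1 - S.γ) * C

lemma exists_slopeBound [Fintype ι] : ∃ C, S.SlopeBound C := by
  have h : 0 < 1 - S.γ := sub_pos.2 S.γ_lt_one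
  have h0 : 0 ≤ ∑ a, |S.s a| / S.A :=
    Finset.sum_nonneg fun a _ => div_nonneg (abs_nonneg _) S.A_pos.le
  refine ⟨(1 + ∑ a, |S.s a| / S.A) / (1 - S.γ), by positivity, fun a => ?_⟩
  rw [mul_div_cancel₀ _ h.ne']
  have := Finset.single_le_sum (f := fun a => |S.s a| / S.A)
    (fun a _ => div_nonneg (abs_nonneg _) S.A_pos.le) (Finset.mem_univ a)
  linarith

variable {S} in
lemma SlopeBound.act_le {C : ℝ} (hC : S.SlopeBound C) {c : ℝ} (hc : |c| ≤ C) (w : List ι) :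
    |S.act c w| ≤ C := by
  induction w generalizing c with
  | nil => simpa
  | cons a w ih =>
    refine ih ?_
    have h1 : |S.γ * c - S.s a / S.A| ≤ |S.γ * c| + |S.s a / S.A| := abs_sub _ _
    rw [abs_mul, abs_of_pos S.γ_pos, abs_div, abs_of_pos S.A_pos] at h1
    have h2 := hC.2 a
    have h3 := mul_le_mul_of_nonneg_left hc S.γ_pos.le
    linarith

lemma exists_T_bound : ∃ M, 0 ≤ M ∧ ∀ y, |y| ≤ 1 → |S.T y| ≤ M := by
  obtain ⟨M, hM⟩ := isCompact_Icc.exists_bound_of_continuousOn S.T_cont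
  refine ⟨M, ?_, fun y hy => hM y (abs_le.1 hy)⟩
  exact (abs_nonneg _).trans (hM 0 (by simp))

lemma exists_U_bound (C : ℝ) (hC : 0 ≤ C) :
    ∃ B, 0 < B ∧ ∀ c y, |c| ≤ C → |y| ≤ 1 → |S.U c y| ≤ B := by
  obtain ⟨M, hM0, hM⟩ := S.exists_T_bound
  refine ⟨M + C + 1, by positivity, fun c y hc hy => ?_⟩
  have h1 : |S.U c y| ≤ |S.T y| + |c * y| := abs_sub _ _
  have h2 : |c * y| ≤ C * 1 := by
    rw [abs_mul]; exact mul_le_mul hc hy (abs_nonneg _) hC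
  linarith [hM y hy]

end GraphIFS

lemma integrable_exp_neg_abs : Integrable (fun x : ℝ => Real.exp (-|x|)) := by
  have h1 : IntegrableOn (fun x : ℝ => Real.exp (-|x|)) (Set.Ioi 0) := by
    refine (integrableOn_exp_neg_Ioi 0).congr_fun (fun x hx => ?_) measurableSet_Ioi
    simp [abs_of_pos (Set.mem_Ioi.1 hx)]
  have h2 : IntegrableOn (fun x : ℝ => Real.exp (-|x|)) (Set.Iic 0) := by
    refine (integrableOn_exp_Iic 0).congr_fun (fun x hx => ?_) measurableSet_Iic
    simp [abs_of_nonpos (Set.mem_Iic.1 hx)]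
  have := h2.union h1
  rwa [Set.Iic_union_Ioi, integrableOn_univ] at this

lemma integral_exp_neg_abs : ∫ x : ℝ, Real.exp (-|x|) = 2 := by
  have := integral_comp_abs (f := fun x => Real.exp (-x))
  rw [this, integral_exp_neg_Ioi_zero]; norm_num

namespace GraphIFS
variable {ι : Type} [Fintype ι] (S : GraphIFS ι)

/-- The distribution of `U c`, smoothed at scale `A ^ n` and rescaled to unit size. -/
noncomputable def g (n : ℕ) (c z : ℝ) : ℝ :=
  wavg n fun w => Real.exp (-|z - S.U c (S.pt w) / S.A ^ n|)

/-- The part of `g (w.length + n) c` coming from the cylinder of the word `w`. -/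
noncomputable def cg (n : ℕ) (c : ℝ) (w : List ι) (z : ℝ) : ℝ :=
  S.g n (S.act c w) (z - S.U c (S.pt w) / S.A ^ (w.length + n))

lemma cg_nil (n : ℕ) (c z : ℝ) : S.cg n c [] z = S.g n c z := by
  simp [cg, S.U_zero]

lemma g_add (j n : ℕ) (c z : ℝ) : S.g (j + n) c z = wavg j fun w => S.cg n c w z := by
  unfold g cg
  rw [wavg_append]
  refine wavg_congr fun u hu => ?_
  unfold g
  refine wavg_congr fun v hv => ?_
  rw [S.U_append, hu]
  congr 3
  have := S.A_pos.ne'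
  field_simp
  ring

lemma g_add_one (n : ℕ) (c z : ℝ) :
    S.g (n + 1) c z = (∑ a, S.cg n c [a] z) / Fintype.card ι := by
  rw [add_comm, g_add, wavg_succ]
  simp [wavg_zero]

lemma cg_cg (n : ℕ) (c : ℝ) (u v : List ι) (z : ℝ) :
    S.cg n c (u ++ v) z =
      S.cg n (S.act c u) v (z - S.U c (S.pt u) / S.A ^ (u.length + v.length + n)) := by
  unfold cg
  rw [S.act_append, S.U_append, List.length_append]
  congr 1
  have := S.A_pos.ne'
  field_simp
  ring

lemma cg_add (j n : ℕ) (c : ℝ) (u : List ι) (z : ℝ) :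
    S.cg (j + n) c u z = wavg j fun v => S.cg n c (u ++ v) z := by
  rw [cg, g_add]
  refine wavg_congr fun v hv => ?_
  rw [cg_cg, hv, add_assoc]

lemma continuous_g (n : ℕ) (c : ℝ) : Continuous (S.g n c) :=
  continuous_wavg fun w => by fun_prop

lemma continuous_cg (n : ℕ) (c : ℝ) (w : List ι) : Continuous (S.cg n c w) :=
  (S.continuous_g n _).comp (by fun_prop)

lemma g_shift (n : ℕ) (c z t : ℝ) : S.g n c (z + t) ≤ Real.exp |t| * S.g n c z := by
  unfold g
  rw [← wavg_mul_left]
  refine wavg_mono fun w _ => ?_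
  rw [← Real.exp_add]
  gcongr
  have := abs_sub_abs_le_abs_sub (z - S.U c (S.pt w) / S.A ^ n) (-t)
  rw [sub_neg_eq_add, abs_neg] at this
  rw [show z + t - S.U c (S.pt w) / S.A ^ n = z - S.U c (S.pt w) / S.A ^ n + t by ring]
  linarith

lemma cg_shift (n : ℕ) (c : ℝ) (w : List ι) (z t : ℝ) :
    S.cg n c w (z + t) ≤ Real.exp |t| * S.cg n c w z := by
  unfold cg
  rw [add_sub_right_comm]
  exact S.g_shift n _ _ _

lemma g_slope (n : ℕ) (c τ z : ℝ) :
    S.g n (c + τ) z ≤ Real.exp (|τ| / S.A ^ n) * S.g n c z := by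
  unfold g
  rw [← wavg_mul_left]
  refine wavg_mono fun w _ => ?_
  rw [← Real.exp_add]
  gcongr
  rw [S.U_add]
  have hA := pow_pos S.A_pos n
  have h1 := abs_sub_abs_le_abs_sub (z - S.U c (S.pt w) / S.A ^ n)
    (z - (S.U c (S.pt w) - τ * S.pt w) / S.A ^ n)
  have h2 : z - S.U c (S.pt w) / S.A ^ n - (z - (S.U c (S.pt w) - τ * S.pt w) / S.A ^ n)
    = -(τ * S.pt w) / S.A ^ n := by ring
  rw [h2, abs_div, abs_neg, abs_mul, abs_of_pos hA] at h1
  have h3 : |τ| * |S.pt w| / S.A ^ n ≤ |τ| / S.A ^ n := by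
    gcongr
    exact mul_le_of_le_one_right (abs_nonneg _) (S.abs_pt_le w)
  linarith

lemma cg_slope (n : ℕ) (c θ : ℝ) (w : List ι) (z : ℝ) :
    S.cg n (c + θ * S.A ^ (w.length + n)) w z ≤
      Real.exp (|θ| * S.b ^ w.length) * S.cg n c w (z + θ * S.pt w) := by
  unfold cg
  have hA := S.A_pos.ne'
  rw [S.act_add, S.U_add]
  refine (S.g_slope n _ _ _).trans_eq ?_
  have hA' := pow_pos S.A_pos n
  have h1 : |S.γ ^ w.length * (θ * S.A ^ (w.length + n))| / S.A ^ n = |θ| * S.b ^ w.length := by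
    rw [← S.γ_mul_A, pow_add, mul_pow, abs_mul, abs_mul, abs_mul,
      abs_of_pos (pow_pos S.γ_pos _), abs_of_pos hA', abs_of_pos (pow_pos S.A_pos _)]
    field_simp
  rw [h1]
  congr 2
  field_simp
  ring

lemma cg_slope' (n : ℕ) (c θ : ℝ) (w : List ι) (z : ℝ) :
    S.cg n c w (z + θ * S.pt w) ≤
      Real.exp (|θ| * S.b ^ w.length) * S.cg n (c + θ * S.A ^ (w.length + n)) w z := by
  have := S.cg_slope n (c + θ * S.A ^ (w.length + n)) (-θ) w (z + θ * S.pt w)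
  rw [abs_neg] at this
  convert this using 2 <;> ring_nf

variable [Nonempty ι]

lemma g_pos (n : ℕ) (c z : ℝ) : 0 < S.g n c z :=
  wavg_pos fun _ _ => Real.exp_pos _

lemma g_le_one (n : ℕ) (c z : ℝ) : S.g n c z ≤ 1 :=
  wavg_le fun _ _ => Real.exp_le_one_iff.2 (by simp)

lemma cg_pos (n : ℕ) (c : ℝ) (w : List ι) (z : ℝ) : 0 < S.cg n c w z := S.g_pos _ _ _

lemma cg_le_one (n : ℕ) (c : ℝ) (w : List ι) (z : ℝ) : S.cg n c w z ≤ 1 := S.g_le_one _ _ _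

omit [Nonempty ι] in
lemma integrable_g (n : ℕ) (c : ℝ) : Integrable (S.g n c) :=
  integrable_wavg fun _ _ => integrable_exp_neg_abs.comp_sub_right _

lemma integral_g (n : ℕ) (c : ℝ) : ∫ z, S.g n c z = 2 := by
  unfold g
  rw [integral_wavg fun _ _ => integrable_exp_neg_abs.comp_sub_right _]
  simp_rw [integral_sub_right_eq_self (fun x => Real.exp (-|x|)), integral_exp_neg_abs,
    wavg_const]

omit [Nonempty ι] in
lemma integrable_cg (n : ℕ) (c : ℝ) (w : List ι) : Integrable (S.cg n c w) :=
  (S.integrable_g n _).comp_sub_right _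

lemma integral_cg (n : ℕ) (c : ℝ) (w : List ι) : ∫ z, S.cg n c w z = 2 := by
  unfold cg
  rw [integral_sub_right_eq_self (S.g n (S.act c w)), integral_g]

lemma g_tail {B c : ℝ} (hB : ∀ y, |y| ≤ 1 → |S.U c y| ≤ B) (n : ℕ) (z : ℝ) :
    S.g n c z ≤ Real.exp (B / S.A ^ n - |z|) := by
  refine wavg_le fun w _ => ?_
  gcongr
  have h1 := abs_sub_abs_le_abs_sub z (S.U c (S.pt w) / S.A ^ n)
  have hA := pow_pos S.A_pos n
  rw [abs_div, abs_of_pos hA] at h1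
  have : |S.U c (S.pt w)| / S.A ^ n ≤ B / S.A ^ n := by
    gcongr
    exact hB _ (S.abs_pt_le w)
  linarith

lemma abs_log_g_sub_le (n : ℕ) (c z z' : ℝ) :
    |Real.log (S.g n c z) - Real.log (S.g n c z')| ≤ |z - z'| := by
  have key : ∀ x y, Real.log (S.g n c x) - Real.log (S.g n c y) ≤ |x - y| := fun x y => by
    have := S.g_shift n c y (x - y)
    rw [add_sub_cancel] at this
    have h2 := Real.log_le_log (S.g_pos n c x) this
    rw [Real.log_mul (Real.exp_pos _).ne' (S.g_pos n c y).ne', Real.log_exp] at h2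
    linarith
  rw [abs_le]
  constructor
  · have := key z' z
    rw [abs_sub_comm] at this
    linarith
  · exact key z z'

end GraphIFS

namespace GraphIFS
variable {ι : Type} [Fintype ι] (S : GraphIFS ι)

/-- Cesàro averages of `f` over the orbit of the slope `0`. -/
noncomputable def orbitAvg (f : ℝ → ℝ) (M : ℕ) : ℝ :=
  (∑ m ∈ Finset.range (M + 1), wavg m fun u => f (S.act 0 u)) / ((M : ℝ) + 1)

/-- An invariant mean on bounded functions of the slope. -/
noncomputable def Lam (f : ℝ → ℝ) : ℝ :=
  limUnder (hyperfilter ℕ : Filter ℕ) (S.orbitAvg f)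

/-- Boundedness on `[-C, C]`. -/
def BddOn (C : ℝ) (f : ℝ → ℝ) : Prop := ∃ R, ∀ c, |c| ≤ C → |f c| ≤ R

lemma BddOn.of_le {C R : ℝ} {f : ℝ → ℝ} (h0 : ∀ c, |c| ≤ C → 0 ≤ f c)
    (h1 : ∀ c, |c| ≤ C → f c ≤ R) : BddOn C f :=
  ⟨R, fun c hc => by rw [abs_of_nonneg (h0 c hc)]; exact h1 c hc⟩

lemma BddOn.add {C : ℝ} {f g : ℝ → ℝ} (hf : BddOn C f) (hg : BddOn C g) :
    BddOn C (fun c => f c + g c) := by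
  obtain ⟨R, hR⟩ := hf
  obtain ⟨R', hR'⟩ := hg
  exact ⟨R + R', fun c hc => (abs_add_le _ _).trans (add_le_add (hR c hc) (hR' c hc))⟩

lemma BddOn.const_mul {C : ℝ} {f : ℝ → ℝ} (r : ℝ) (hf : BddOn C f) :
    BddOn C (fun c => r * f c) := by
  obtain ⟨R, hR⟩ := hf
  exact ⟨|r| * R, fun c hc => by
    rw [abs_mul]; exact mul_le_mul_of_nonneg_left (hR c hc) (abs_nonneg _)⟩

lemma BddOn.const (C r : ℝ) : BddOn C (fun _ => r) := ⟨|r|, fun _ _ => le_rfl⟩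

lemma BddOn.sub {C : ℝ} {f g : ℝ → ℝ} (hf : BddOn C f) (hg : BddOn C g) :
    BddOn C (fun c => f c - g c) := by
  simpa [sub_eq_add_neg] using hf.add (hg.const_mul (-1))

lemma BddOn.sum {κ : Type} {C : ℝ} {f : κ → ℝ → ℝ} (s : Finset κ)
    (hf : ∀ i ∈ s, BddOn C (f i)) : BddOn C (fun c => ∑ i ∈ s, f i c) := by
  classical
  induction s using Finset.induction_on with
  | empty => simpa using BddOn.const C 0
  | insert a s has ih =>
    simp only [Finset.sum_insert has]
    exact (hf a (by simp)).add (ih fun i hi => hf i (by simp [hi]))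

variable [Nonempty ι] {S} {C : ℝ}

lemma SlopeBound.bddOn_wavg (hC : S.SlopeBound C) {f : ℝ → ℝ} (hf : BddOn C f) (j : ℕ) :
    BddOn C (fun c => wavg j fun w => f (S.act c w)) := by
  obtain ⟨R, hR⟩ := hf
  exact ⟨R, fun c hc => abs_wavg_le fun w _ => hR _ (hC.act_le hc w)⟩

namespace SlopeBound
variable (hC : S.SlopeBound C)
include hC

lemma abs_wavg_act_le {f : ℝ → ℝ} {R : ℝ} (hR : ∀ c, |c| ≤ C → |f c| ≤ R) (m : ℕ) :
    |wavg m fun u => f (S.act 0 u)| ≤ R :=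
  abs_wavg_le fun u _ => hR _ (hC.act_le (by simpa using hC.1.le) u)

lemma tendsto_Lam {f : ℝ → ℝ} (hf : BddOn C f) :
    Tendsto (S.orbitAvg f) (hyperfilter ℕ) (𝓝 (S.Lam f)) := by
  obtain ⟨R, hR⟩ := hf
  have hb : ∀ M, S.orbitAvg f M ∈ Set.Icc (-R) R := fun M => by
    rw [Set.mem_Icc, ← abs_le, orbitAvg, abs_div, abs_of_pos (by positivity : (0:ℝ) < M + 1),
      div_le_iff₀ (by positivity)]
    refine (Finset.abs_sum_le_sum_abs _ _).trans ?_
    refine (Finset.sum_le_sum fun m _ => hC.abs_wavg_act_le hR m).trans ?_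
    simp [mul_comm]
  refine tendsto_nhds_limUnder ?_
  obtain ⟨x, -, hx⟩ := (isCompact_Icc (a := -R) (b := R)).ultrafilter_le_nhds
    ((hyperfilter ℕ).map (S.orbitAvg f)) (by
      rw [le_principal_iff]
      exact Filter.mem_map.2 (Filter.univ_mem' hb))
  exact ⟨x, hx⟩

lemma Lam_mono {f g : ℝ → ℝ} (hf : BddOn C f) (hg : BddOn C g)
    (h : ∀ c, |c| ≤ C → f c ≤ g c) : S.Lam f ≤ S.Lam g := by
  refine le_of_tendsto_of_tendsto' (hC.tendsto_Lam hf) (hC.tendsto_Lam hg) fun M => ?_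
  unfold orbitAvg
  gcongr with m
  exact wavg_mono fun u _ => h _ (hC.act_le (by simpa using hC.1.le) u)

lemma Lam_add {f g : ℝ → ℝ} (hf : BddOn C f) (hg : BddOn C g) :
    S.Lam (fun c => f c + g c) = S.Lam f + S.Lam g := by
  refine tendsto_nhds_unique (hC.tendsto_Lam (hf.add hg)) ?_
  convert (hC.tendsto_Lam hf).add (hC.tendsto_Lam hg) using 2 with M
  simp only [orbitAvg, wavg_add, Finset.sum_add_distrib, add_div]

lemma Lam_const_mul {f : ℝ → ℝ} (r : ℝ) (hf : BddOn C f) :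
    S.Lam (fun c => r * f c) = r * S.Lam f := by
  refine tendsto_nhds_unique (hC.tendsto_Lam (hf.const_mul r)) ?_
  convert (hC.tendsto_Lam hf).const_mul r using 2 with M
  simp only [orbitAvg, wavg_mul_left, ← Finset.mul_sum, mul_div_assoc]

lemma Lam_const (r : ℝ) : S.Lam (fun _ => r) = r := by
  refine tendsto_nhds_unique (hC.tendsto_Lam (BddOn.const C r)) ?_
  refine tendsto_const_nhds.congr fun M => ?_
  have : (M : ℝ) + 1 ≠ 0 := by positivity
  simp only [orbitAvg, wavg_const, Finset.sum_const, Finset.card_range, nsmul_eq_mul]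
  push_cast
  field_simp

lemma Lam_sub {f g : ℝ → ℝ} (hf : BddOn C f) (hg : BddOn C g) :
    S.Lam (fun c => f c - g c) = S.Lam f - S.Lam g := by
  have := hC.Lam_add hf (hg.const_mul (-1))
  rw [hC.Lam_const_mul _ hg] at this
  simpa [sub_eq_add_neg] using this

lemma Lam_sum {κ : Type} {f : κ → ℝ → ℝ} (s : Finset κ) (hf : ∀ i ∈ s, BddOn C (f i)) :
    S.Lam (fun c => ∑ i ∈ s, f i c) = ∑ i ∈ s, S.Lam (f i) := by
  classical
  induction s using Finset.induction_on with
  | empty => simpa using hC.Lam_const 0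
  | insert a s has ih =>
    simp only [Finset.sum_insert has]
    rw [hC.Lam_add (hf a (by simp)) (BddOn.sum s fun i hi => hf i (by simp [hi])),
      ih fun i hi => hf i (by simp [hi])]

lemma Lam_nonneg {f : ℝ → ℝ} (hf : BddOn C f) (h : ∀ c, |c| ≤ C → 0 ≤ f c) : 0 ≤ S.Lam f := by
  simpa [hC.Lam_const] using hC.Lam_mono (BddOn.const C 0) hf h

lemma Lam_wavg_one {f : ℝ → ℝ} (hf : BddOn C f) :
    S.Lam (fun c => wavg 1 fun w => f (S.act c w)) = S.Lam f := by
  have hg := hC.bddOn_wavg hf 1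
  rw [← sub_eq_zero, ← hC.Lam_sub hg hf]
  refine tendsto_nhds_unique (hC.tendsto_Lam (hg.sub hf)) ?_
  obtain ⟨R, hR⟩ := hf
  refine Tendsto.mono_left ?_ (Nat.hyperfilter_le_atTop)
  have h0 : Tendsto (fun M : ℕ => 2 * R / ((M : ℝ) + 1)) atTop (𝓝 0) :=
    tendsto_const_nhds.div_atTop
      (tendsto_atTop_add_const_right _ _ tendsto_natCast_atTop_atTop)
  refine squeeze_zero_norm (fun M => ?_) h0
  have : ∀ m, (wavg m fun u => (wavg 1 fun w => f (S.act (S.act 0 u) w)) - f (S.act 0 u))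
      = (wavg (m + 1) fun u => f (S.act 0 u)) - wavg m fun u => f (S.act 0 u) := fun m => by
    rw [wavg_sub, wavg_append]
    simp_rw [S.act_append]
  simp only [orbitAvg, this]
  rw [Finset.sum_range_sub (fun m => wavg m fun u => f (S.act 0 u)), Real.norm_eq_abs, abs_div,
    abs_of_pos (by positivity : (0:ℝ) < M + 1)]
  gcongr
  have h1 := hC.abs_wavg_act_le hR (M + 1)
  have h2 := hC.abs_wavg_act_le hR 0
  have := abs_sub (wavg (M + 1) fun u => f (S.act 0 u)) (wavg 0 fun u => f (S.act 0 u))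
  linarith

lemma Lam_wavg {f : ℝ → ℝ} (hf : BddOn C f) (j : ℕ) :
    S.Lam (fun c => wavg j fun w => f (S.act c w)) = S.Lam f := by
  induction j with
  | zero => simp [wavg_zero]
  | succ j ih =>
    rw [← ih, ← hC.Lam_wavg_one (hC.bddOn_wavg hf j)]
    congr 1
    ext c
    rw [add_comm, wavg_append]
    simp_rw [S.act_append]

end SlopeBound
end GraphIFS

lemma sq_le_of_abs_log_sub_gt {x y τ η : ℝ} (hx : Real.exp (-τ) ≤ x) (hy : Real.exp (-τ) ≤ y)
    (hη : 0 < η) (h : η < |Real.log x - Real.log y|) :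
    1 ≤ Real.exp (2 * τ) / η ^ 2 * (x - y) ^ 2 := by
  have hpos := Real.exp_pos (-τ)
  have key : ∀ u v : ℝ, Real.exp (-τ) ≤ u → Real.exp (-τ) ≤ v →
      Real.log u - Real.log v ≤ |u - v| * Real.exp τ := fun u v hu hv => by
    have hu0 := hpos.trans_le hu
    have hv0 := hpos.trans_le hv
    rw [← Real.log_div hu0.ne' hv0.ne']
    refine (Real.log_le_sub_one_of_pos (div_pos hu0 hv0)).trans ?_
    rw [div_sub_one hv0.ne', div_le_iff₀ hv0]
    have h1 : 1 ≤ Real.exp τ * v := by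
      have := mul_le_mul_of_nonneg_left hv (Real.exp_pos τ).le
      rwa [← Real.exp_add, add_neg_cancel, Real.exp_zero] at this
    calc u - v ≤ |u - v| * 1 := by rw [mul_one]; exact le_abs_self _
      _ ≤ |u - v| * (Real.exp τ * v) := by gcongr
      _ = _ := by ring
  have h2 : η < |x - y| * Real.exp τ := by
    refine h.trans_le (abs_le.2 ⟨?_, key x y hx hy⟩)
    have := key y x hy hx
    rw [abs_sub_comm] at this
    linarith
  rw [div_mul_eq_mul_div, le_div_iff₀ (by positivity), one_mul, two_mul, Real.exp_add,
    ← sq_abs (x - y)]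
  nlinarith [abs_nonneg (x - y), Real.exp_pos τ]

namespace GraphIFS
variable {ι : Type} [Fintype ι] (S : GraphIFS ι)

/-- A convex functional measuring the fluctuation of `g n c` at unit distances. -/
noncomputable def V (𝒯 : Finset ℝ) (n : ℕ) (c : ℝ) : ℝ :=
  ∑ t ∈ 𝒯, ∫ z, S.g n c (z + t) ^ 2 / S.g n c z

/-- The loss of `V` when passing from the cylinders of length `j` to their average. -/
noncomputable def gap (𝒯 : Finset ℝ) (j n : ℕ) (c : ℝ) : ℝ :=
  (wavg j fun w => S.V 𝒯 n (S.act c w)) - S.V 𝒯 (j + n) c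

/-- The logarithmic increment of the part of `g` in the cylinder of `w`. -/
noncomputable def incr (n : ℕ) (c : ℝ) (w : List ι) (z t : ℝ) : ℝ :=
  Real.log (S.cg n c w (z + t)) - Real.log (S.cg n c w z)

/-- The set where the increments in the cylinder of `w` deviate from those of the whole. -/
def dev (𝒯 : Finset ℝ) (η : ℝ) (n : ℕ) (c : ℝ) (w : List ι) : Set ℝ :=
  {z | ∃ t ∈ 𝒯, η < |S.incr n c w z t - S.incr (w.length + n) c [] z t|}

variable [Nonempty ι]

lemma continuous_incr (n : ℕ) (c : ℝ) (w : List ι) (t : ℝ) :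
    Continuous fun z => S.incr n c w z t := by
  have h := S.continuous_cg n c w
  unfold incr
  refine Continuous.sub ?_ ?_
  · exact (h.comp (by fun_prop)).log fun z => (S.cg_pos _ _ _ _).ne'
  · exact h.log fun z => (S.cg_pos _ _ _ _).ne'

lemma abs_incr_sub_le (n : ℕ) (c : ℝ) (w : List ι) (z t t' : ℝ) :
    |S.incr n c w z t - S.incr n c w z t'| ≤ |t - t'| := by
  have := S.abs_log_g_sub_le n (S.act c w) (z + t - S.U c (S.pt w) / S.A ^ (w.length + n))
    (z + t' - S.U c (S.pt w) / S.A ^ (w.length + n))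
  unfold incr cg
  convert this using 2 <;> ring

lemma isOpen_dev (𝒯 : Finset ℝ) (η : ℝ) (n : ℕ) (c : ℝ) (w : List ι) :
    IsOpen (S.dev 𝒯 η n c w) := by
  have : S.dev 𝒯 η n c w
      = ⋃ t ∈ 𝒯, {z | η < |S.incr n c w z t - S.incr (w.length + n) c [] z t|} := by
    ext z; simp [dev]
  rw [this]
  refine isOpen_biUnion fun t _ => isOpen_lt continuous_const ?_
  exact ((S.continuous_incr _ _ _ _).sub (S.continuous_incr _ _ _ _)).abs

omit [Nonempty ι] in
lemma integrable_of_le_cg {n : ℕ} {c : ℝ} {w : List ι} {f : ℝ → ℝ} (hf : Measurable f) (r : ℝ)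
    (h0 : ∀ z, 0 ≤ f z) (h : ∀ z, f z ≤ r * S.cg n c w z) : Integrable f :=
  ((S.integrable_cg n c w).const_mul r).mono' hf.aestronglyMeasurable
    (Filter.Eventually.of_forall fun z => by rw [Real.norm_of_nonneg (h0 z)]; exact h z)

omit [Nonempty ι] in
lemma integrable_of_le_g {n : ℕ} {c : ℝ} {f : ℝ → ℝ} (hf : Measurable f) (r : ℝ)
    (h0 : ∀ z, 0 ≤ f z) (h : ∀ z, f z ≤ r * S.g n c z) : Integrable f :=
  S.integrable_of_le_cg (n := n) (c := c) (w := []) hf r h0 (by simpa [cg_nil] using h)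

lemma sq_div_cg_le (n : ℕ) (c : ℝ) (w : List ι) (z t : ℝ) :
    S.cg n c w (z + t) ^ 2 / S.cg n c w z ≤ Real.exp (2 * |t|) * S.cg n c w z := by
  have h0 := S.cg_pos n c w z
  rw [div_le_iff₀ h0, two_mul, Real.exp_add]
  have := S.cg_shift n c w z t
  have h1 := S.cg_pos n c w (z + t)
  nlinarith

omit [Nonempty ι] in
lemma measurable_sq_div (n : ℕ) (c : ℝ) (w : List ι) (t : ℝ) :
    Measurable fun z => S.cg n c w (z + t) ^ 2 / S.cg n c w z := by
  have h := (S.continuous_cg n c w).measurable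
  have h' : Measurable fun z => S.cg n c w (z + t) := h.comp (by fun_prop)
  exact (h'.pow_const 2).div h

lemma integrable_sq_div (n : ℕ) (c : ℝ) (w : List ι) (t : ℝ) :
    Integrable fun z => S.cg n c w (z + t) ^ 2 / S.cg n c w z :=
  S.integrable_of_le_cg (S.measurable_sq_div n c w t) _
    (fun _ => div_nonneg (sq_nonneg _) (S.cg_pos _ _ _ _).le) (S.sq_div_cg_le n c w · t)

omit [Nonempty ι] in
lemma V_act (𝒯 : Finset ℝ) (n : ℕ) (c : ℝ) (w : List ι) :
    S.V 𝒯 n (S.act c w) = ∑ t ∈ 𝒯, ∫ z, S.cg n c w (z + t) ^ 2 / S.cg n c w z := by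
  refine Finset.sum_congr rfl fun t _ => ?_
  unfold cg
  rw [← integral_sub_right_eq_self (fun z => S.g n (S.act c w) (z + t) ^ 2 / S.g n (S.act c w) z)
    (S.U c (S.pt w) / S.A ^ (w.length + n))]
  congr 1; ext
  rw [add_sub_right_comm]

lemma V_nonneg (𝒯 : Finset ℝ) (n : ℕ) (c : ℝ) : 0 ≤ S.V 𝒯 n c :=
  Finset.sum_nonneg fun _ _ => integral_nonneg fun _ =>
    div_nonneg (sq_nonneg _) (S.g_pos _ _ _).le

lemma V_le (𝒯 : Finset ℝ) (n : ℕ) (c : ℝ) : S.V 𝒯 n c ≤ ∑ t ∈ 𝒯, Real.exp (2 * |t|) * 2 := by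
  rw [← S.act_nil c, S.V_act]
  refine Finset.sum_le_sum fun t _ => ?_
  refine le_of_le_of_eq ?_ (by rw [integral_const_mul, S.integral_cg n c []] :
    ∫ z, Real.exp (2 * |t|) * S.cg n c [] z = Real.exp (2 * |t|) * 2)
  exact integral_mono (S.integrable_sq_div _ _ _ _) ((S.integrable_cg _ _ _).const_mul _)
    (S.sq_div_cg_le n c [] · t)

lemma bddOn_V (𝒯 : Finset ℝ) (n : ℕ) (C : ℝ) : BddOn C (S.V 𝒯 n) :=
  BddOn.of_le (fun c _ => S.V_nonneg 𝒯 n c) fun c _ => S.V_le 𝒯 n c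

lemma wavg_sq_dev (j n : ℕ) (c z t : ℝ) :
    (wavg j fun w => S.cg n c w z *
      (S.cg n c w (z + t) / S.cg n c w z - S.g (j + n) c (z + t) / S.g (j + n) c z) ^ 2)
    = (wavg j fun w => S.cg n c w (z + t) ^ 2 / S.cg n c w z)
      - S.g (j + n) c (z + t) ^ 2 / S.g (j + n) c z := by
  set r := S.g (j + n) c (z + t) / S.g (j + n) c z with hr
  have hg := (S.g_pos (j + n) c z).ne'
  have h1 : ∀ w : List ι, w.length = j → S.cg n c w z * (S.cg n c w (z + t) / S.cg n c w z - r) ^ 2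
      = S.cg n c w (z + t) ^ 2 / S.cg n c w z - 2 * r * S.cg n c w (z + t)
        + r ^ 2 * S.cg n c w z := fun w _ => by
    have := (S.cg_pos n c w z).ne'
    field_simp
    ring
  rw [wavg_congr h1, wavg_add, wavg_sub, wavg_mul_left, wavg_mul_left, ← S.g_add, ← S.g_add, hr]
  field_simp
  ring

lemma gap_eq (𝒯 : Finset ℝ) (j n : ℕ) (c : ℝ) :
    S.gap 𝒯 j n c = ∫ z, ∑ t ∈ 𝒯, wavg j fun w => S.cg n c w z *
      (S.cg n c w (z + t) / S.cg n c w z - S.g (j + n) c (z + t) / S.g (j + n) c z) ^ 2 := by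
  simp_rw [wavg_sq_dev]
  have hi : ∀ t, Integrable fun z => wavg j fun w => S.cg n c w (z + t) ^ 2 / S.cg n c w z :=
    fun t => integrable_wavg fun w _ => S.integrable_sq_div n c w t
  have hj : ∀ t, Integrable fun z => S.g (j + n) c (z + t) ^ 2 / S.g (j + n) c z := fun t => by
    simpa [cg_nil] using S.integrable_sq_div (j + n) c [] t
  rw [integral_finsetSum _ fun i _ => by exact (hi i).sub (hj i)]
  simp_rw [integral_sub (hi _) (hj _), Finset.sum_sub_distrib, gap, V_act]
  rw [wavg_finset_sum, V]
  congr 1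
  refine Finset.sum_congr rfl fun t _ => ?_
  rw [integral_wavg fun w _ => S.integrable_sq_div n c w t]

lemma dev_indicator_le {𝒯 : Finset ℝ} {τ η : ℝ} (h𝒯 : ∀ t ∈ 𝒯, |t| ≤ τ) (hη : 0 < η)
    (j n : ℕ) (c : ℝ) (w : List ι) (hw : w.length = j) (z : ℝ) :
    (S.dev 𝒯 η n c w).indicator (S.cg n c w) z ≤ Real.exp (2 * τ) / η ^ 2 *
      ∑ t ∈ 𝒯, S.cg n c w z *
      (S.cg n c w (z + t) / S.cg n c w z - S.g (j + n) c (z + t) / S.g (j + n) c z) ^ 2 := by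
  have h0 := S.cg_pos n c w z
  have hg0 := S.g_pos (j + n) c z
  refine Set.indicator_apply_le' (fun hz => ?_) fun _ => by positivity
  obtain ⟨t, ht, hlt⟩ := hz
  have hlow : ∀ (m : ℕ) (v : List ι), Real.exp (-τ) ≤ S.cg m c v (z + t) / S.cg m c v z :=
    fun m v => by
      rw [le_div_iff₀ (S.cg_pos _ _ _ _)]
      have h1 := S.cg_shift m c v (z + t) (-t)
      rw [add_neg_cancel_right, abs_neg] at h1
      have h2 : S.cg m c v z ≤ Real.exp τ * S.cg m c v (z + t) :=
        h1.trans (mul_le_mul_of_nonneg_right (Real.exp_le_exp.2 (h𝒯 t ht)) (S.cg_pos _ _ _ _).le)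
      calc Real.exp (-τ) * S.cg m c v z
          ≤ Real.exp (-τ) * (Real.exp τ * S.cg m c v (z + t)) := by gcongr
        _ = _ := by rw [← mul_assoc, ← Real.exp_add, neg_add_cancel, Real.exp_zero, one_mul]
  have h2 := hlow (j + n) []
  rw [cg_nil, cg_nil] at h2
  have h3 := sq_le_of_abs_log_sub_gt (hlow n w) h2 hη (by
    rw [Real.log_div (S.cg_pos _ _ _ _).ne' h0.ne', Real.log_div (S.g_pos _ _ _).ne' hg0.ne']
    simpa [incr, cg_nil, hw] using hlt)
  have h4 := Finset.single_le_sum (f := fun t => S.cg n c w z *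
      (S.cg n c w (z + t) / S.cg n c w z - S.g (j + n) c (z + t) / S.g (j + n) c z) ^ 2)
      (fun i _ => by positivity) ht
  have h5 : 0 ≤ Real.exp (2 * τ) / η ^ 2 := by positivity
  refine le_trans ?_ (mul_le_mul_of_nonneg_left h4 h5)
  nlinarith

omit [Nonempty ι] in
lemma integrable_indicator_cg {s : Set ℝ} (hs : MeasurableSet s) (n : ℕ) (c : ℝ) (w : List ι) :
    Integrable (s.indicator (S.cg n c w)) := (S.integrable_cg n c w).indicator hs

lemma wavg_dev_le {𝒯 : Finset ℝ} {τ η : ℝ} (h𝒯 : ∀ t ∈ 𝒯, |t| ≤ τ) (hη : 0 < η)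
    (j n : ℕ) (c : ℝ) :
    (wavg j fun w => ∫ z, (S.dev 𝒯 η n c w).indicator (S.cg n c w) z)
      ≤ Real.exp (2 * τ) / η ^ 2 * S.gap 𝒯 j n c := by
  have hi : ∀ w : List ι, w.length = j →
      Integrable ((S.dev 𝒯 η n c w).indicator (S.cg n c w)) :=
    fun w _ => S.integrable_indicator_cg (S.isOpen_dev _ _ _ _ _).measurableSet n c w
  rw [← integral_wavg hi, gap_eq, ← integral_const_mul]
  refine integral_mono (integrable_wavg hi) (Integrable.const_mul ?_ _) fun z => ?_
  · simp_rw [wavg_sq_dev]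
    refine integrable_finsetSum _ fun t _ => Integrable.sub ?_ ?_
    · exact integrable_wavg fun w _ => S.integrable_sq_div n c w t
    · simpa [cg_nil] using S.integrable_sq_div (j + n) c [] t
  · simp only
    rw [← wavg_finset_sum, ← wavg_mul_left]
    exact wavg_mono fun w hw => S.dev_indicator_le h𝒯 hη j n c w hw z

lemma gap_nonneg (𝒯 : Finset ℝ) (j n : ℕ) (c : ℝ) : 0 ≤ S.gap 𝒯 j n c := by
  rw [gap_eq]
  exact integral_nonneg fun z => Finset.sum_nonneg fun t _ => wavg_nonneg fun w _ =>
    mul_nonneg (S.cg_pos _ _ _ _).le (sq_nonneg _)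

variable {S} {C : ℝ}

lemma SlopeBound.bddOn_gap (hC : S.SlopeBound C) (𝒯 : Finset ℝ) (j n : ℕ) :
    BddOn C (S.gap 𝒯 j n) :=
  (hC.bddOn_wavg (S.bddOn_V 𝒯 n C) j).sub (S.bddOn_V 𝒯 (j + n) C)

lemma SlopeBound.Lam_gap (hC : S.SlopeBound C) (𝒯 : Finset ℝ) (j n : ℕ) :
    S.Lam (S.gap 𝒯 j n) = S.Lam (S.V 𝒯 n) - S.Lam (S.V 𝒯 (j + n)) := by
  unfold gap
  rw [hC.Lam_sub (hC.bddOn_wavg (S.bddOn_V 𝒯 n C) j) (S.bddOn_V 𝒯 (j + n) C),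
    hC.Lam_wavg (S.bddOn_V 𝒯 n C)]

lemma SlopeBound.exists_Lam_gap_le (hC : S.SlopeBound C) (𝒯 : Finset ℝ) {δ : ℝ} (hδ : 0 < δ) :
    ∃ n₀, ∀ n ≥ n₀, ∀ j, S.Lam (S.gap 𝒯 j n) ≤ δ := by
  set F : ℕ → ℝ := fun n => S.Lam (S.V 𝒯 n) with hF
  have hanti : Antitone F := antitone_nat_of_succ_le fun n => by
    have h1 := hC.Lam_nonneg (hC.bddOn_gap 𝒯 1 n) fun c _ => S.gap_nonneg 𝒯 1 n c
    rw [hC.Lam_gap, add_comm 1 n] at h1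
    simpa [hF] using h1
  have h0 : ∀ n, 0 ≤ F n := fun n => hC.Lam_nonneg (S.bddOn_V 𝒯 n C) fun c _ => S.V_nonneg 𝒯 n c
  have hbdd : BddBelow (Set.range F) := ⟨0, by rintro _ ⟨n, rfl⟩; exact h0 n⟩
  obtain ⟨n₀, hn₀⟩ := exists_lt_of_ciInf_lt (show iInf F < iInf F + δ by linarith)
  refine ⟨n₀, fun n hn j => ?_⟩
  rw [hC.Lam_gap]
  have h1 := ciInf_le hbdd (j + n)
  have h2 := hanti hn
  simp only [hF] at h1 h2 hn₀ ⊢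
  linarith

end GraphIFS

lemma exists_growth {Q : ℝ → ℝ} {e κ δ ℓ τ t₀ : ℝ} (hQ : ∀ t t', |Q t - Q t'| ≤ |t - t'|)
    (hQ0 : Q 0 = 0) (he0 : e ≠ 0) (he : |e| ≤ 1 / 16) (hℓ : 1 ≤ ℓ) (hτ : ℓ + 1 ≤ τ)
    (hstep : ∀ t, |t| ≤ τ → |Q (t + e) - Q t - κ| ≤ δ) (hδ : δ ≤ |e| / (32 * ℓ))
    (ht₀ : |t₀| ≤ ℓ) (hQt₀ : 1 / 4 ≤ |Q t₀|) :
    ∃ t, |t| ≤ τ ∧ τ / (16 * ℓ) - 1 ≤ Q t := by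
  have hepos : 0 < |e| := abs_pos.2 he0
  have hδ0 : 0 ≤ δ := (abs_nonneg _).trans (hstep 0 (by simp; linarith))
  have hnat : ∀ k : ℕ, k * |e| ≤ τ → |Q (k * e) - k * κ| ≤ k * δ ∧
      |Q (-k * e) + k * κ| ≤ k * δ := by
    intro k
    induction k with
    | zero => intro _; simp [hQ0]
    | succ k ih =>
      intro hk
      push_cast at hk ⊢
      have hk' : (k : ℝ) * |e| ≤ τ := by nlinarith
      obtain ⟨h1, h2⟩ := ih hk'
      have h3 := hstep (k * e) (by rw [abs_mul, Nat.abs_cast]; exact hk')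
      have h4 := hstep (-(k + 1) * e) (by
        rw [abs_mul, abs_neg, abs_of_pos (by positivity : (0:ℝ) < k + 1)]; exact hk)
      rw [show k * e + e = (k + 1) * e by ring] at h3
      rw [show -(k + 1) * e + e = -k * e by ring] at h4
      rw [abs_le] at h1 h2 h3 h4 ⊢
      rw [abs_le]
      constructor <;> constructor <;> linarith [h1.1, h1.2, h2.1, h2.2, h3.1, h3.2, h4.1, h4.2]
  have hinteg : ∀ k : ℤ, |(k : ℝ)| * |e| ≤ τ → |Q (k * e) - k * κ| ≤ |(k : ℝ)| * δ := by
    intro k hk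
    obtain ⟨n, rfl | rfl⟩ := k.eq_nat_or_neg
    · simp only [Int.cast_natCast, Nat.abs_cast] at hk ⊢
      exact (hnat n hk).1
    · simp only [Int.cast_neg, Int.cast_natCast, abs_neg, Nat.abs_cast] at hk ⊢
      have := (hnat n hk).2
      rwa [neg_mul (n : ℝ) κ, sub_neg_eq_add]
  have hκ : |e| / (8 * ℓ) ≤ |κ| := by
    set k := round (t₀ / e)
    have hk : |t₀ - k * e| ≤ |e| / 2 := by
      have h1 := abs_sub_round (t₀ / e)
      have h2 : t₀ - k * e = (t₀ / e - k) * e := by field_simp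
      rw [h2, abs_mul]
      nlinarith
    have hk2 : |(k : ℝ)| * |e| ≤ ℓ + 1 / 32 := by
      have h1 := abs_sub_abs_le_abs_sub (k * e) t₀
      rw [abs_sub_comm, abs_mul] at h1
      linarith
    have h1 := hinteg k (by linarith)
    have h2 := hQ t₀ (k * e)
    have h3 : 7 / 32 ≤ |(k : ℝ)| * (|κ| + δ) := by
      have h4 : |Q t₀| ≤ |Q t₀ - Q (k * e)| + |Q (k * e) - k * κ| + |k * κ| := by
        have := abs_add_three (Q t₀ - Q (k * e)) (Q (k * e) - k * κ) (k * κ)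
        rwa [sub_add_sub_cancel, sub_add_cancel] at this
      rw [abs_mul] at h4
      linarith
    have h5 : 7 / 32 * |e| ≤ (ℓ + 1 / 32) * (|κ| + δ) := by
      have h6 : 0 ≤ |κ| + δ := add_nonneg (abs_nonneg _) hδ0
      calc 7 / 32 * |e| ≤ |(k : ℝ)| * (|κ| + δ) * |e| := by gcongr
        _ = |(k : ℝ)| * |e| * (|κ| + δ) := by ring
        _ ≤ _ := by gcongr
    have h7 : (ℓ + 1 / 32) * (|κ| + δ) ≤ 33 / 32 * ℓ * (|κ| + δ) := by
      gcongr; linarith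
    rw [le_div_iff₀ (by positivity)] at hδ
    rw [div_le_iff₀ (by positivity)]
    nlinarith
  have hgain : |e| / (16 * ℓ) ≤ |κ| - δ := by
    have h1 : |e| / (8 * ℓ) = 4 * (|e| / (32 * ℓ)) := by field_simp; norm_num
    have h2 : |e| / (16 * ℓ) = 2 * (|e| / (32 * ℓ)) := by field_simp; norm_num
    have : 0 ≤ |e| / (32 * ℓ) := by positivity
    linarith
  set n := ⌊τ / |e|⌋₊
  have hn1 : n * |e| ≤ τ := by
    rw [← le_div_iff₀ hepos]; exact Nat.floor_le (div_nonneg (by linarith) hepos.le)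
  have hn2 : τ / |e| - 1 ≤ n := by linarith [Nat.lt_floor_add_one (τ / |e|)]
  obtain ⟨h1, h2⟩ := hnat n hn1
  have h3 : τ / (16 * ℓ) - 1 ≤ n * (|κ| - δ) := by
    have h4 : (τ / |e| - 1) * (|e| / (16 * ℓ)) ≤ n * (|κ| - δ) := by
      refine mul_le_mul hn2 hgain (by positivity) (by positivity)
    have h5 : (τ / |e| - 1) * (|e| / (16 * ℓ)) = τ / (16 * ℓ) - |e| / (16 * ℓ) := by
      field_simp
    have h6 : |e| / (16 * ℓ) ≤ 1 := by
      rw [div_le_one (by positivity)]; linarith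
    linarith
  rw [abs_le] at h1 h2
  rcases abs_cases κ with ⟨hk, -⟩ | ⟨hk, -⟩
  · refine ⟨n * e, by rw [abs_mul, Nat.abs_cast]; exact hn1, ?_⟩
    rw [hk] at h3; linarith [h1.1]
  · refine ⟨-n * e, by rw [abs_mul, abs_neg, Nat.abs_cast]; exact hn1, ?_⟩
    rw [hk] at h3; linarith [h2.1]

namespace GraphIFS
variable {ι : Type} [Fintype ι] (S : GraphIFS ι)

/-- The set where `log (g n c)` varies by more than `r` at distance at most `ℓ`. -/
def ev (r ℓ : ℝ) (n : ℕ) (c : ℝ) : Set ℝ := {z | ∃ t, |t| ≤ ℓ ∧ r < |S.incr n c [] z t|}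

open Classical in
/-- The contribution to `g (n + 1) c` of the letters that do not dominate. -/
noncomputable def minor (ε : ℝ) (n : ℕ) (c z : ℝ) : ℝ :=
  (∑ a, if S.cg n c [a] z ≤ (1 - ε) * (Fintype.card ι * S.g (n + 1) c z)
    then S.cg n c [a] z else 0) / Fintype.card ι

variable [Nonempty ι]

lemma isOpen_ev (r ℓ : ℝ) (n : ℕ) (c : ℝ) : IsOpen (S.ev r ℓ n c) := by
  have : S.ev r ℓ n c = ⋃ t, ⋃ (_ : |t| ≤ ℓ), {z | r < |S.incr n c [] z t|} := by
    ext z; simp [ev]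
  rw [this]
  exact isOpen_iUnion fun t => isOpen_iUnion fun _ =>
    isOpen_lt continuous_const (S.continuous_incr _ _ _ _).abs

lemma minor_nonneg (ε : ℝ) (n : ℕ) (c z : ℝ) : 0 ≤ S.minor ε n c z := by
  refine div_nonneg (Finset.sum_nonneg fun a _ => ?_) (by positivity)
  split_ifs
  exacts [(S.cg_pos _ _ _ _).le, le_rfl]

lemma minor_le (ε : ℝ) (n : ℕ) (c z : ℝ) : S.minor ε n c z ≤ S.g (n + 1) c z := by
  rw [g_add_one, minor]
  gcongr with a
  split_ifs
  exacts [le_rfl, (S.cg_pos _ _ _ _).le]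

omit [Nonempty ι] in
lemma measurable_minor (ε : ℝ) (n : ℕ) (c : ℝ) : Measurable (S.minor ε n c) := by
  refine Measurable.div_const (Finset.measurable_sum _ fun a _ => ?_) _
  have h1 := (S.continuous_cg n c [a]).measurable
  have h2 := (S.continuous_g (n + 1) c).measurable
  exact Measurable.ite (measurableSet_le h1 (by fun_prop)) h1 measurable_const

lemma incr_slope_le (n : ℕ) (c θ : ℝ) (w : List ι) (z t : ℝ) :
    |S.incr n c w z t - S.incr n (c + θ * S.A ^ (w.length + n)) w (z - θ * S.pt w) t|
      ≤ 2 * (|θ| * S.b ^ w.length) := by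
  set c' := c + θ * S.A ^ (w.length + n) with hc'
  have key : ∀ y, |Real.log (S.cg n c w y) - Real.log (S.cg n c' w (y - θ * S.pt w))|
      ≤ |θ| * S.b ^ w.length := fun y => by
    have h1 := S.cg_slope n c θ w (y - θ * S.pt w)
    have h2 := S.cg_slope' n c θ w (y - θ * S.pt w)
    rw [sub_add_cancel] at h1 h2
    have h3 := Real.log_le_log (S.cg_pos _ _ _ _) h1
    have h4 := Real.log_le_log (S.cg_pos _ _ _ _) h2
    rw [Real.log_mul (Real.exp_pos _).ne' (S.cg_pos _ _ _ _).ne', Real.log_exp] at h3 h4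
    rw [abs_le]; constructor <;> linarith
  have h1 := key (z + t)
  have h2 := key z
  rw [show z + t - θ * S.pt w = z - θ * S.pt w + t by ring] at h1
  unfold incr
  rw [abs_le] at h1 h2 ⊢
  constructor <;> linarith [h1.1, h1.2, h2.1, h2.2]

/-- The set where the word `w` is atypical for the slope `c` or for the perturbed slope. -/
def atyp (𝒯 : Finset ℝ) (η : ℝ) (n : ℕ) (c θ : ℝ) (w : List ι) : Set ℝ :=
  S.dev 𝒯 η n c w ∪
    (fun z => z - θ * S.pt w) ⁻¹' S.dev 𝒯 η n (c + θ * S.A ^ (w.length + n)) w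

lemma isOpen_atyp (𝒯 : Finset ℝ) (η : ℝ) (n : ℕ) (c θ : ℝ) (w : List ι) :
    IsOpen (S.atyp 𝒯 η n c θ w) :=
  (S.isOpen_dev _ _ _ _ _).union ((S.isOpen_dev _ _ _ _ _).preimage (by fun_prop))

lemma g_le_of_two_typical {𝒯 : Finset ℝ} {τ ϖ η ℓ θ δ c z : ℝ} {m n : ℕ}
    (hdense : ∀ t, |t| ≤ τ → ∃ t' ∈ 𝒯, |t - t'| ≤ ϖ) (hϖ : ϖ ≤ 1)
    (hℓ : 1 ≤ ℓ) (hτ : ℓ + 1 ≤ τ) (w w' : List ι) (hw : w.length = m) (hw' : w'.length = m)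
    (he0 : 0 < |θ * (S.pt w - S.pt w')|)
    (he : |θ * (S.pt w - S.pt w')| ≤ 1 / 16)
    (hδ : δ ≤ |θ * (S.pt w - S.pt w')| / (32 * ℓ))
    (hδ' : 4 * (η + |θ| * S.b ^ m + ϖ) ≤ δ)
    (hz : z ∈ S.ev (1 / 2) ℓ (m + n) c) (hzw : z ∉ S.atyp 𝒯 η n c θ w)
    (hzw' : z ∉ S.atyp 𝒯 η n c θ w') :
    S.g (m + n) c z ≤ Real.exp (3 - τ / (16 * ℓ)) * ∑ t ∈ 𝒯, S.g (m + n) c (z + t) := by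
  set c' := c + θ * S.A ^ (m + n) with hc'
  set e := θ * (S.pt w - S.pt w') with hedef
  have hδ1 : δ ≤ 1 / 2 := hδ.trans (by rw [div_le_iff₀ (by positivity)]; linarith)
  have claim : ∀ v : List ι, v.length = m → z ∉ S.atyp 𝒯 η n c θ v → ∀ t, |t| ≤ τ →
      |S.incr (m + n) c [] z t - S.incr (m + n) c' [] (z - θ * S.pt v) t| ≤ δ / 2 := by
    intro v hv hzv t ht
    obtain ⟨t', ht', htt'⟩ := hdense t ht
    simp only [atyp, Set.mem_union, not_or, dev, Set.mem_ofPred_eq, Set.mem_preimage, not_exists,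
      not_and, not_lt, hv] at hzv
    have h1 := hzv.1 t' ht'
    have h2 := hzv.2 t' ht'
    have h3 := S.incr_slope_le n c θ v z t'
    rw [hv] at h3
    have h4 := S.abs_incr_sub_le (m + n) c [] z t t'
    have h5 := S.abs_incr_sub_le (m + n) c' [] (z - θ * S.pt v) t t'
    rw [← hc'] at h2 h3
    replace h4 := h4.trans htt'
    replace h5 := h5.trans htt'
    rw [abs_le] at h1 h2 h3 h4 h5 ⊢
    constructor <;> linarith [h1.1, h1.2, h2.1, h2.2, h3.1, h3.2, h4.1, h4.2, h5.1, h5.2]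
  have c1 := claim w hw hzw
  have c2 := claim w' hw' hzw'
  set Q : ℝ → ℝ := S.incr (m + n) c' [] (z - θ * S.pt w) with hQ
  have hshift : ∀ t, S.incr (m + n) c' [] (z - θ * S.pt w') t = Q (t + e) - Q e := fun t => by
    have h1 : z - θ * S.pt w' = z - θ * S.pt w + e := by rw [hedef]; ring
    rw [hQ, h1]
    simp only [incr]
    rw [show z - θ * S.pt w + e + t = z - θ * S.pt w + (t + e) by ring]
    ring
  obtain ⟨t₀, ht₀, hqt₀⟩ := hz
  obtain ⟨t, ht, hQt⟩ := exists_growth (Q := Q) (e := e) (κ := Q e) (δ := δ) (ℓ := ℓ) (τ := τ)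
    (t₀ := t₀) (S.abs_incr_sub_le _ _ _ _) (by simp [hQ, incr]) (abs_pos.1 he0) he hℓ hτ
    (fun t ht => by
      have h1 := c1 t ht
      have h2 := c2 t ht
      rw [hshift] at h2
      rw [abs_le] at h1 h2 ⊢
      constructor <;> linarith [h1.1, h1.2, h2.1, h2.2])
    hδ ht₀ (by
      have h1 := c1 t₀ (by linarith)
      have h2 := abs_sub_abs_le_abs_sub (S.incr (m + n) c [] z t₀) (Q t₀)
      linarith)
  have h1 := c1 t ht
  obtain ⟨t', ht', htt'⟩ := hdense t ht
  have h2 : τ / (16 * ℓ) - 3 ≤ S.incr (m + n) c [] z t' := by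
    have h3 := S.abs_incr_sub_le (m + n) c [] z t t'
    rw [abs_le] at h1 h3
    linarith [h1.1, h1.2, h3.1, h3.2]
  rw [incr, cg_nil, cg_nil] at h2
  have h4 : Real.log (S.g (m + n) c z) ≤ 3 - τ / (16 * ℓ) + Real.log (S.g (m + n) c (z + t')) := by
    linarith
  have h5 := Real.exp_le_exp.2 h4
  rw [Real.exp_add, Real.exp_log (S.g_pos _ _ _), Real.exp_log (S.g_pos _ _ _)] at h5
  refine h5.trans (mul_le_mul_of_nonneg_left ?_ (Real.exp_pos _).le)
  exact Finset.single_le_sum (f := fun t => S.g (m + n) c (z + t))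
    (fun i _ => (S.g_pos _ _ _).le) ht'

lemma minor_le_of_mem_ev {𝒯 : Finset ℝ} {τ ϖ η ℓ θ δ ε c z : ℝ} {m n : ℕ}
    (hdense : ∀ t, |t| ≤ τ → ∃ t' ∈ 𝒯, |t - t'| ≤ ϖ) (hϖ : ϖ ≤ 1)
    (hℓ : 1 ≤ ℓ) (hτ : ℓ + 1 ≤ τ) (hε : 0 < ε) (hε1 : ε ≤ 1)
    (hθ0 : θ ≠ 0) (hθ : |θ| ≤ 1 / 32)
    (hδ : δ ≤ |θ| * S.sep / (32 * ℓ))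
    (hδ' : 4 * (η + |θ| * S.b ^ (m + 1) + ϖ) ≤ δ)
    (hz : z ∈ S.ev (1 / 2) ℓ (m + n + 1) c) :
    S.minor ε (m + n) c z ≤
      Real.exp (3 - τ / (16 * ℓ)) * (∑ t ∈ 𝒯, S.g (m + n + 1) c (z + t)) +
      ε⁻¹ * wavg (m + 1) fun w => (S.atyp 𝒯 η n c θ w).indicator (S.cg n c w) z := by
  set D := wavg (m + 1) fun w => (S.atyp 𝒯 η n c θ w).indicator (S.cg n c w) z with hD
  have hind : ∀ w : List ι, 0 ≤ (S.atyp 𝒯 η n c θ w).indicator (S.cg n c w) z := fun w =>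
    Set.indicator_nonneg (fun z _ => (S.cg_pos _ _ _ _).le) z
  have hD0 : 0 ≤ D := wavg_nonneg fun w _ => hind w
  have hsum0 : 0 ≤ ∑ t ∈ 𝒯, S.g (m + n + 1) c (z + t) :=
    Finset.sum_nonneg fun t _ => (S.g_pos _ _ _).le
  have hK : (0 : ℝ) < Fintype.card ι := by exact_mod_cast Fintype.card_pos
  by_cases h : ∃ a₀, ∀ a ≠ a₀, ∀ v : List ι, v.length = m → z ∈ S.atyp 𝒯 η n c θ (a :: v)
  · obtain ⟨a₀, h⟩ := h
    classical
    have h1 : (∑ a ∈ Finset.univ.erase a₀, S.cg (m + n) c [a] z) / Fintype.card ι ≤ D := by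
      rw [hD, wavg_succ]
      gcongr
      refine le_trans ?_ (Finset.sum_le_sum_of_subset_of_nonneg (Finset.erase_subset a₀ _)
        fun a _ _ => wavg_nonneg fun v _ => hind _)
      refine Finset.sum_le_sum fun a ha => ?_
      rw [cg_add]
      refine wavg_mono fun v hv => ?_
      rw [Set.indicator_of_mem (h a (Finset.ne_of_mem_erase ha) v hv)]
      rfl
    have h2 : S.g (m + n + 1) c z = (∑ a ∈ Finset.univ.erase a₀, S.cg (m + n) c [a] z)
        / Fintype.card ι + S.cg (m + n) c [a₀] z / Fintype.card ι := by
      rw [g_add_one, ← add_div, Finset.sum_erase_add _ _ (Finset.mem_univ _)]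
    have h3 : S.minor ε (m + n) c z ≤ ε⁻¹ * D := by
      by_cases hdom : S.cg (m + n) c [a₀] z
          ≤ (1 - ε) * (Fintype.card ι * S.g (m + n + 1) c z)
      · refine (S.minor_le _ _ _ _).trans ?_
        rw [inv_mul_eq_div, le_div_iff₀ hε]
        have h4 : S.cg (m + n) c [a₀] z / Fintype.card ι ≤ (1 - ε) * S.g (m + n + 1) c z := by
          rw [div_le_iff₀ hK]; linarith
        linarith
      · have h4 : S.minor ε (m + n) c z
            ≤ (∑ a ∈ Finset.univ.erase a₀, S.cg (m + n) c [a] z) / Fintype.card ι := by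
          unfold minor
          rw [← Finset.sum_erase_add _ _ (Finset.mem_univ a₀), if_neg hdom, add_zero]
          gcongr with a
          split_ifs
          exacts [le_rfl, (S.cg_pos _ _ _ _).le]
        have h5 : D ≤ ε⁻¹ * D := le_mul_of_one_le_left hD0 ((one_le_inv₀ hε).2 hε1)
        linarith
    have := mul_nonneg (Real.exp_pos (3 - τ / (16 * ℓ))).le hsum0
    linarith
  · push Not at h
    obtain ⟨a, -, v, hv, hz1⟩ := h (Classical.arbitrary ι)
    obtain ⟨a', ha', v', hv', hz2⟩ := h a
    have hsep := S.separated a a' _ _ ha'.symm (S.abs_pt_le v) (S.abs_pt_le v')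
    have he : |θ * (S.pt (a :: v) - S.pt (a' :: v'))|
        = |θ| * |S.pt (a :: v) - S.pt (a' :: v')| := abs_mul _ _
    have hθpos := abs_pos.2 hθ0
    have hsep' : |θ| * S.sep ≤ |θ * (S.pt (a :: v) - S.pt (a' :: v'))| := by
      rw [he]; gcongr; exact hsep
    have h1 := S.g_le_of_two_typical (m := m + 1) (n := n) (η := η) hdense hϖ hℓ hτ
      (a :: v) (a' :: v')
      (by simp [hv]) (by simp [hv']) ((mul_pos hθpos S.sep_pos).trans_le hsep')
      (by
        have h2 := abs_sub (S.pt (a :: v)) (S.pt (a' :: v'))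
        have h3 := S.abs_pt_le (a :: v)
        have h4 := S.abs_pt_le (a' :: v')
        rw [he]
        nlinarith)
      (hδ.trans (by gcongr)) hδ' (by rwa [add_right_comm]) hz1 hz2
    rw [add_right_comm m 1 n] at h1
    have h2 := S.minor_le ε (m + n) c z
    have : 0 ≤ ε⁻¹ * D := by positivity
    linarith

lemma wavg_atyp_le {𝒯 : Finset ℝ} {τ η : ℝ} (h𝒯 : ∀ t ∈ 𝒯, |t| ≤ τ) (hη : 0 < η)
    (j n : ℕ) (c θ : ℝ) (hθ : |θ| ≤ 1 / 32) :
    (wavg j fun w => ∫ z, (S.atyp 𝒯 η n c θ w).indicator (S.cg n c w) z)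
      ≤ Real.exp (2 * τ) / η ^ 2 *
        (S.gap 𝒯 j n c + 2 * S.gap 𝒯 j n (c + θ * S.A ^ (j + n))) := by
  set c' := c + θ * S.A ^ (j + n) with hc'
  have h1 := S.wavg_dev_le h𝒯 hη j n c
  have h2 := S.wavg_dev_le h𝒯 hη j n c'
  have h3 : (wavg j fun w => ∫ z, (S.atyp 𝒯 η n c θ w).indicator (S.cg n c w) z) ≤
      wavg j fun w => (∫ z, (S.dev 𝒯 η n c w).indicator (S.cg n c w) z)
        + 2 * ∫ z, (S.dev 𝒯 η n c' w).indicator (S.cg n c' w) z := by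
    refine wavg_mono fun w hw => ?_
    have hi1 := S.integrable_indicator_cg (S.isOpen_dev 𝒯 η n c w).measurableSet n c w
    have hi2 := S.integrable_indicator_cg (S.isOpen_dev 𝒯 η n c' w).measurableSet n c' w
    rw [← integral_sub_right_eq_self ((S.dev 𝒯 η n c' w).indicator (S.cg n c' w)) (θ * S.pt w),
      ← integral_const_mul, ← integral_add hi1 ((hi2.comp_sub_right _).const_mul _)]
    refine integral_mono
      (S.integrable_indicator_cg (S.isOpen_atyp 𝒯 η n c θ w).measurableSet n c w)
      (hi1.add ((hi2.comp_sub_right _).const_mul _)) fun z => ?_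
    have hn1 : 0 ≤ (S.dev 𝒯 η n c w).indicator (S.cg n c w) z :=
      Set.indicator_nonneg (fun z _ => (S.cg_pos _ _ _ _).le) z
    have hn2 : 0 ≤ (S.dev 𝒯 η n c' w).indicator (S.cg n c' w) (z - θ * S.pt w) :=
      Set.indicator_nonneg (fun z _ => (S.cg_pos _ _ _ _).le) _
    refine Set.indicator_apply_le' (fun hz => ?_) fun _ => by positivity
    simp only [atyp, hw, ← hc', Set.mem_union, Set.mem_preimage] at hz
    rcases hz with hz | hz
    · rw [Set.indicator_of_mem hz]; linarith
    · have h5 := S.cg_slope' n c θ w (z - θ * S.pt w)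
      rw [sub_add_cancel, hw, ← hc'] at h5
      simp only
      rw [Set.indicator_of_mem hz]
      have h6 : Real.exp (|θ| * S.b ^ j) ≤ 2 := by
        have h7 : |θ| * S.b ^ j ≤ 1 / 32 * 1 := by
          exact mul_le_mul hθ (pow_le_one₀ S.b_pos.le S.b_lt_one.le)
            (pow_nonneg S.b_pos.le _) (by norm_num)
        calc Real.exp (|θ| * S.b ^ j) ≤ Real.exp (Real.log 2) :=
              Real.exp_le_exp.2 (by linarith [Real.log_two_gt_d9])
          _ = 2 := Real.exp_log two_pos
      have h8 := S.cg_pos n c' w (z - θ * S.pt w)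
      nlinarith
  rw [wavg_add, wavg_mul_left] at h3
  linarith

lemma integral_minor_le {𝒯 : Finset ℝ} {τ ϖ η ℓ θ δ ε c : ℝ} {m n : ℕ}
    (h𝒯 : ∀ t ∈ 𝒯, |t| ≤ τ) (hη : 0 < η)
    (hdense : ∀ t, |t| ≤ τ → ∃ t' ∈ 𝒯, |t - t'| ≤ ϖ) (hϖ : ϖ ≤ 1)
    (hℓ : 1 ≤ ℓ) (hτ : ℓ + 1 ≤ τ) (hε : 0 < ε) (hε1 : ε ≤ 1)
    (hθ0 : θ ≠ 0) (hθ : |θ| ≤ 1 / 32)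
    (hδ : δ ≤ |θ| * S.sep / (32 * ℓ))
    (hδ' : 4 * (η + |θ| * S.b ^ (m + 1) + ϖ) ≤ δ) :
    ∫ z, (S.ev (1 / 2) ℓ (m + n + 1) c).indicator (S.minor ε (m + n) c) z ≤
      Real.exp (3 - τ / (16 * ℓ)) * (2 * 𝒯.card) + ε⁻¹ * (Real.exp (2 * τ) / η ^ 2 *
        (S.gap 𝒯 (m + 1) n c + 2 * S.gap 𝒯 (m + 1) n (c + θ * S.A ^ (m + 1 + n)))) := by
  have hi1 : ∀ w : List ι, w.length = m + 1 →
      Integrable ((S.atyp 𝒯 η n c θ w).indicator (S.cg n c w)) := fun w _ =>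
    S.integrable_indicator_cg (S.isOpen_atyp 𝒯 η n c θ w).measurableSet n c w
  have hi2 : Integrable fun z => ∑ t ∈ 𝒯, S.g (m + n + 1) c (z + t) :=
    integrable_finsetSum _ fun t _ => (S.integrable_g _ _).comp_add_right t
  have h1 : ∫ z, ∑ t ∈ 𝒯, S.g (m + n + 1) c (z + t) = 2 * 𝒯.card := by
    rw [integral_finsetSum _ fun t _ => (S.integrable_g _ _).comp_add_right t]
    simp_rw [integral_add_right_eq_self (S.g (m + n + 1) c), integral_g]
    simp [mul_comm]
  rw [← h1, ← integral_const_mul]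
  refine le_trans ?_ (add_le_add_right (mul_le_mul_of_nonneg_left
    (S.wavg_atyp_le h𝒯 hη (m + 1) n c θ hθ) (inv_pos.2 hε).le) _)
  rw [← integral_wavg hi1, ← integral_const_mul,
    ← integral_add (hi2.const_mul _) ((integrable_wavg hi1).const_mul _)]
  refine integral_mono ?_ ((hi2.const_mul _).add ((integrable_wavg hi1).const_mul _)) fun z => ?_
  · refine Integrable.indicator ?_ (S.isOpen_ev _ _ _ _).measurableSet
    exact S.integrable_of_le_g (n := m + n + 1) (c := c) (S.measurable_minor ε _ c) 1
      (S.minor_nonneg _ _ _) (by simpa using S.minor_le ε (m + n) c)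
  · refine Set.indicator_apply_le' (fun hz => ?_) fun _ => ?_
    · exact S.minor_le_of_mem_ev hdense hϖ hℓ hτ hε hε1 hθ0 hθ hδ hδ' hz
    · have hD0 : 0 ≤ wavg (m + 1) fun w => (S.atyp 𝒯 η n c θ w).indicator (S.cg n c w) z :=
        wavg_nonneg fun w _ => Set.indicator_nonneg (fun z _ => (S.cg_pos _ _ _ _).le) z
      have hsum0 : 0 ≤ ∑ t ∈ 𝒯, S.g (m + n + 1) c (z + t) :=
        Finset.sum_nonneg fun t _ => (S.g_pos _ _ _).le
      have := Real.exp_pos (3 - τ / (16 * ℓ))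
      positivity

end GraphIFS

lemma exists_grid {ϖ a x : ℝ} (τ₀ : ℝ) (hϖ : 0 < ϖ) (ha : 0 < a) (hx : 0 < x) :
    ∃ (τ : ℝ) (𝒯 : Finset ℝ), τ₀ ≤ τ ∧ (∀ t ∈ 𝒯, |t| ≤ τ) ∧
      (∀ t, |t| ≤ τ → ∃ t' ∈ 𝒯, |t - t'| ≤ ϖ) ∧ Real.exp (3 - a * τ) * (2 * 𝒯.card) ≤ x := by
  classical
  have h1 : Tendsto (fun I : ℕ => Real.exp 3 * (4 * (I * Real.exp (-(a * ϖ)) ^ I)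
      + 2 * Real.exp (-(a * ϖ)) ^ I)) atTop (𝓝 (Real.exp 3 * (4 * 0 + 2 * 0))) := by
    have hr : Real.exp (-(a * ϖ)) < 1 := Real.exp_lt_one_iff.2 (by nlinarith [mul_pos ha hϖ])
    exact (((tendsto_self_mul_const_pow_of_lt_one (Real.exp_pos _).le hr).const_mul 4).add
      ((tendsto_pow_atTop_nhds_zero_of_lt_one (Real.exp_pos _).le hr).const_mul 2)).const_mul _
  have h2 : ∀ᶠ I : ℕ in atTop, τ₀ / ϖ ≤ I :=
    tendsto_natCast_atTop_atTop.eventually_ge_atTop _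
  obtain ⟨I, hI, hI'⟩ := ((h1.eventually_le_const (by simpa using hx)).and h2).exists
  rw [div_le_iff₀ hϖ] at hI'
  refine ⟨I * ϖ, (Finset.Icc (-(I : ℤ)) I).image fun i : ℤ => (i : ℝ) * ϖ, hI', ?_, ?_, ?_⟩
  · intro t ht
    obtain ⟨i, hi, rfl⟩ := Finset.mem_image.1 ht
    rw [Finset.mem_Icc, ← abs_le] at hi
    rw [abs_mul, abs_of_pos hϖ]
    gcongr
    exact_mod_cast hi
  · intro t ht
    refine ⟨round (t / ϖ) * ϖ, Finset.mem_image_of_mem _ ?_, ?_⟩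
    · have h3 : |t / ϖ| ≤ I := by rw [abs_div, abs_of_pos hϖ, div_le_iff₀ hϖ]; exact ht
      have h4 := abs_sub_round (t / ϖ)
      rw [abs_le] at h3 h4
      have h5 : (round (t / ϖ) : ℝ) < I + 1 := by linarith [h3.2, h4.1]
      have h6 : -((I : ℝ) + 1) < round (t / ϖ) := by linarith [h3.1, h4.2]
      have h7 : round (t / ϖ) < (I : ℤ) + 1 := by exact_mod_cast h5
      have h8 : -((I : ℤ) + 1) < round (t / ϖ) := by exact_mod_cast h6
      rw [Finset.mem_Icc]; omega
    · have h4 := abs_sub_round (t / ϖ)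
      have h5 : t - round (t / ϖ) * ϖ = (t / ϖ - round (t / ϖ)) * ϖ := by field_simp
      rw [h5, abs_mul, abs_of_pos hϖ]
      nlinarith
  · have hc : (((Finset.Icc (-(I : ℤ)) I).image fun i : ℤ => (i : ℝ) * ϖ).card : ℝ)
        ≤ 2 * I + 1 := by
      have : ((Finset.Icc (-(I : ℤ)) I).image fun i : ℤ => (i : ℝ) * ϖ).card ≤ 2 * I + 1 :=
        Finset.card_image_le.trans (by simp; omega)
      exact_mod_cast this
    refine le_trans ?_ hI
    have h3 : Real.exp (3 - a * (I * ϖ)) = Real.exp 3 * Real.exp (-(a * ϖ)) ^ I := by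
      rw [← Real.exp_nat_mul, ← Real.exp_add]; ring_nf
    rw [h3]
    have h4 : 0 < Real.exp 3 * Real.exp (-(a * ϖ)) ^ I := by positivity
    nlinarith

namespace GraphIFS
variable {ι : Type} [Fintype ι] {S : GraphIFS ι} [Nonempty ι]

lemma integrable_indicator_minor (r ℓ ε : ℝ) (n : ℕ) (c : ℝ) :
    Integrable ((S.ev r ℓ (n + 1) c).indicator (S.minor ε n c)) := by
  refine Integrable.indicator ?_ (S.isOpen_ev _ _ _ _).measurableSet
  exact S.integrable_of_le_g (n := n + 1) (c := c) (S.measurable_minor ε _ c) 1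
    (S.minor_nonneg _ _ _) (by simpa using S.minor_le ε n c)

lemma bddOn_minor (r ℓ ε : ℝ) (n : ℕ) (C : ℝ) :
    BddOn C fun c => ∫ z, (S.ev r ℓ (n + 1) c).indicator (S.minor ε n c) z := by
  refine BddOn.of_le (R := 2) (fun c _ => integral_nonneg fun z =>
    Set.indicator_nonneg (fun z _ => S.minor_nonneg _ _ _ z) z) fun c _ => ?_
  rw [← S.integral_g (n + 1) c]
  exact integral_mono (integrable_indicator_minor r ℓ ε n c) (S.integrable_g _ _) fun z =>
    Set.indicator_apply_le' (fun _ => S.minor_le _ _ _ _) fun _ => (S.g_pos _ _ _).le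

omit [Fintype ι] [Nonempty ι] in
lemma act_cons_sub (c : ℝ) (a a' : ι) (q : List ι) :
    S.act c (a' :: q) = S.act c (a :: q) + S.γ ^ q.length * ((S.s a - S.s a') / S.A) := by
  rw [act, act, ← act_add]
  congr 1
  ring

omit [Nonempty ι] in
lemma wavg_map_head_le {f : List ι → ℝ} (hf : ∀ w, 0 ≤ f w) (σ : ι → ι) (k : ℕ)
    {f' : List ι → ℝ} (hf' : ∀ a q, f' (a :: q) = f (σ a :: q)) :
    wavg (k + 1) f' ≤ Fintype.card ι * wavg (k + 1) f := by
  rw [wavg_succ, wavg_succ, ← mul_div_assoc]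
  gcongr
  simp_rw [hf']
  refine (Finset.sum_le_card_nsmul Finset.univ _ (∑ a, wavg k fun w => f (a :: w))
    fun a _ => ?_).trans
    (by simp)
  exact Finset.single_le_sum (f := fun a => wavg k fun w => f (a :: w))
    (fun a _ => wavg_nonneg fun w _ => hf _) (Finset.mem_univ (σ a))

lemma SlopeBound.exists_Lam_minor_le {C : ℝ} (hC : S.SlopeBound C)
    (hs : ∃ a a', S.s a ≠ S.s a') {ℓ ε x : ℝ} (hℓ : 1 ≤ ℓ) (hε : 0 < ε) (hε1 : ε ≤ 1)
    (hx : 0 < x) : ∃ n₀, ∀ n ≥ n₀,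
      S.Lam (fun c => ∫ z, (S.ev (1 / 2) ℓ (n + 1) c).indicator (S.minor ε n c) z) ≤ x := by
  have hA := S.A_pos
  have hγ := S.γ_pos
  have hσ : ∀ a, ∃ a', S.s a - S.s a' ≠ 0 := fun a => by
    obtain ⟨a₁, a₂, h⟩ := hs
    by_contra! hcon
    exact h (by linarith [hcon a₁, hcon a₂])
  choose σ hσ using hσ
  obtain ⟨a₀, -, ha₀⟩ := Finset.exists_min_image Finset.univ
    (fun a => |S.s a - S.s (σ a)|) Finset.univ_nonempty
  set D₁ := |S.s a₀ - S.s (σ a₀)|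
  have hD₁ : 0 < D₁ := abs_pos.2 (hσ a₀)
  set D₂ := ∑ a, |S.s a - S.s (σ a)|
  have hD₂ : ∀ a, |S.s a - S.s (σ a)| ≤ D₂ := fun a =>
    Finset.single_le_sum (f := fun a => |S.s a - S.s (σ a)|) (fun _ _ => abs_nonneg _)
      (Finset.mem_univ a)
  have hD₂0 : 0 < D₂ := hD₁.trans_le (hD₂ a₀)
  set θ₁ := S.γ / 32 * (D₁ / D₂)
  have hθ₁ : 0 < θ₁ := by positivity
  have hsep := S.sep_pos
  set δ := min (θ₁ * S.sep / (32 * ℓ)) 1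
  have hδ : 0 < δ := lt_min (by positivity) one_pos
  obtain ⟨m, hm⟩ := exists_pow_lt_of_lt_one (show 0 < δ / 12 by positivity) S.b_lt_one
  have hm1 : S.b ^ (m + 1) ≤ δ / 12 := by
    rw [pow_succ]
    have := pow_pos S.b_pos m
    nlinarith [S.b_lt_one]
  obtain ⟨τ, 𝒯, hτ, h𝒯, hdense, hE⟩ := exists_grid (ϖ := δ / 12) (a := 1 / (16 * ℓ))
    (x := x / 2) (ℓ + 1) (by positivity) (by positivity) (by positivity)
  set E := ε⁻¹ * (Real.exp (2 * τ) / (δ / 12) ^ 2)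
  have hE0 : 0 < E := by positivity
  set K : ℝ := (Fintype.card ι : ℝ)
  have hK : 0 < K := by simp only [K]; exact_mod_cast Fintype.card_pos
  obtain ⟨n₁, hn₁⟩ := hC.exists_Lam_gap_le 𝒯 (δ := x / 2 / (E * (1 + 2 * K))) (by positivity)
  obtain ⟨n₂, hn₂⟩ := exists_pow_lt_of_lt_one (show 0 < 32 * D₂ by positivity) S.A_lt_one
  refine ⟨m + max n₁ n₂, fun n' hn' => ?_⟩
  obtain ⟨n, rfl⟩ := Nat.exists_eq_add_of_le (show m ≤ n' by omega)
  have hn : n₁ ≤ n ∧ n₂ ≤ n := by rw [← max_le_iff]; omega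
  set N := m + 1 + n with hN
  have hX : S.A ^ (N + 1) / (32 * D₂) ≤ 1 := by
    rw [div_le_one (by positivity)]
    exact (pow_le_pow_of_le_one hA.le S.A_lt_one.le (by omega)).trans hn₂.le
  obtain ⟨k, hk1, hk2⟩ := exists_nat_pow_near_of_lt_one
    (show 0 < S.A ^ (N + 1) / (32 * D₂) by positivity) hX hγ S.γ_lt_one
  set θ : ι → ℝ := fun a => S.γ ^ (k + 1) * (S.s a - S.s (σ a)) / S.A ^ (N + 1) with hθ
  have hAN : 0 < S.A ^ (N + 1) := by positivity
  have hθabs : ∀ a, |θ a| = S.γ ^ (k + 1) * |S.s a - S.s (σ a)| / S.A ^ (N + 1) := fun a => by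
    simp only [hθ]
    rw [abs_div, abs_mul, abs_of_pos (by positivity : 0 < S.γ ^ (k + 1)), abs_of_pos hAN]
  have hθle : ∀ a, |θ a| ≤ 1 / 32 := fun a => by
    rw [hθabs, div_le_iff₀ hAN]
    rw [lt_div_iff₀ (by positivity)] at hk1
    have := hD₂ a
    have : S.γ ^ (k + 1) * |S.s a - S.s (σ a)| ≤ S.γ ^ (k + 1) * D₂ := by gcongr
    linarith
  have hθge : ∀ a, θ₁ ≤ |θ a| := fun a => by
    rw [hθabs, le_div_iff₀ hAN]
    rw [div_le_iff₀ (by positivity)] at hk2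
    have h1 := ha₀ a (Finset.mem_univ a)
    calc θ₁ * S.A ^ (N + 1) ≤ θ₁ * (S.γ ^ k * (32 * D₂)) := by gcongr
      _ = S.γ ^ (k + 1) * D₁ := by simp only [θ₁]; field_simp; ring
      _ ≤ _ := by gcongr
  set F := fun c => ∫ z, (S.ev (1 / 2) ℓ (m + n + 1) c).indicator (S.minor ε (m + n) c) z
  have hF : ∀ c a, F c ≤ x / 2 + E * (S.gap 𝒯 (m + 1) n c
      + 2 * S.gap 𝒯 (m + 1) n (c + θ a * S.A ^ N)) := fun c a => by
    refine (S.integral_minor_le (δ := δ) h𝒯 (by positivity : 0 < δ / 12) hdense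
      (by have := min_le_right (θ₁ * S.sep / (32 * ℓ)) 1; simp only [δ]; linarith) hℓ hτ hε hε1
      (abs_pos.1 (hθ₁.trans_le (hθge a))) (hθle a)
      ((min_le_left _ _).trans (by gcongr; exact hθge a)) ?_).trans ?_
    · have : |θ a| * S.b ^ (m + 1) ≤ 1 / 32 * (δ / 12) :=
        mul_le_mul (hθle a) hm1 (pow_nonneg S.b_pos.le _) (by norm_num)
      linarith
    · rw [show τ / (16 * ℓ) = 1 / (16 * ℓ) * τ by ring]
      simp only [E]
      rw [← mul_assoc (ε⁻¹)]
      gcongr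
  have hbg := hC.bddOn_gap 𝒯 (m + 1) n
  have hFb : BddOn C F := bddOn_minor _ _ _ _ _
  have hbound : ∀ c, (wavg (k + 2) fun w => F (S.act c w)) ≤
      x / 2 + E * (1 + 2 * K) * wavg (k + 2) fun w => S.gap 𝒯 (m + 1) n (S.act c w) := by
    intro c
    set f' : List ι → ℝ := fun w => match w with
      | [] => 0
      | a :: q => S.gap 𝒯 (m + 1) n (S.act c (σ a :: q)) with hf'
    have h1 : (wavg (k + 2) fun w => F (S.act c w)) ≤ wavg (k + 2) fun w =>
        x / 2 + E * (S.gap 𝒯 (m + 1) n (S.act c w) + 2 * f' w) := by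
      refine wavg_mono fun w hw => ?_
      cases w with
      | nil => simp at hw
      | cons a q =>
        have h2 := hF (S.act c (a :: q)) a
        have h3 := S.act_cons_sub c a (σ a) q
        have h4 : θ a * S.A ^ N = S.γ ^ q.length * ((S.s a - S.s (σ a)) / S.A) := by
          simp only [List.length_cons] at hw
          rw [show q.length = k + 1 by omega]
          simp only [hθ]
          field_simp
          ring
        rw [h4, ← h3] at h2
        exact h2
    have h5 := wavg_map_head_le (f := fun w => S.gap 𝒯 (m + 1) n (S.act c w))
      (fun w => S.gap_nonneg _ _ _ _) σ (k + 1) (f' := f') (fun a q => rfl)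
    rw [wavg_add, wavg_const, wavg_mul_left, wavg_add, wavg_mul_left] at h1
    refine h1.trans ?_
    nlinarith
  rw [← hC.Lam_wavg hFb (k + 2)]
  refine (hC.Lam_mono (hC.bddOn_wavg hFb _) ((BddOn.const C (x / 2)).add
    ((hC.bddOn_wavg hbg (k + 2)).const_mul _)) fun c _ => hbound c).trans ?_
  rw [hC.Lam_add (BddOn.const C (x / 2)) ((hC.bddOn_wavg hbg (k + 2)).const_mul _), hC.Lam_const,
    hC.Lam_const_mul _ (hC.bddOn_wavg hbg _), hC.Lam_wavg hbg]
  have h6 := hn₁ n hn.1 (m + 1)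
  rw [le_div_iff₀ (by positivity)] at h6
  linarith

end GraphIFS

namespace GraphIFS
variable {ι : Type} [Fintype ι] (S : GraphIFS ι)

open Classical in
/-- The number of non-dominating letters along the word, for mass functions of final level `n₀`. -/
noncomputable def nb (ε : ℝ) (n₀ : ℕ) : List ι → ℝ → ℝ → ℕ
  | [], _, _ => 0
  | a :: w, c, z =>
    (if S.cg (w.length + n₀) c [a] z ≤ (1 - ε) * (Fintype.card ι * S.g (w.length + n₀ + 1) c z)
      then 1 else 0) +
    nb ε n₀ w (S.act c [a]) (z - S.U c (S.pt [a]) / S.A ^ (1 + w.length + n₀))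

variable [Nonempty ι]

lemma wavg_pow_nb_le {ε x : ℝ} (hε : ε ≤ 1 / 2) (hx : 0 < x) (n₀ k : ℕ) (c z : ℝ) :
    (wavg k fun w => x ^ S.nb ε n₀ w c z) ≤
      ((1 + Fintype.card ι * x) / Fintype.card ι) ^ k := by
  classical
  have hK : (0 : ℝ) < Fintype.card ι := by exact_mod_cast Fintype.card_pos
  induction k generalizing c z with
  | zero => simp [wavg_zero, nb]
  | succ k ih =>
    set q := ((1 + Fintype.card ι * x) / Fintype.card ι) ^ k with hq
    set P : ι → Prop := fun a =>
      S.cg (k + n₀) c [a] z ≤ (1 - ε) * (Fintype.card ι * S.g (k + n₀ + 1) c z) with hP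
    have h1 : ∀ a, (wavg k fun w => x ^ S.nb ε n₀ (a :: w) c z) ≤
        (if P a then x else 1) * q := fun a => by
      refine le_trans (le_of_eq ?_) (mul_le_mul_of_nonneg_left (ih (S.act c [a])
        (z - S.U c (S.pt [a]) / S.A ^ (1 + k + n₀))) (by split_ifs <;> positivity))
      rw [← wavg_mul_left]
      refine wavg_congr fun w hw => ?_
      simp only [nb, hw, pow_add, hP]
      congr 1
      split_ifs <;> simp
    have h2 : ∑ a, (if P a then x else 1) ≤ 1 + Fintype.card ι * x := by
      have h3 : ∃ a₀, ∀ a ≠ a₀, P a := by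
        by_contra! hcon
        obtain ⟨a, -, ha⟩ := hcon (Classical.arbitrary ι)
        obtain ⟨a', haa, ha'⟩ := hcon a
        simp only [hP, not_le] at ha ha'
        have h4 := S.g_add_one (k + n₀) c z
        rw [eq_div_iff hK.ne'] at h4
        have h5 : S.cg (k + n₀) c [a] z + S.cg (k + n₀) c [a'] z ≤ ∑ a, S.cg (k + n₀) c [a] z := by
          rw [← Finset.sum_pair (f := fun a => S.cg (k + n₀) c [a] z) haa.symm]
          exact Finset.sum_le_sum_of_subset_of_nonneg (Finset.subset_univ _)
            fun i _ _ => (S.cg_pos _ _ _ _).le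
        have h6 := S.g_pos (k + n₀ + 1) c z
        have h7 : 0 < Fintype.card ι * S.g (k + n₀ + 1) c z := by positivity
        nlinarith
      obtain ⟨a₀, h3⟩ := h3
      have h4 : ∀ a, (if P a then x else 1) ≤ (if a = a₀ then 1 else 0) + x := fun a => by
        by_cases ha : a = a₀
        · rw [if_pos ha]; split_ifs <;> linarith
        · rw [if_neg ha, if_pos (h3 a ha), zero_add]
      refine (Finset.sum_le_sum fun a _ => h4 a).trans ?_
      rw [Finset.sum_add_distrib]
      simp
    rw [wavg_succ, pow_succ', ← hq, div_mul_eq_mul_div]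
    gcongr
    refine (Finset.sum_le_sum fun a _ => h1 a).trans ?_
    rw [← Finset.sum_mul]
    have : 0 ≤ q := by positivity
    gcongr

omit [Nonempty ι] in
lemma wavg_cg_nb_succ (ε : ℝ) (n₀ k : ℕ) (c z : ℝ) :
    (wavg (k + 1) fun w => S.cg n₀ c w z * S.nb ε n₀ w c z) = S.minor ε (k + n₀) c z +
      wavg 1 fun u => wavg k fun w =>
        S.cg n₀ (S.act c u) w (z - S.U c (S.pt u) / S.A ^ (1 + k + n₀)) *
        S.nb ε n₀ w (S.act c u) (z - S.U c (S.pt u) / S.A ^ (1 + k + n₀)) := by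
  classical
  rw [wavg_succ, wavg_succ, minor, ← add_div, ← Finset.sum_add_distrib]
  congr 1
  refine Finset.sum_congr rfl fun a _ => ?_
  rw [wavg_zero]
  have h1 : ∀ w : List ι, w.length = k → S.cg n₀ c (a :: w) z =
      S.cg n₀ (S.act c [a]) w (z - S.U c (S.pt [a]) / S.A ^ (1 + k + n₀)) := fun w hw => by
    have := S.cg_cg n₀ c [a] w z
    simpa [hw] using this
  have h2 : S.cg (k + n₀) c [a] z = wavg k fun w => S.cg n₀ c (a :: w) z := S.cg_add k n₀ c [a] z
  rw [wavg_congr (g := fun w => S.cg n₀ c (a :: w) z * (if S.cg (k + n₀) c [a] z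
      ≤ (1 - ε) * (Fintype.card ι * S.g (k + n₀ + 1) c z) then 1 else 0) +
      S.cg n₀ (S.act c [a]) w (z - S.U c (S.pt [a]) / S.A ^ (1 + k + n₀)) *
        S.nb ε n₀ w (S.act c [a]) (z - S.U c (S.pt [a]) / S.A ^ (1 + k + n₀)))
      (fun w hw => by
        simp only [nb, hw]
        push_cast
        rw [mul_add, ← h1 w hw]), wavg_add, wavg_mul_right, ← h2]
  split_ifs <;> simp

omit [Nonempty ι] in
lemma wavg_cg_nb (ε : ℝ) (n₀ k : ℕ) (c z : ℝ) :
    (wavg k fun w => S.cg n₀ c w z * S.nb ε n₀ w c z) = ∑ j ∈ Finset.range k,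
      wavg j fun u => S.minor ε (k - 1 - j + n₀) (S.act c u)
        (z - S.U c (S.pt u) / S.A ^ (k + n₀)) := by
  induction k generalizing c z with
  | zero => simp [wavg_zero, nb]
  | succ k ih =>
    rw [wavg_cg_nb_succ, Finset.sum_range_succ', add_comm]
    congr 1
    · simp_rw [ih]
      rw [wavg_finset_sum]
      refine Finset.sum_congr rfl fun j hj => ?_
      rw [add_comm j 1, wavg_append]
      refine wavg_congr fun u hu => wavg_congr fun v hv => ?_
      rw [S.act_append, S.U_append, hu]
      congr 1
      · congr 1
        omega
      · have := S.A_pos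
        rw [show 1 + k + n₀ = k + n₀ + 1 by ring, show k + 1 + n₀ = k + n₀ + 1 by ring]
        field_simp
        ring
    · rw [wavg_zero]
      simp [act, pt, U_zero]

lemma g_le_of_nb {ε x : ℝ} (hε : ε ≤ 1 / 2) (hx : 0 < x) (hx1 : x ≤ 1) (n₀ k : ℕ) {p : ℕ}
    (hp : 0 < p) (c z : ℝ) : S.g (k + n₀) c z ≤
      ((1 + Fintype.card ι * x) / Fintype.card ι) ^ k / x ^ p +
      (∑ j ∈ Finset.range k, wavg j fun u => S.minor ε (k - 1 - j + n₀) (S.act c u)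
        (z - S.U c (S.pt u) / S.A ^ (k + n₀))) / p := by
  have hp' : (0 : ℝ) < p := by exact_mod_cast hp
  rw [← wavg_cg_nb, g_add]
  have h1 : (wavg k fun w => S.cg n₀ c w z) ≤ wavg k fun w => (x ^ p)⁻¹ * x ^ S.nb ε n₀ w c z
      + (p : ℝ)⁻¹ * (S.cg n₀ c w z * S.nb ε n₀ w c z) := by
    refine wavg_mono fun w _ => ?_
    have h2 := S.cg_pos n₀ c w z
    have h3 := S.cg_le_one n₀ c w z
    rcases le_total (S.nb ε n₀ w c z) p with h | h
    · have h4 : 1 ≤ (x ^ p)⁻¹ * x ^ S.nb ε n₀ w c z := by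
        rw [inv_mul_eq_div, one_le_div (by positivity)]
        exact pow_le_pow_of_le_one hx.le hx1 h
      have : 0 ≤ (p : ℝ)⁻¹ * (S.cg n₀ c w z * S.nb ε n₀ w c z) := by positivity
      linarith
    · have h4 : 1 ≤ (p : ℝ)⁻¹ * S.nb ε n₀ w c z := by
        rw [inv_mul_eq_div, one_le_div hp']
        exact_mod_cast h
      have : 0 ≤ (x ^ p)⁻¹ * x ^ S.nb ε n₀ w c z := by positivity
      nlinarith
  refine h1.trans ?_
  rw [wavg_add, wavg_mul_left, wavg_mul_left, inv_mul_eq_div, inv_mul_eq_div]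
  gcongr
  exact S.wavg_pow_nb_le hε hx n₀ k c z

lemma mem_ev_of_not_mem_dev {𝒯 : Finset ℝ} {ℓ c z : ℝ} {m n : ℕ}
    (hdense : ∀ t, |t| ≤ ℓ → ∃ t' ∈ 𝒯, |t - t'| ≤ 1 / 8) {u : List ι} (hu : u.length = m)
    (hz : z ∈ S.ev 1 ℓ (m + n) c) (hzu : z ∉ S.dev 𝒯 (1 / 8) n c u) :
    z - S.U c (S.pt u) / S.A ^ (m + n) ∈ S.ev (1 / 2) ℓ n (S.act c u) := by
  obtain ⟨t, ht, h⟩ := hz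
  refine ⟨t, ht, ?_⟩
  obtain ⟨t', ht', htt'⟩ := hdense t ht
  simp only [dev, Set.mem_ofPred_eq, not_exists, not_and, not_lt, hu] at hzu
  have h1 := hzu t' ht'
  have h2 := (S.abs_incr_sub_le (m + n) c [] z t t').trans htt'
  have h3 := (S.abs_incr_sub_le n c u z t t').trans htt'
  have h4 : S.incr n (S.act c u) [] (z - S.U c (S.pt u) / S.A ^ (m + n)) t
      = S.incr n c u z t := by
    simp only [incr, cg_nil]
    simp only [cg, hu, add_sub_right_comm]
  rw [h4]
  have h5 : |S.incr (m + n) c [] z t| ≤ |S.incr n c u z t| + 3 / 8 := by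
    have h6 := abs_sub_abs_le_abs_sub (S.incr (m + n) c [] z t) (S.incr n c u z t)
    have h7 : |S.incr (m + n) c [] z t - S.incr n c u z t| ≤ 3 / 8 := by
      rw [abs_le] at h1 h2 h3 ⊢
      constructor <;> linarith [h1.1, h1.2, h2.1, h2.2, h3.1, h3.2]
    linarith
  linarith

lemma integral_minor_shift_le {𝒯 : Finset ℝ} {ℓ ε c : ℝ} {m n : ℕ}
    (hdense : ∀ t, |t| ≤ ℓ → ∃ t' ∈ 𝒯, |t - t'| ≤ 1 / 8) {u : List ι} (hu : u.length = m) :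
    ∫ z, (S.ev 1 ℓ (m + (n + 1)) c).indicator (fun z => S.minor ε n (S.act c u)
        (z - S.U c (S.pt u) / S.A ^ (m + (n + 1)))) z ≤
      (∫ z, (S.dev 𝒯 (1 / 8) (n + 1) c u).indicator (S.cg (n + 1) c u) z) +
      ∫ z, (S.ev (1 / 2) ℓ (n + 1) (S.act c u)).indicator (S.minor ε n (S.act c u)) z := by
  set r := S.U c (S.pt u) / S.A ^ (m + (n + 1))
  have hi1 :=
    S.integrable_indicator_cg (S.isOpen_dev 𝒯 (1 / 8) (n + 1) c u).measurableSet (n + 1) c u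
  have hi2 := integrable_indicator_minor (S := S) (1 / 2) ℓ ε n (S.act c u)
  rw [← integral_sub_right_eq_self
    ((S.ev (1 / 2) ℓ (n + 1) (S.act c u)).indicator (S.minor ε n (S.act c u))) r,
    ← integral_add hi1 (hi2.comp_sub_right r)]
  have hg : ∀ z, S.minor ε n (S.act c u) (z - r) ≤ S.cg (n + 1) c u z := fun z => by
    rw [cg, hu]
    exact S.minor_le _ _ _ _
  refine integral_mono ?_ (hi1.add (hi2.comp_sub_right r)) fun z => ?_
  · refine Integrable.indicator ?_ (S.isOpen_ev _ _ _ _).measurableSet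
    refine S.integrable_of_le_cg (n := n + 1) (c := c) (w := u)
      ((S.measurable_minor ε n _).comp (measurable_id.sub_const r)) 1
      (fun z => S.minor_nonneg _ _ _ _) (by simpa using hg)
  · have hn1 : 0 ≤ (S.dev 𝒯 (1 / 8) (n + 1) c u).indicator (S.cg (n + 1) c u) z :=
      Set.indicator_nonneg (fun z _ => (S.cg_pos _ _ _ _).le) z
    have hn2 : 0 ≤ (S.ev (1 / 2) ℓ (n + 1) (S.act c u)).indicator
        (S.minor ε n (S.act c u)) (z - r) :=
      Set.indicator_nonneg (fun z _ => S.minor_nonneg _ _ _ _) _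
    refine Set.indicator_apply_le' (fun hz => ?_) fun _ => add_nonneg hn1 hn2
    by_cases hd : z ∈ S.dev 𝒯 (1 / 8) (n + 1) c u
    · simp only at hn1 hn2 ⊢
      rw [Set.indicator_of_mem hd]
      linarith [hg z]
    · have := S.mem_ev_of_not_mem_dev hdense hu hz hd
      simp only at hn1 hn2 ⊢
      rw [Set.indicator_of_mem this]
      linarith

end GraphIFS

lemma integrable_exp_neg_half_abs : Integrable (fun x : ℝ => Real.exp (-(|x| / 2))) := by
  have := integrable_exp_neg_abs.comp_mul_left' (show (2⁻¹ : ℝ) ≠ 0 by norm_num)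
  convert this using 2 with x
  rw [abs_mul, abs_of_pos (by norm_num : (0:ℝ) < 2⁻¹)]
  ring_nf

lemma integral_exp_neg_half_abs : ∫ x : ℝ, Real.exp (-(|x| / 2)) = 4 := by
  have := Measure.integral_comp_mul_left (fun x => Real.exp (-|x|)) 2⁻¹
  rw [integral_exp_neg_abs, inv_inv, abs_two, smul_eq_mul] at this
  convert this using 2
  · ext x
    rw [abs_mul, abs_of_pos (by norm_num : (0:ℝ) < 2⁻¹)]
    ring_nf
  · norm_num

namespace GraphIFS
variable {ι : Type} [Fintype ι] {S : GraphIFS ι} [Nonempty ι]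

lemma integrable_indicator_g (r ℓ : ℝ) (n : ℕ) (c : ℝ) :
    Integrable ((S.ev r ℓ n c).indicator (S.g n c)) :=
  (S.integrable_g n c).indicator (S.isOpen_ev _ _ _ _).measurableSet

lemma bddOn_ev (r ℓ : ℝ) (n : ℕ) (C : ℝ) :
    BddOn C fun c => ∫ z, (S.ev r ℓ n c).indicator (S.g n c) z := by
  refine BddOn.of_le (R := 2) (fun c _ => integral_nonneg fun z =>
    Set.indicator_nonneg (fun z _ => (S.g_pos _ _ z).le) z) fun c _ => ?_
  rw [← S.integral_g n c]
  exact integral_mono (integrable_indicator_g r ℓ n c) (S.integrable_g _ _) fun z =>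
    Set.indicator_apply_le' (fun _ => le_rfl) fun _ => (S.g_pos _ _ _).le

lemma integral_ev_le {𝒯 : Finset ℝ} {ℓ B x y c : ℝ} {k n₀ p : ℕ}
    (hB0 : 0 < B) (hB : ∀ y, |y| ≤ 1 → |S.U c y| ≤ B) (hy : 0 ≤ y)
    (h𝒯 : ∀ t ∈ 𝒯, |t| ≤ ℓ) (hdense : ∀ t, |t| ≤ ℓ → ∃ t' ∈ 𝒯, |t - t'| ≤ 1 / 8)
    (hx : 0 < x) (hx1 : x ≤ 1) (hp : 0 < p) :
    ∫ z, (S.ev 1 ℓ (k + n₀) c).indicator (S.g (k + n₀) c) z ≤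
      4 * (B + y) / S.A ^ (k + n₀) *
        (((1 + Fintype.card ι * x) / Fintype.card ι) ^ k / x ^ p) + 4 * Real.exp (-y) +
      (p : ℝ)⁻¹ * ∑ j ∈ Finset.range k,
        (64 * Real.exp (2 * ℓ) * S.gap 𝒯 j (k - 1 - j + n₀ + 1) c + wavg j fun u =>
          ∫ z, (S.ev (1 / 2) ℓ (k - 1 - j + n₀ + 1) (S.act c u)).indicator
            (S.minor (1 / 2) (k - 1 - j + n₀) (S.act c u)) z) := by
  set n := k + n₀
  have hA := S.A_pos
  have hAn : 0 < S.A ^ n := by positivity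
  have hAn1 : S.A ^ n ≤ 1 := pow_le_one₀ hA.le S.A_lt_one.le
  set P := ((1 + Fintype.card ι * x) / Fintype.card ι) ^ k / x ^ p
  have hP : 0 ≤ P := by positivity
  set Z := 2 * (B + y) / S.A ^ n with hZ
  have hZ0 : 0 ≤ Z := by positivity
  set G : ℕ → List ι → ℝ → ℝ := fun j u => (S.ev 1 ℓ n c).indicator fun z =>
    S.minor (1 / 2) (k - 1 - j + n₀) (S.act c u) (z - S.U c (S.pt u) / S.A ^ n) with hG
  have hGi : ∀ j ∈ Finset.range k, ∀ u : List ι, u.length = j → Integrable (G j u) := by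
    intro j hj u hu
    have hn : n = j + (k - 1 - j + n₀ + 1) := by
      have := Finset.mem_range.1 hj
      simp only [n]; omega
    refine Integrable.indicator ?_ (S.isOpen_ev _ _ _ _).measurableSet
    refine S.integrable_of_le_cg (n := k - 1 - j + n₀ + 1) (c := c) (w := u)
      ((S.measurable_minor _ _ _).comp (measurable_id.sub_const _)) 1
      (fun z => S.minor_nonneg _ _ _ _) (fun z => ?_)
    rw [one_mul, cg, hu, ← hn]
    exact S.minor_le _ _ _ _
  have hGint : ∀ j ∈ Finset.range k, ∀ u : List ι, u.length = j → ∫ z, G j u z ≤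
      (∫ z, (S.dev 𝒯 (1 / 8) (k - 1 - j + n₀ + 1) c u).indicator
        (S.cg (k - 1 - j + n₀ + 1) c u) z) +
      ∫ z, (S.ev (1 / 2) ℓ (k - 1 - j + n₀ + 1) (S.act c u)).indicator
            (S.minor (1 / 2) (k - 1 - j + n₀) (S.act c u)) z := by
    intro j hj u hu
    have hn : n = j + (k - 1 - j + n₀ + 1) := by
      have := Finset.mem_range.1 hj
      simp only [n]; omega
    have := S.integral_minor_shift_le (ε := 1 / 2) (n := k - 1 - j + n₀) (c := c) hdense hu
    rw [← hn] at this
    exact this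
  have hsumi : Integrable fun z => ∑ j ∈ Finset.range k, wavg j fun u => G j u z :=
    integrable_finsetSum _ fun j hj => integrable_wavg (hGi j hj)
  have hIcc : Integrable ((Set.Icc (-Z) Z).indicator fun _ : ℝ => P) :=
    (integrable_indicator_iff measurableSet_Icc).2
      (integrableOn_const (by simp))
  have hexp := integrable_exp_neg_half_abs.const_mul (Real.exp (-y))
  have key : ∫ z, (S.ev 1 ℓ n c).indicator (S.g n c) z ≤
      ∫ z, ((Set.Icc (-Z) Z).indicator (fun _ : ℝ => P) z
        + Real.exp (-y) * Real.exp (-(|z| / 2)))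
        + (p : ℝ)⁻¹ * ∑ j ∈ Finset.range k, wavg j fun u => G j u z := by
    refine integral_mono (integrable_indicator_g 1 ℓ n c)
      ((hIcc.add hexp).add (hsumi.const_mul _)) fun z => ?_
    have hI0 : 0 ≤ (Set.Icc (-Z) Z).indicator (fun _ : ℝ => P) z :=
      Set.indicator_nonneg (fun z _ => hP) z
    have hs0 : 0 ≤ ∑ j ∈ Finset.range k, wavg j fun u => G j u z :=
      Finset.sum_nonneg fun j _ => wavg_nonneg fun u _ =>
        Set.indicator_nonneg (fun z _ => S.minor_nonneg _ _ _ _) z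
    refine Set.indicator_apply_le' (fun hz => ?_) fun _ => by positivity
    by_cases hzZ : |z| ≤ Z
    · have h1 := S.g_le_of_nb (ε := 1 / 2) le_rfl hx hx1 n₀ k hp c z
      have h2 : (∑ j ∈ Finset.range k, wavg j fun u => S.minor (1 / 2) (k - 1 - j + n₀)
          (S.act c u) (z - S.U c (S.pt u) / S.A ^ n))
          = ∑ j ∈ Finset.range k, wavg j fun u => G j u z := by
        refine Finset.sum_congr rfl fun j _ => wavg_congr fun u _ => ?_
        simp only [hG]
        rw [Set.indicator_of_mem hz]
      rw [h2, div_eq_inv_mul _ (p : ℝ)] at h1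
      have h3 : (Set.Icc (-Z) Z).indicator (fun _ : ℝ => P) z = P :=
        Set.indicator_of_mem (Set.mem_Icc.2 (abs_le.1 hzZ)) _
      have : 0 ≤ Real.exp (-y) * Real.exp (-(|z| / 2)) := by positivity
      simp only [h3]
      linarith
    · have h1 := S.g_tail hB n z
      have h2 : B / S.A ^ n - |z| ≤ -y + -(|z| / 2) := by
        have h3 : B / S.A ^ n = Z / 2 - y / S.A ^ n := by rw [hZ]; field_simp; ring
        have h4 : y ≤ y / S.A ^ n := by rw [le_div_iff₀ hAn]; nlinarith
        linarith
      have h5 := h1.trans (Real.exp_le_exp.2 h2)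
      rw [Real.exp_add] at h5
      have : 0 ≤ (p : ℝ)⁻¹ * ∑ j ∈ Finset.range k, wavg j fun u => G j u z := by positivity
      simp only
      linarith
  refine key.trans ?_
  rw [integral_add (f := fun z => (Set.Icc (-Z) Z).indicator (fun _ : ℝ => P) z
      + Real.exp (-y) * Real.exp (-(|z| / 2))) (hIcc.add hexp) (hsumi.const_mul _),
    integral_add hIcc hexp,
    integral_const_mul, integral_const_mul, integral_exp_neg_half_abs,
    integral_indicator_const _ measurableSet_Icc,
    integral_finsetSum _ fun j hj => integrable_wavg (hGi j hj)]
  have hvol : volume.real (Set.Icc (-Z) Z) • P = 4 * (B + y) / S.A ^ n * P := by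
    rw [Real.volume_real_Icc_of_le (by linarith), smul_eq_mul, hZ]; ring
  rw [hvol, mul_comm (Real.exp (-y))]
  gcongr with j hj
  rw [integral_wavg (hGi j hj)]
  refine (wavg_mono (hGint j hj)).trans ?_
  rw [wavg_add]
  gcongr
  refine (S.wavg_dev_le h𝒯 (by norm_num : (0:ℝ) < 1 / 8) j _ c).trans (le_of_eq ?_)
  ring

lemma integral_ev_mono {r r' ℓ ℓ' : ℝ} (hr : r' ≤ r) (hℓ : ℓ ≤ ℓ') (n : ℕ) (c : ℝ) :
    ∫ z, (S.ev r ℓ n c).indicator (S.g n c) z ≤ ∫ z, (S.ev r' ℓ' n c).indicator (S.g n c) z := by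
  refine integral_mono (integrable_indicator_g _ _ n c) (integrable_indicator_g _ _ n c)
    fun z => Set.indicator_le_indicator_of_subset (fun z hz => ?_) (fun z => (S.g_pos _ _ _).le) z
  obtain ⟨t, ht, h⟩ := hz
  exact ⟨t, ht.trans hℓ, hr.trans_lt h⟩

lemma SlopeBound.exists_Lam_ev_le {C : ℝ} (hC : S.SlopeBound C)
    (hs : ∃ a a', S.s a ≠ S.s a') (hK : 1 < Fintype.card ι * S.A) {ℓ ξ : ℝ} (hℓ : 1 ≤ ℓ)
    (hξ : 0 < ξ) : ∃ n₀, ∀ n ≥ n₀,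
      S.Lam (fun c => ∫ z, (S.ev 1 ℓ n c).indicator (S.g n c) z) ≤ ξ := by
  have hA := S.A_pos
  have hA1 := S.A_lt_one
  set K : ℝ := (Fintype.card ι : ℝ) with hKdef
  have hK0 : 0 < K := by rw [hKdef]; exact_mod_cast Fintype.card_pos
  obtain ⟨B, hB0, hB⟩ := S.exists_U_bound C hC.1.le
  obtain ⟨τ, 𝒯, hτ, h𝒯, hdense, -⟩ := exists_grid (ϖ := 1 / 8) (a := 1) (x := 1) ℓ
    (by norm_num) one_pos one_pos
  have hmono := fun n => hC.Lam_mono (bddOn_ev (S := S) 1 ℓ n C) (bddOn_ev (S := S) 1 τ n C)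
    fun c _ => integral_ev_mono (S := S) (le_refl 1) hτ n c
  set x := (K * S.A - 1) / (2 * K) with hx
  have hx0 : 0 < x := div_pos (by linarith) (by positivity)
  have hx1 : x ≤ 1 := by rw [hx, div_le_one (by positivity)]; nlinarith
  set r := (1 + K * x) / (K * S.A) with hr
  have hr0 : 0 < r := by positivity
  have hr1 : r < 1 := by
    rw [hr, div_lt_one (by positivity)]
    have : K * x = (K * S.A - 1) / 2 := by rw [hx]; field_simp
    linarith
  obtain ⟨q, hq⟩ := exists_pow_lt_of_lt_one hx0 hr1
  have hq0 : 0 < q := by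
    rcases Nat.eq_zero_or_pos q with rfl | h
    · rw [pow_zero] at hq; linarith
    · exact h
  have hq0' : (0 : ℝ) < q := by exact_mod_cast hq0
  set ρ := r ^ q / x with hρ
  have hρ0 : 0 < ρ := by positivity
  have hρ1 : ρ < 1 := by rwa [hρ, div_lt_one hx0]
  set y := 16 / ξ with hy
  have hy0 : 0 < y := by positivity
  have hexp : 4 * Real.exp (-y) ≤ ξ / 4 := by
    have h1 := Real.add_one_le_exp y
    rw [Real.exp_neg]
    have h2 : (Real.exp y)⁻¹ ≤ y⁻¹ := by gcongr; linarith
    calc 4 * (Real.exp y)⁻¹ ≤ 4 * y⁻¹ := by gcongr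
      _ = ξ / 4 := by rw [hy]; field_simp; norm_num
  set C₁ := 64 * Real.exp (2 * τ) with hC₁
  have hC₁0 : 0 < C₁ := by positivity
  obtain ⟨n₁, hn₁⟩ := hC.exists_Lam_gap_le 𝒯 (δ := ξ / (16 * q * C₁)) (by positivity)
  obtain ⟨n₂, hn₂⟩ := hC.exists_Lam_minor_le hs (ℓ := τ) (ε := 1 / 2) (x := ξ / (16 * q))
    (hℓ.trans hτ) (by norm_num) (by norm_num) (by positivity)
  set n₀ := max n₁ n₂
  obtain ⟨p₀, hp₀⟩ := exists_pow_lt_of_lt_one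
    (show 0 < ξ / 4 / (4 * (B + y) / S.A ^ n₀) by positivity) hρ1
  refine ⟨q * (p₀ + 1) + n₀, fun n hn => (hmono n).trans ?_⟩
  obtain ⟨k, rfl⟩ := Nat.exists_eq_add_of_le' (show n₀ ≤ n by omega)
  have hk : q * (p₀ + 1) ≤ k := by omega
  set p := k / q with hp
  have hpp : p₀ + 1 ≤ p := by rw [hp, Nat.le_div_iff_mul_le hq0]; linarith
  have hp0 : 0 < p := by omega
  have hp0' : (0 : ℝ) < p := by exact_mod_cast hp0
  have hkp : q * p ≤ k := Nat.mul_div_le k q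
  have hkp2 : (k : ℝ) ≤ 2 * q * p := by
    have h1 : k < q * (p + 1) := Nat.lt_mul_div_succ k hq0
    have h2 : q * (p + 1) ≤ 2 * q * p := by nlinarith
    exact_mod_cast (h1.trans_le h2).le
  have hmain : 4 * (B + y) / S.A ^ (k + n₀) * (((1 + K * x) / K) ^ k / x ^ p) ≤ ξ / 4 := by
    have h1 : 4 * (B + y) / S.A ^ (k + n₀) * (((1 + K * x) / K) ^ k / x ^ p)
        = 4 * (B + y) / S.A ^ n₀ * (r ^ k / x ^ p) := by
      have h3 : ((1 + K * x) / K) ^ k = r ^ k * S.A ^ k := by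
        rw [← mul_pow, hr]; congr 1; clear_value x; field_simp
      rw [h3, pow_add]
      clear_value x r
      field_simp
    have h2 : r ^ k / x ^ p ≤ ρ ^ p₀ := by
      calc r ^ k / x ^ p ≤ r ^ (q * p) / x ^ p :=
            div_le_div_of_nonneg_right (pow_le_pow_of_le_one hr0.le hr1.le hkp) (by positivity)
        _ = ρ ^ p := by rw [pow_mul]; exact (div_pow (r ^ q) x p).symm
        _ ≤ ρ ^ p₀ := pow_le_pow_of_le_one hρ0.le hρ1.le (by omega)
    rw [lt_div_iff₀ (by positivity)] at hp₀
    rw [h1]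
    calc _ ≤ 4 * (B + y) / S.A ^ n₀ * ρ ^ p₀ := by gcongr
      _ ≤ _ := by linarith
  set F : ℕ → ℝ → ℝ := fun m c =>
    ∫ z, (S.ev (1 / 2) τ (m + 1) c).indicator (S.minor (1 / 2) m c) z with hF
  have hFb : ∀ m, BddOn C (F m) := fun m => bddOn_minor _ _ _ _ _
  have hterm : ∀ j, BddOn C fun c => C₁ * S.gap 𝒯 j (k - 1 - j + n₀ + 1) c +
      wavg j fun u => F (k - 1 - j + n₀) (S.act c u) := fun j =>
    ((hC.bddOn_gap 𝒯 j _).const_mul _).add (hC.bddOn_wavg (hFb _) j)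
  have hsum := BddOn.sum (Finset.range k) fun j _ => hterm j
  have hbound : ∀ c, |c| ≤ C → ∫ z, (S.ev 1 τ (k + n₀) c).indicator (S.g (k + n₀) c) z ≤
      ξ / 2 + (p : ℝ)⁻¹ * ∑ j ∈ Finset.range k, (C₁ * S.gap 𝒯 j (k - 1 - j + n₀ + 1) c +
      wavg j fun u => F (k - 1 - j + n₀) (S.act c u)) := fun c hc => by
    have h1 := S.integral_ev_le (n₀ := n₀) (k := k) (y := y) (c := c) hB0
      (fun y hy => hB c y hc hy) hy0.le h𝒯 hdense hx0 hx1 hp0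
    refine h1.trans ?_
    gcongr
    linarith
  refine (hC.Lam_mono (bddOn_ev 1 τ _ C) ((BddOn.const C (ξ / 2)).add (hsum.const_mul _))
    hbound).trans ?_
  rw [hC.Lam_add (BddOn.const C _) (hsum.const_mul _), hC.Lam_const, hC.Lam_const_mul _ hsum,
    hC.Lam_sum _ fun j _ => hterm j]
  have hj : ∀ j ∈ Finset.range k, S.Lam (fun c => C₁ * S.gap 𝒯 j (k - 1 - j + n₀ + 1) c +
      wavg j fun u => F (k - 1 - j + n₀) (S.act c u)) ≤ ξ / (8 * q) := fun j hj => by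
    have hj' := Finset.mem_range.1 hj
    rw [hC.Lam_add ((hC.bddOn_gap 𝒯 j _).const_mul _) (hC.bddOn_wavg (hFb _) j),
      hC.Lam_const_mul _ (hC.bddOn_gap 𝒯 j _), hC.Lam_wavg (hFb _)]
    have h1 := hn₁ (k - 1 - j + n₀ + 1) (by have := le_max_left n₁ n₂; omega) j
    have h2 := hn₂ (k - 1 - j + n₀) (by have := le_max_right n₁ n₂; omega)
    calc _ ≤ C₁ * (ξ / (16 * q * C₁)) + ξ / (16 * q) := by gcongr
      _ = _ := by field_simp; norm_num
  have h1 := Finset.sum_le_card_nsmul _ _ _ hj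
  rw [Finset.card_range, nsmul_eq_mul] at h1
  have h2 : (p : ℝ)⁻¹ * (k * (ξ / (8 * q))) ≤ ξ / 4 := by
    calc (p : ℝ)⁻¹ * (k * (ξ / (8 * q))) ≤ (p : ℝ)⁻¹ * (2 * q * p * (ξ / (8 * q))) := by gcongr
      _ = ξ / 4 := by field_simp; norm_num
  have h3 := mul_le_mul_of_nonneg_left h1 (inv_pos.2 hp0').le
  linarith

omit [Fintype ι] [Nonempty ι] in
lemma one_le_inv_A_pow (S : GraphIFS ι) (h : ℕ) : 1 ≤ 1 / S.A ^ h := by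
  rw [le_div_iff₀ (pow_pos S.A_pos h), one_mul]
  exact pow_le_one₀ S.A_pos.le S.A_lt_one.le

lemma g_le_exp {B c : ℝ} (hB : ∀ y, |y| ≤ 1 → |S.U c y| ≤ B) (h : ℕ) (z : ℝ) :
    S.g h c z ≤ Real.exp B * Real.exp (-|z * S.A ^ h|) := by
  have hA := pow_pos S.A_pos h
  rw [← Real.exp_add]
  rcases le_total |z * S.A ^ h| B with h1 | h1
  · exact (S.g_le_one _ _ _).trans (Real.one_le_exp (by linarith))
  · refine (S.g_tail hB h z).trans (Real.exp_le_exp.2 ?_)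
    have h2 : B / S.A ^ h - |z| = (B - |z * S.A ^ h|) * (1 / S.A ^ h) := by
      rw [abs_mul, abs_of_pos hA]; field_simp
    rw [h2]
    nlinarith [S.one_le_inv_A_pow h]

lemma intervalIntegral_g_le {B c : ℝ} (hB : ∀ y, |y| ≤ 1 → |S.U c y| ≤ B) (h : ℕ)
    (z : ℝ) : ∫ t in (-(1 / S.A ^ h))..(1 / S.A ^ h), S.g h c (z + t) ≤
      2 * Real.exp (B + 2) * Real.exp (-|z * S.A ^ h|) := by
  have hA := pow_pos S.A_pos h
  have hq := S.one_le_inv_A_pow h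
  set q := 1 / S.A ^ h with hqdef
  rw [mul_assoc, ← Real.exp_add]
  rcases le_total |z * S.A ^ h| (B + 2) with h1 | h1
  · rw [intervalIntegral.integral_of_le (by linarith)]
    have h2 : ∫ t, S.g h c (z + t) = 2 := by
      rw [integral_add_left_eq_self (S.g h c), S.integral_g]
    have h3 : ∫ t in Set.Ioc (-q) q, S.g h c (z + t) ≤ 2 := by
      rw [← h2]
      exact setIntegral_le_integral ((S.integrable_g h c).comp_add_left z)
        (Eventually.of_forall fun t => (S.g_pos _ _ _).le)
    have := Real.one_le_exp (show 0 ≤ B + 2 + -|z * S.A ^ h| by linarith)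
    linarith
  · have h2 : ∀ t ∈ Set.Icc (-q) q, S.g h c (z + t) ≤ Real.exp (q * (B + 1 - |z * S.A ^ h|)) := by
      intro t ht
      refine (S.g_tail hB h _).trans (Real.exp_le_exp.2 ?_)
      have h3 : q * (B + 1 - |z * S.A ^ h|) = B / S.A ^ h + q - |z| := by
        rw [abs_mul, abs_of_pos hA, hqdef]; field_simp
      have h4 := abs_sub_abs_le_abs_sub z (-t)
      rw [sub_neg_eq_add, abs_neg] at h4
      have h5 : |t| ≤ q := abs_le.2 ht
      linarith
    have h3 := intervalIntegral.integral_mono_on (show -q ≤ q by linarith)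
      (Continuous.intervalIntegrable
        ((S.continuous_g h c).comp (continuous_const.add continuous_id)) _ _)
      (intervalIntegrable_const (μ := volume) (c := Real.exp (q * (B + 1 - |z * S.A ^ h|)))) h2
    refine h3.trans ?_
    rw [intervalIntegral.integral_const, smul_eq_mul]
    have h4 := Real.add_one_le_exp (q - 1)
    have h5 : q * Real.exp (q * (B + 1 - |z * S.A ^ h|)) ≤
        Real.exp (B + 2 + -|z * S.A ^ h|) := by
      calc _ ≤ Real.exp (q - 1) * Real.exp (q * (B + 1 - |z * S.A ^ h|)) := by
            exact mul_le_mul_of_nonneg_right (by linarith) (Real.exp_pos _).le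
        _ ≤ _ := by
            rw [← Real.exp_add]
            exact Real.exp_le_exp.2 (by nlinarith)
    linarith

lemma g_add_le {B C c : ℝ} (hC : S.SlopeBound C)
    (hB : ∀ c y, |c| ≤ C → |y| ≤ 1 → |S.U c y| ≤ B) (hc : |c| ≤ C) (m h : ℕ)
    (y : ℝ) :
    S.g (m + h) c (y / S.A ^ (m + h)) ≤ Real.exp B * S.g m c (y / S.A ^ m) := by
  have hA := S.A_pos
  rw [S.g_add, g, ← wavg_mul_left]
  refine wavg_mono fun w hw => ?_
  have h1 := S.g_le_exp (fun y => hB _ y (hC.act_le hc w)) h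
    (y / S.A ^ (m + h) - S.U c (S.pt w) / S.A ^ (m + h))
  rw [cg, hw]
  convert h1 using 5
  rw [pow_add]
  field_simp

lemma g_add_le_of_not_mem_ev {B C c ℓ : ℝ} (hC : S.SlopeBound C)
    (hB : ∀ c y, |c| ≤ C → |y| ≤ 1 → |S.U c y| ≤ B) (hc : |c| ≤ C) (m h : ℕ)
    (hℓ : 1 / S.A ^ h ≤ ℓ) (y : ℝ) (hy : y / S.A ^ (m + h) ∉ S.ev 2 ℓ (m + h) c) :
    S.g (m + h) c (y / S.A ^ (m + h)) ≤ Real.exp (B + 4) * S.A ^ h * S.g m c (y / S.A ^ m) := by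
  have hA := S.A_pos
  have hAh := pow_pos hA h
  have hq := S.one_le_inv_A_pow h
  set q := 1 / S.A ^ h with hqdef
  set x := y / S.A ^ (m + h) with hx
  have hcont : ∀ n c x, Continuous fun t => S.g n c (x + t) := fun n c x =>
    (S.continuous_g n c).comp (continuous_const.add continuous_id)
  have h1 : ∫ t in (-q)..q, S.g (m + h) c (x + t) ≤
      2 * Real.exp (B + 2) * S.g m c (y / S.A ^ m) := by
    have h2 : ∀ t, S.g (m + h) c (x + t) = wavg m fun w => S.cg h c w (x + t) := fun t =>
      S.g_add _ _ _ _
    have h3 : ∫ t in (-q)..q, S.g (m + h) c (x + t) =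
        wavg m fun w => ∫ t in (-q)..q, S.cg h c w (x + t) := by
      simp_rw [h2, wavg]
      rw [intervalIntegral.integral_div, intervalIntegral.integral_finsetSum]
      exact fun v _ => Continuous.intervalIntegrable
        ((S.continuous_cg h c _).comp (continuous_const.add continuous_id)) _ _
    rw [h3, g, ← wavg_mul_left]
    refine wavg_mono fun w hw => ?_
    have h4 := S.intervalIntegral_g_le (fun y => hB _ y (hC.act_le hc w)) h
      (x - S.U c (S.pt w) / S.A ^ (m + h))
    have h5 : ∀ t, S.cg h c w (x + t) =
        S.g h (S.act c w) (x - S.U c (S.pt w) / S.A ^ (m + h) + t) := fun t => by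
      rw [cg, hw]; congr 1; ring
    simp_rw [h5]
    convert h4 using 5
    rw [hx, pow_add]
    field_simp
  have h2 : ∀ t ∈ Set.Icc (-q) q, Real.exp (-2) * S.g (m + h) c x ≤ S.g (m + h) c (x + t) := by
    intro t ht
    have h3 : ¬ 2 < |S.incr (m + h) c [] x t| := fun h => hy ⟨t, (abs_le.2 ht).trans hℓ, h⟩
    have h4 := (abs_le.1 (not_lt.1 h3)).1
    rw [incr, S.cg_nil, S.cg_nil] at h4
    rw [← Real.exp_log (S.g_pos (m + h) c x), ← Real.exp_log (S.g_pos (m + h) c (x + t)),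
      ← Real.exp_add]
    gcongr
    linarith
  have h3 := intervalIntegral.integral_mono_on (show -q ≤ q by linarith)
    (intervalIntegrable_const (μ := volume) (c := Real.exp (-2) * S.g (m + h) c x))
    ((hcont _ _ _).intervalIntegrable _ _) h2
  rw [intervalIntegral.integral_const, smul_eq_mul] at h3
  have h4 : q * (Real.exp (-2) * S.g (m + h) c x) ≤ Real.exp (B + 2) * S.g m c (y / S.A ^ m) := by
    linarith
  have h5 : S.g (m + h) c x =
      Real.exp 2 * S.A ^ h * (q * (Real.exp (-2) * S.g (m + h) c x)) := by
    have : Real.exp 2 * Real.exp (-2) = 1 := by rw [← Real.exp_add]; simp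
    have h6 : S.A ^ h * q = 1 := by rw [hqdef]; field_simp
    linear_combination (- S.g (m + h) c x) * this -
      (Real.exp 2 * Real.exp (-2) * S.g (m + h) c x) * h6
  rw [h5]
  calc _ ≤ Real.exp 2 * S.A ^ h * (Real.exp (B + 2) * S.g m c (y / S.A ^ m)) := by gcongr
    _ = _ := by
      rw [show B + 4 = 2 + (B + 2) by ring, Real.exp_add 2]; ring

omit [Nonempty ι] in
lemma mem_ev_of_abs_sub_le {ℓ d x x' c : ℝ} {n : ℕ} (hd : |x - x'| ≤ d) (hℓ : 0 ≤ ℓ)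
    (hx : x ∈ S.ev 2 ℓ n c) :
    x' ∈ S.ev 1 (ℓ + d) n c := by
  by_contra hcon
  obtain ⟨t, ht, h⟩ := hx
  have key : ∀ t, |t| ≤ ℓ + d → |S.incr n c [] x' t| ≤ 1 := fun t ht =>
    not_lt.1 fun h => hcon ⟨t, ht, h⟩
  have h1 := key (x - x' + t) ((abs_add_le _ _).trans (by linarith))
  have h2 := key (x - x') (by linarith)
  have h3 : S.incr n c [] x t = S.incr n c [] x' (x - x' + t) - S.incr n c [] x' (x - x') := by
    simp only [incr]
    rw [show x' + (x - x' + t) = x + t by ring, show x' + (x - x') = x by ring]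
    ring
  rw [h3] at h
  have h4 := abs_sub (S.incr n c [] x' (x - x' + t)) (S.incr n c [] x' (x - x'))
  linarith

open Classical in
lemma wavg_mem_ev_le {B C c ℓ : ℝ} (hC : S.SlopeBound C)
    (hB : ∀ c y, |c| ≤ C → |y| ≤ 1 → |S.U c y| ≤ B) (hc : |c| ≤ C) (hℓ : 0 ≤ ℓ)
    (m j : ℕ) :
    (wavg (m + j) fun w => if S.U c (S.pt w) / S.A ^ m ∈ S.ev 2 ℓ m c then (1:ℝ) else 0) ≤
      2 * ∫ z, (S.ev 1 (ℓ + (B + 1)) m c).indicator (S.g m c) z := by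
  have hA := pow_pos S.A_pos m
  set E := S.ev 1 (ℓ + (B + 1)) m c with hE
  have hEm : MeasurableSet E := (S.isOpen_ev _ _ _ _).measurableSet
  have hinteg : ∀ x, Integrable (E.indicator fun z => Real.exp (-|z - x|)) := fun x =>
    (integrable_exp_neg_abs.comp_sub_right x).indicator hEm
  have h1 : ∫ z, E.indicator (S.g m c) z =
      wavg m fun u => ∫ z, E.indicator (fun z => Real.exp (-|z - S.U c (S.pt u) / S.A ^ m|)) z := by
    rw [← integral_wavg fun w _ => hinteg _]
    congr 1
    ext z
    by_cases hz : z ∈ E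
    · simp [hz, g]
    · simp [hz, wavg]
  rw [h1, wavg_append, ← wavg_mul_left]
  refine wavg_mono fun u hu => wavg_le fun v _ => ?_
  have h0 : 0 ≤ ∫ z, E.indicator (fun z => Real.exp (-|z - S.U c (S.pt u) / S.A ^ m|)) z :=
    integral_nonneg fun z => Set.indicator_nonneg (fun z _ => (Real.exp_pos _).le) _
  split_ifs with hw
  · set x := S.U c (S.pt u) / S.A ^ m with hx
    have hsub : Set.Icc (x - 1) (x + 1) ⊆ E := fun z hz => by
      refine mem_ev_of_abs_sub_le ?_ hℓ hw
      have h2 : S.U c (S.pt (u ++ v)) / S.A ^ m - z =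
          S.U (S.act c u) (S.pt v) + (x - z) := by
        rw [S.U_append, hu, hx]; field_simp; ring
      rw [h2]
      have h3 := hB _ _ (hC.act_le hc u) (S.abs_pt_le v)
      have h4 : |x - z| ≤ 1 := abs_le.2 ⟨by linarith [hz.2], by linarith [hz.1]⟩
      exact (abs_add_le _ _).trans (by linarith)
    have h2 : ∫ z, (Set.Icc (x - 1) (x + 1)).indicator (fun _ => (1 / 3 : ℝ)) z ≤
        ∫ z, E.indicator (fun z => Real.exp (-|z - x|)) z := by
      refine integral_mono ((integrable_indicator_iff measurableSet_Icc).2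
        (integrableOn_const (by simp))) (hinteg x) fun z => ?_
      by_cases hz : z ∈ Set.Icc (x - 1) (x + 1)
      · rw [Set.indicator_of_mem hz, Set.indicator_of_mem (hsub hz)]
        have h3 : |z - x| ≤ 1 := abs_le.2 ⟨by linarith [hz.1], by linarith [hz.2]⟩
        calc (1 / 3 : ℝ) ≤ Real.exp (-1) := by
              rw [Real.exp_neg, one_div]
              gcongr
              exact Real.exp_one_lt_d9.le.trans (by norm_num)
          _ ≤ _ := by gcongr
      · rw [Set.indicator_of_notMem hz]
        exact Set.indicator_nonneg (fun z _ => (Real.exp_pos _).le) _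
    rw [integral_indicator measurableSet_Icc, setIntegral_const, measureReal_def,
      Real.volume_Icc, show x + 1 - (x - 1) = 2 by ring, ENNReal.toReal_ofReal (by norm_num),
      smul_eq_mul] at h2
    linarith
  · linarith

open Classical in
/-- The indicator of the words of length `L` whose neighbourhood at scale `A ^ L` carries too large
a proportion of the words. -/
noncomputable def hv (S : GraphIFS ι) (L : ℕ) (ε c : ℝ) (w : List ι) : ℝ :=
  if S.A ^ ((L : ℝ) * (1 - ε)) < S.g L c (S.U c (S.pt w) / S.A ^ L) then 1 else 0

omit [Nonempty ι] in
lemma hv_nonneg (L : ℕ) (ε c : ℝ) (w : List ι) : 0 ≤ S.hv L ε c w := by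
  unfold hv; split_ifs <;> norm_num

omit [Nonempty ι] in
lemma hv_le_one (L : ℕ) (ε c : ℝ) (w : List ι) : S.hv L ε c w ≤ 1 := by
  unfold hv; split_ifs <;> norm_num

lemma bddOn_hv (L : ℕ) (ε C : ℝ) : BddOn C fun c => wavg L (S.hv L ε c) :=
  BddOn.of_le (R := 1) (fun _ _ => wavg_nonneg fun _ _ => hv_nonneg _ _ _ _)
    fun _ _ => wavg_le fun _ _ => hv_le_one _ _ _ _

open Classical in
lemma g_le_prod {B C c ℓ : ℝ} (hC : S.SlopeBound C)
    (hB : ∀ c y, |c| ≤ C → |y| ≤ 1 → |S.U c y| ≤ B) (hc : |c| ≤ C) (L h : ℕ)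
    (hℓ : 1 / S.A ^ h ≤ ℓ) (y : ℝ) (I : ℕ) :
    S.g (L + h * I) c (y / S.A ^ (L + h * I)) ≤ Real.exp (B + 4) ^ I *
      ∏ i ∈ Finset.range I, (if y / S.A ^ (L + h * (i + 1)) ∈ S.ev 2 ℓ (L + h * (i + 1)) c
        then 1 else S.A ^ h) := by
  have hA := S.A_pos
  induction I with
  | zero => simpa using S.g_le_one _ _ _
  | succ I ih =>
    have hg := (S.g_pos (L + h * I) c (y / S.A ^ (L + h * I))).le
    rw [Finset.prod_range_succ, pow_succ]
    have hstep : S.g (L + h * (I + 1)) c (y / S.A ^ (L + h * (I + 1))) ≤ Real.exp (B + 4) *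
        (if y / S.A ^ (L + h * (I + 1)) ∈ S.ev 2 ℓ (L + h * (I + 1)) c
        then 1 else S.A ^ h) * S.g (L + h * I) c (y / S.A ^ (L + h * I)) := by
      split_ifs with hev
      · have := g_add_le hC hB hc (L + h * I) h y
        rw [show L + h * (I + 1) = L + h * I + h by ring, mul_one]
        refine this.trans ?_
        gcongr
        linarith
      · rw [show L + h * (I + 1) = L + h * I + h by ring] at hev ⊢
        exact g_add_le_of_not_mem_ev hC hB hc (L + h * I) h hℓ y hev
    have hf : 0 ≤ (if y / S.A ^ (L + h * (I + 1)) ∈ S.ev 2 ℓ (L + h * (I + 1)) c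
        then 1 else S.A ^ h) := by split_ifs <;> positivity
    refine hstep.trans ((mul_le_mul_of_nonneg_left ih (by positivity)).trans_eq ?_)
    ring

lemma SlopeBound.exists_Lam_hv_le {C : ℝ} (hC : S.SlopeBound C)
    (hs : ∃ a a', S.s a ≠ S.s a') (hK : 1 < Fintype.card ι * S.A) {ε : ℝ} (hε : 0 < ε)
    (hε1 : ε < 1) (L₁ : ℕ) : ∃ L ≥ L₁, S.Lam (fun c => wavg L (S.hv L ε c)) ≤ ε := by
  classical
  have hA := S.A_pos
  obtain ⟨B, hB0, hB⟩ := S.exists_U_bound C hC.1.le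
  set a := -Real.log S.A with ha
  have ha0 : 0 < a := by rw [ha, neg_pos]; exact Real.log_neg hA S.A_lt_one
  obtain ⟨h, hh⟩ := exists_nat_ge ((B + 4) / (a * (ε / 4)))
  have hh0 : (0 : ℝ) < h := lt_of_lt_of_le (by positivity) hh
  rw [div_le_iff₀ (by positivity)] at hh
  set ℓ := 1 / S.A ^ h with hℓ
  have hℓ1 : 1 ≤ ℓ := S.one_le_inv_A_pow h
  obtain ⟨L₀, hL₀⟩ := hC.exists_Lam_ev_le hs hK (ℓ := ℓ + (B + 1)) (ξ := ε * (ε / 4) / 2)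
    (by linarith) (by positivity)
  obtain ⟨I, hI⟩ := exists_nat_ge (L₀ / (2 * (ε / 4) * h) + L₁ + 1)
  have hpos : 0 ≤ L₀ / (2 * (ε / 4) * h) := by positivity
  have hIL : L₁ ≤ I := by
    have : (L₁ : ℝ) ≤ I := by linarith
    exact_mod_cast this
  have hI0 : (0 : ℝ) < I := by
    have : (0 : ℝ) ≤ L₁ := by positivity
    linarith
  have hIL0 : (L₀ : ℝ) ≤ 2 * (ε / 4) * h * I := by
    have : L₀ / (2 * (ε / 4) * h) ≤ I := by
      have : (0 : ℝ) ≤ L₁ := by positivity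
      linarith
    rw [div_le_iff₀ (by positivity)] at this
    linarith
  have hh1 : 1 ≤ h := by exact_mod_cast hh0
  set L := L₀ + h * I with hL
  have hLL : L₁ ≤ L := by nlinarith
  set m : ℕ → ℕ := fun i => L₀ + h * (i + 1) with hm
  set bad : ℕ → ℝ → List ι → ℝ := fun i c w =>
    if S.U c (S.pt w) / S.A ^ m i ∈ S.ev 2 ℓ (m i) c then 1 else 0 with hbad
  have hfew : ∀ c, |c| ≤ C → ∀ w, (∑ i ∈ Finset.range I, bad i c w) ≤ ε / 4 * I →
      S.hv L ε c w = 0 := by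
    intro c hc w hw
    unfold hv
    rw [if_neg (not_lt.2 ?_)]
    refine (g_le_prod hC hB hc L₀ h le_rfl _ I).trans ?_
    have h1 : ∏ i ∈ Finset.range I, (if S.U c (S.pt w) / S.A ^ (L₀ + h * (i + 1)) ∈
        S.ev 2 ℓ (L₀ + h * (i + 1)) c then 1 else S.A ^ h) =
        Real.exp (∑ i ∈ Finset.range I, -(a * h) * (1 - bad i c w)) := by
      rw [Real.exp_sum]
      refine Finset.prod_congr rfl fun i _ => ?_
      simp only [hbad, hm]
      split_ifs
      · simp
      · rw [ha, sub_zero, mul_one, neg_mul, neg_neg, mul_comm, Real.exp_nat_mul, Real.exp_log hA]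
    rw [h1, ← Finset.mul_sum, Finset.sum_sub_distrib, Finset.sum_const, Finset.card_range,
      nsmul_eq_mul, mul_one, ← Real.exp_nat_mul, ← Real.exp_add, Real.rpow_def_of_pos hA]
    refine Real.exp_le_exp.2 ?_
    have h2 : Real.log S.A = -a := by rw [ha, neg_neg]
    have hLr : (L : ℝ) = L₀ + h * I := by rw [hL]; push_cast; ring
    rw [h2, hLr]
    set k := ∑ i ∈ Finset.range I, bad i c w
    have h3 : a * h * k ≤ a * h * (ε / 4 * I) := by gcongr
    have h4 : (I : ℝ) * (B + 4) ≤ I * (h * (a * (ε / 4))) := by gcongr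
    have h5 : a * (L₀ * (1 - ε)) ≤ a * (2 * (ε / 4) * h * I) := by
      refine mul_le_mul_of_nonneg_left (le_trans ?_ hIL0) ha0.le
      exact mul_le_of_le_one_right (Nat.cast_nonneg _) (by linarith)
    nlinarith
  have hpt : ∀ c, |c| ≤ C → wavg L (S.hv L ε c) ≤ (ε / 4 * I)⁻¹ * ∑ i ∈ Finset.range I,
      2 * ∫ z, (S.ev 1 (ℓ + (B + 1)) (m i) c).indicator (S.g (m i) c) z := by
    intro c hc
    have h1 : wavg L (S.hv L ε c) ≤
        wavg L fun w => (ε / 4 * I)⁻¹ * ∑ i ∈ Finset.range I, bad i c w := by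
      refine wavg_mono fun w _ => ?_
      have h0 : 0 ≤ ∑ i ∈ Finset.range I, bad i c w := Finset.sum_nonneg fun i _ => by
        simp only [hbad]; split_ifs <;> norm_num
      by_cases hw : (∑ i ∈ Finset.range I, bad i c w) ≤ ε / 4 * I
      · rw [hfew c hc w hw]
        positivity
      · refine (hv_le_one _ _ _ _).trans ?_
        rw [inv_mul_eq_div, le_div_iff₀ (by positivity)]
        linarith
    refine h1.trans ?_
    rw [wavg_mul_left, wavg_finset_sum]
    gcongr with i hi
    have hi' := Finset.mem_range.1 hi
    obtain ⟨j, hj⟩ : ∃ j, L = m i + j := Nat.exists_eq_add_of_le (by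
      simp only [hL, hm]
      have : h * (i + 1) ≤ h * I := Nat.mul_le_mul_left _ hi'
      omega)
    rw [hj]
    exact wavg_mem_ev_le hC hB hc (by linarith) (m i) j
  have hb : ∀ i, BddOn C fun c => 2 * ∫ z, (S.ev 1 (ℓ + (B + 1)) (m i) c).indicator
    (S.g (m i) c) z := fun i => (bddOn_ev _ _ _ _).const_mul _
  have hsum := BddOn.sum (Finset.range I) fun i _ => hb i
  refine ⟨L, hLL, (hC.Lam_mono (bddOn_hv L ε C) (hsum.const_mul _) hpt).trans ?_⟩
  rw [hC.Lam_const_mul _ hsum, hC.Lam_sum _ fun i _ => hb i]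
  have h1 : ∀ i ∈ Finset.range I, S.Lam (fun c => 2 * ∫ z,
      (S.ev 1 (ℓ + (B + 1)) (m i) c).indicator (S.g (m i) c) z) ≤ ε * (ε / 4) := fun i _ => by
    rw [hC.Lam_const_mul _ (bddOn_ev _ _ _ _)]
    have := hL₀ (m i) (by simp only [hm]; omega)
    linarith
  have h2 := Finset.sum_le_card_nsmul _ _ _ h1
  rw [Finset.card_range, nsmul_eq_mul] at h2
  calc _ ≤ (ε / 4 * I)⁻¹ * (I * (ε * (ε / 4))) := by gcongr
    _ = ε := by field_simp

end GraphIFS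

/-- The prefix of length `n` of an infinite word. -/
def pre {ι : Type} (n : ℕ) (ω : ℕ → ι) : List ι := List.ofFn fun i : Fin n => ω i

section pre
variable {ι : Type}

lemma length_pre (n : ℕ) (ω : ℕ → ι) : (pre n ω).length = n := by simp [pre]

lemma pre_succ (n : ℕ) (ω : ℕ → ι) : pre (n + 1) ω = ω 0 :: pre n fun i => ω (i + 1) := by
  simp [pre, List.ofFn_succ]

lemma pre_add (n m : ℕ) (ω : ℕ → ι) : pre (n + m) ω = pre n ω ++ pre m fun i => ω (i + n) := by
  induction n generalizing ω with
  | zero => simp [pre]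
  | succ n ih =>
    rw [show n + 1 + m = n + m + 1 by ring, pre_succ, pre_succ, ih]
    simp [add_assoc]

lemma wavg_eq_le [Fintype ι] (n : ℕ) (u : List ι) [DecidableEq ι] :
    (wavg n fun v => if v = u then (1 : ℝ) else 0) ≤ 1 / (Fintype.card ι : ℝ) ^ n := by
  unfold wavg
  gcongr
  rw [Finset.sum_boole]
  have : (Finset.univ.filter fun v : Fin n → ι => List.ofFn v = u).card ≤ 1 := by
    rw [Finset.card_le_one]
    intro a ha b hb
    simp only [Finset.mem_filter, Finset.mem_univ, true_and] at ha hb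
    exact List.ofFn_injective (ha.trans hb.symm)
  exact_mod_cast this

open Classical in
lemma exists_measure_le_wavg (ι : Type) [Fintype ι] [Nonempty ι] [MeasurableSpace ι]
    [MeasurableSingletonClass ι] : ∃ P : Measure (ℕ → ι), IsProbabilityMeasure P ∧
      ∀ (p : (ℕ → ι) → Prop) (n : ℕ), P {ω | p ω} ≤
        ENNReal.ofReal (wavg n fun w => if ∃ ω, pre n ω = w ∧ p ω then 1 else 0) := by
  refine ⟨Measure.infinitePi fun _ => (PMF.uniformOfFintype ι).toMeasure, inferInstance,
    fun p n => ?_⟩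
  have hK : (0 : ℝ) < Fintype.card ι := by exact_mod_cast Fintype.card_pos
  set P := Measure.infinitePi fun _ : ℕ => (PMF.uniformOfFintype ι).toMeasure with hP
  set W := Finset.univ.filter fun v : Fin n → ι => ∃ ω, pre n ω = List.ofFn v ∧ p ω with hW
  have hcyl : ∀ v : Fin n → ι, P {ω | ∀ i : Fin n, ω i = v i} =
      ENNReal.ofReal (1 / (Fintype.card ι : ℝ) ^ n) := by
    intro v
    have h1 : {ω : ℕ → ι | ∀ i : Fin n, ω i = v i} = (Finset.range n : Set ℕ).pi
        fun i => {ω | ∀ h : i < n, ω = v ⟨i, h⟩} := by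
      ext ω
      simp only [Set.mem_ofPred_eq, Set.mem_pi, Finset.coe_range, Set.mem_Iio]
      exact ⟨fun h i _ hi => h ⟨i, hi⟩, fun h i => h i i.2 i.2⟩
    rw [h1, hP, Measure.infinitePi_pi _ fun i _ => Set.Finite.measurableSet (Set.toFinite _)]
    have h2 : ∀ i ∈ Finset.range n, (PMF.uniformOfFintype ι).toMeasure
        {ω | ∀ h : i < n, ω = v ⟨i, h⟩} = ENNReal.ofReal (1 / Fintype.card ι) := by
      intro i hi
      have hi' := Finset.mem_range.1 hi
      have h3 : {ω | ∀ h : i < n, ω = v ⟨i, h⟩} = {v ⟨i, hi'⟩} := by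
        ext ω
        simp [hi']
      rw [h3, PMF.toMeasure_apply_singleton _ _ (measurableSet_singleton _),
        PMF.uniformOfFintype_apply, one_div, ENNReal.ofReal_inv_of_pos hK, ENNReal.ofReal_natCast]
    rw [Finset.prod_congr rfl h2, Finset.prod_const, Finset.card_range,
      ← ENNReal.ofReal_pow (by positivity), one_div_pow]
  have hsub : {ω | p ω} ⊆ ⋃ v ∈ W, {ω | ∀ i : Fin n, ω i = v i} := by
    intro ω hω
    refine Set.mem_biUnion (x := fun i : Fin n => ω i) ?_ fun i => rfl
    simp only [hW, Finset.coe_filter, Finset.mem_univ, true_and]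
    exact ⟨ω, rfl, hω⟩
  refine (measure_mono hsub).trans ((measure_biUnion_finset_le _ _).trans ?_)
  rw [Finset.sum_congr rfl fun v _ => hcyl v, Finset.sum_const, nsmul_eq_mul, wavg,
    Finset.sum_boole, ← ENNReal.ofReal_natCast, ← ENNReal.ofReal_mul (by positivity), mul_one_div]

end pre

namespace GraphIFS
variable {ι : Type} (S : GraphIFS ι)

/-- The point of the attractor coded by an infinite word. -/
noncomputable def code (ω : ℕ → ι) : ℝ := ∑' i, S.b ^ i * S.t (ω i)

lemma abs_t_le (a : ι) : |S.t a| ≤ 1 - S.b := by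
  have h1 := (abs_le.1 (S.maps a 1 (by simp))).2
  have h2 := (abs_le.1 (S.maps a (-1) (by simp))).1
  exact abs_le.2 ⟨by linarith, by linarith⟩

lemma norm_code_term_le (ω : ℕ → ι) (i : ℕ) : ‖S.b ^ i * S.t (ω i)‖ ≤ S.b ^ i * (1 - S.b) := by
  have hb := pow_pos S.b_pos i
  rw [Real.norm_eq_abs, abs_mul, abs_of_pos hb]
  exact mul_le_mul_of_nonneg_left (S.abs_t_le _) hb.le

lemma hasSum_code_bound : HasSum (fun i => S.b ^ i * (1 - S.b)) 1 := by
  have := (hasSum_geometric_of_lt_one S.b_pos.le S.b_lt_one).mul_right (1 - S.b)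
  rwa [inv_mul_cancel₀ (sub_pos.2 S.b_lt_one).ne'] at this

lemma abs_code_le (ω : ℕ → ι) : |S.code ω| ≤ 1 :=
  tsum_of_norm_bounded S.hasSum_code_bound (S.norm_code_term_le ω)

lemma code_succ (ω : ℕ → ι) : S.code ω = S.b * S.code (fun i => ω (i + 1)) + S.t (ω 0) := by
  have h := Summable.of_norm_bounded S.hasSum_code_bound.summable (S.norm_code_term_le ω)
  rw [code, h.tsum_eq_zero_add, code, ← tsum_mul_left, pow_zero, one_mul, add_comm]
  congr 1
  exact tsum_congr fun i => by ring

lemma code_eq (n : ℕ) (ω : ℕ → ι) :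
    S.code ω = S.b ^ n * S.code (fun i => ω (i + n)) + S.pt (pre n ω) := by
  induction n generalizing ω with
  | zero => simp [pre]
  | succ n ih =>
    rw [S.code_succ, ih, pre_succ, pt_cons]
    simp only [add_assoc]
    ring

lemma continuous_code [TopologicalSpace ι] [DiscreteTopology ι] : Continuous S.code :=
  continuous_tsum
    (fun i => continuous_const.mul (continuous_of_discreteTopology.comp (continuous_apply i)))
    S.hasSum_code_bound.summable fun i ω => S.norm_code_term_le ω i

open Classical in
lemma wavg_close_le [Fintype ι] {C B Q : ℝ} {S : GraphIFS ι} (hC : S.SlopeBound C)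
    (hB : ∀ c y, |c| ≤ C → |y| ≤ 1 → |S.U c y| ≤ B) (hQ : 0 ≤ Q)
    (hcount : ∀ c, |c| ≤ C → ∀ y,
      ((Finset.univ.filter fun a => |S.U c (S.t a) - y| ≤ (B + 1) * S.A).card : ℝ) ≤ Q)
    (m : ℕ) (c y R : ℝ) (hc : |c| ≤ C) (hR : R ≤ S.A ^ m) :
    (wavg m fun v => if ∃ x, |x| ≤ 1 ∧ |S.U c (S.b ^ m * x + S.pt v) - y| ≤ R then (1 : ℝ) else 0)
      ≤ (Q / Fintype.card ι) ^ m := by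
  induction m generalizing c y R with
  | zero =>
    rw [wavg_zero, pow_zero]
    split_ifs <;> norm_num
  | succ m ih =>
    have hA := S.A_pos
    rw [wavg_succ, pow_succ' (Q / _), div_mul_eq_mul_div]
    gcongr
    set q := (Q / Fintype.card ι) ^ m with hq
    have hq0 : 0 ≤ q := by positivity
    have key : ∀ a, (wavg m fun w => if ∃ x, |x| ≤ 1 ∧
        |S.U c (S.b ^ (m + 1) * x + S.pt (a :: w)) - y| ≤ R then (1 : ℝ) else 0) ≤
        (if |S.U c (S.t a) - y| ≤ (B + 1) * S.A then 1 else 0) * q := by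
      intro a
      have hU : ∀ z, |z| ≤ 1 → S.U c (S.b * z + S.t a) =
          S.A * S.U (S.act c [a]) z + S.U c (S.t a) := fun z hz => by
        simpa using S.U_word c [a] z hz
      have hc' : |S.act c [a]| ≤ C := hC.act_le hc [a]
      have hRA : R / S.A ≤ S.A ^ m := by
        rw [div_le_iff₀ hA]; rwa [pow_succ] at hR
      refine le_trans (wavg_mono (g := fun w =>
        (if |S.U c (S.t a) - y| ≤ (B + 1) * S.A then 1 else 0) *
        (if ∃ x, |x| ≤ 1 ∧ |S.U (S.act c [a]) (S.b ^ m * x + S.pt w) -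
          (y - S.U c (S.t a)) / S.A| ≤ R / S.A then (1 : ℝ) else 0)) fun w hw => ?_) ?_
      · by_cases h : ∃ x, |x| ≤ 1 ∧ |S.U c (S.b ^ (m + 1) * x + S.pt (a :: w)) - y| ≤ R
        · obtain ⟨x, hx, h⟩ := h
          have hz : |S.b ^ m * x + S.pt w| ≤ 1 := hw ▸ S.abs_map_le w x hx
          rw [pt_cons, show S.b ^ (m + 1) * x + (S.b * S.pt w + S.t a) =
            S.b * (S.b ^ m * x + S.pt w) + S.t a by ring, hU _ hz] at h
          have hUB := hB _ _ hc' hz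
          set V := S.U (S.act c [a]) (S.b ^ m * x + S.pt w) with hV
          have h1 : |S.U c (S.t a) - y| ≤ (B + 1) * S.A := by
            have h2 := abs_sub (S.A * V + S.U c (S.t a) - y) (S.A * V)
            rw [abs_mul, abs_of_pos hA,
              show S.A * V + S.U c (S.t a) - y - S.A * V = S.U c (S.t a) - y by ring] at h2
            have h3 : S.A ^ (m + 1) ≤ S.A := by
              rw [pow_succ]
              exact mul_le_of_le_one_left hA.le (pow_le_one₀ hA.le S.A_lt_one.le)
            nlinarith
          have h2 : |V - (y - S.U c (S.t a)) / S.A| ≤ R / S.A := by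
            rw [show V - (y - S.U c (S.t a)) / S.A = (S.A * V + S.U c (S.t a) - y) / S.A by
              field_simp; ring, abs_div, abs_of_pos hA]
            gcongr
          have h3 : ∃ x, |x| ≤ 1 ∧ |S.U (S.act c [a]) (S.b ^ m * x + S.pt w) -
            (y - S.U c (S.t a)) / S.A| ≤ R / S.A := ⟨x, hx, h2⟩
          rw [if_pos h1, if_pos h3]
          split_ifs <;> norm_num
        · rw [if_neg h]
          split_ifs <;> norm_num
      · rw [wavg_mul_left]
        have := ih (S.act c [a]) ((y - S.U c (S.t a)) / S.A) (R / S.A) hc' hRA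
        refine mul_le_mul_of_nonneg_left this ?_
        split_ifs <;> norm_num
    refine (Finset.sum_le_sum fun a _ => key a).trans ?_
    rw [← Finset.sum_mul, Finset.sum_boole]
    exact mul_le_mul_of_nonneg_right (hcount c hc y) hq0

end GraphIFS

namespace GraphIFS
variable {ι : Type} [Fintype ι] {S : GraphIFS ι} [Nonempty ι]

/-- The graph of the function of a system. -/
def graph (S : GraphIFS ι) : Set (ℝ × ℝ) := {p | ∃ x ∈ Set.Icc (-1 : ℝ) 1, p = (x, S.T x)}

open Classical in
lemma wavg_prefix_le {C B Q d : ℝ} (hC : S.SlopeBound C)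
    (hB : ∀ c y, |c| ≤ C → |y| ≤ 1 → |S.U c y| ≤ B) (hQ : 0 ≤ Q)
    (hcount : ∀ c, |c| ≤ C → ∀ y,
      ((Finset.univ.filter fun a => |S.U c (S.t a) - y| ≤ (B + 1) * S.A).card : ℝ) ≤ Q)
    {n m : ℕ} (hd : d ≤ S.sep * S.b ^ n) (hdm : d ≤ S.b ^ n) (hm : S.γ ^ n ≤ S.A ^ m)
    {p : (ℕ → ι) → Prop}
    (hp : ∀ ω ω', p ω → p ω' → |S.code ω - S.code ω'| ≤ d ∧
      |S.T (S.code ω) - S.T (S.code ω')| ≤ d) :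
    (wavg (n + m) fun w => if ∃ ω, pre (n + m) ω = w ∧ p ω then (1 : ℝ) else 0) ≤
      1 / (Fintype.card ι : ℝ) ^ n * (Q / Fintype.card ι) ^ m := by
  have hA := pow_pos S.A_pos n
  by_cases hne : ∃ ω, p ω
  swap
  · have : ∀ w, ¬ ∃ ω, pre (n + m) ω = w ∧ p ω := fun w ⟨ω, _, h⟩ => hne ⟨ω, h⟩
    simp only [this, if_false, wavg_const]
    positivity
  obtain ⟨ω₀, hω₀⟩ := hne
  have hpre : ∀ ω, p ω → pre n ω = pre n ω₀ := by
    intro ω hω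
    by_contra hcon
    have h1 := S.separated_words (pre n ω) (pre n ω₀) (by simp [length_pre]) hcon
      (S.code fun i => ω (i + n)) (S.code fun i => ω₀ (i + n)) (S.abs_code_le _) (S.abs_code_le _)
    simp only [length_pre] at h1
    rw [← S.code_eq, ← S.code_eq] at h1
    have h2 := (hp ω ω₀ hω hω₀).1
    rcases Nat.eq_zero_or_pos n with rfl | hn
    · simp [pre] at hcon
    · obtain ⟨k, rfl⟩ := Nat.exists_eq_add_of_le' hn
      simp only [Nat.add_sub_cancel] at h1
      have h3 : S.sep * S.b ^ (k + 1) < S.b ^ k * S.sep := by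
        rw [pow_succ, ← mul_assoc, mul_comm S.sep]
        exact mul_lt_of_lt_one_right (mul_pos (pow_pos S.b_pos k) S.sep_pos) S.b_lt_one
      linarith
  set u := pre n ω₀ with hu
  have hul : u.length = n := length_pre _ _
  set c := S.act 0 u with hc
  have hcC : |c| ≤ C := hC.act_le (by simpa using hC.1.le) u
  set y := S.U c (S.code fun i => ω₀ (i + n)) with hy
  have hclose : ∀ ω, p ω → |S.U c (S.code fun i => ω (i + n)) - y| ≤ S.γ ^ n := by
    intro ω hω
    have key : ∀ ω, p ω → S.T (S.code ω) =
        S.A ^ n * S.U c (S.code fun i => ω (i + n)) + S.U 0 (S.pt u) := by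
      intro ω hω
      have h1 := S.U_word 0 u (S.code fun i => ω (i + n)) (S.abs_code_le _)
      rw [hul, ← hpre ω hω, ← S.code_eq, hpre ω hω] at h1
      simpa [U, hc] using h1
    have h2 := (hp ω ω₀ hω hω₀).2
    rw [key ω hω, key ω₀ hω₀, add_sub_add_right_eq_sub, ← mul_sub, abs_mul, abs_of_pos hA] at h2
    rw [γ, div_pow, le_div_iff₀ hA, mul_comm]
    exact h2.trans hdm
  have hstep : (wavg (n + m) fun w => if ∃ ω, pre (n + m) ω = w ∧ p ω then (1 : ℝ) else 0) ≤
      wavg n fun u' => (if u' = u then 1 else 0) * (Q / Fintype.card ι) ^ m := by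
    rw [wavg_append]
    refine wavg_mono fun u' hu' => ?_
    split_ifs with h
    · rw [one_mul]
      refine le_trans (wavg_mono fun v hv => ?_)
        (wavg_close_le hC hB hQ hcount m c y (S.γ ^ n) hcC hm)
      by_cases h1 : ∃ ω, pre (n + m) ω = u' ++ v ∧ p ω
      · obtain ⟨ω, h1, h2⟩ := h1
        rw [pre_add] at h1
        have h3 := (List.append_inj h1 (by rw [length_pre, hu'])).2
        have h4 : ∃ x, |x| ≤ 1 ∧ |S.U c (S.b ^ m * x + S.pt v) - y| ≤ S.γ ^ n := by
          refine ⟨S.code fun i => ω (i + m + n), S.abs_code_le _, ?_⟩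
          have h5 := S.code_eq m fun i => ω (i + n)
          rw [h3] at h5
          rw [← h5]
          exact hclose ω h2
        rw [if_pos h4]
        split_ifs <;> norm_num
      · rw [if_neg h1]
        split_ifs <;> norm_num
    · rw [zero_mul]
      refine wavg_le fun v _ => ?_
      rw [if_neg]
      rintro ⟨ω, h1, h2⟩
      rw [pre_add] at h1
      have h3 := (List.append_inj h1 (by rw [length_pre, hu'])).1
      exact h (h3 ▸ hpre ω h2)
  refine hstep.trans ?_
  rw [wavg_mul_right]
  gcongr
  exact wavg_eq_le n u

lemma le_dimH_of_count {C B Q : ℝ} (hC : S.SlopeBound C)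
    (hB : ∀ c y, |c| ≤ C → |y| ≤ 1 → |S.U c y| ≤ B) (hQ : 0 < Q) (hQK : Q ≤ Fintype.card ι)
    (hcount : open Classical in ∀ c, |c| ≤ C → ∀ y,
      ((Finset.univ.filter fun a => |S.U c (S.t a) - y| ≤ (B + 1) * S.A).card : ℝ) ≤ Q)
    {σ : NNReal} (hσ : σ * -Real.log S.b < Real.log (Fintype.card ι) +
      Real.log S.γ / Real.log S.A * (Real.log (Fintype.card ι) - Real.log Q)) :
    (σ : ENNReal) ≤ dimH S.graph := by
  classical
  have hb := S.b_pos
  have hA := S.A_pos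
  have hK : (0 : ℝ) < Fintype.card ι := by exact_mod_cast Fintype.card_pos
  set K : ℝ := (Fintype.card ι : ℝ) with hKdef
  set l := Real.log K - Real.log Q with hl
  have hl0 : 0 ≤ l := sub_nonneg.2 (Real.log_le_log hQ hQK)
  have hlA : Real.log S.A < 0 := Real.log_neg hA S.A_lt_one
  have hlγ : Real.log S.γ < 0 := Real.log_neg S.γ_pos S.γ_lt_one
  set θ := Real.log S.γ / Real.log S.A with hθ
  have hθ0 : 0 < θ := div_pos_of_neg_of_neg hlγ hlA
  set δ := Real.log K + θ * l - σ * -Real.log S.b with hδ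
  have hδ0 : 0 < δ := by linarith
  set s := min S.sep 1 with hs
  have hs0 : 0 < s := lt_min S.sep_pos one_pos
  obtain ⟨n₁, hn₁⟩ := exists_nat_ge ((l - σ * Real.log s - σ * Real.log S.b) / δ)
  rw [div_le_iff₀ hδ0] at hn₁
  set d₁ := s * S.b ^ (n₁ + 1) with hd₁
  have hd₁0 : 0 < d₁ := by positivity
  let _ : TopologicalSpace ι := ⊥
  have : DiscreteTopology ι := ⟨rfl⟩
  let _ : MeasurableSpace ι := ⊤
  have : BorelSpace ι := ⟨by rw [borel_eq_top_of_discrete]⟩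
  obtain ⟨P, hP, hPle⟩ := exists_measure_le_wavg ι
  set f : (ℕ → ι) → ℝ × ℝ := fun ω => (S.code ω, S.T (S.code ω)) with hf
  have hfc : Continuous f := by
    refine S.continuous_code.prodMk ?_
    exact S.T_cont.comp_continuous S.continuous_code fun ω => abs_le.1 (S.abs_code_le ω)
  have hmain : ∀ d, 0 < d → d ≤ d₁ → ∀ E : Set (ℝ × ℝ), (∀ x ∈ E, ∀ y ∈ E, dist x y ≤ d) →
      P (f ⁻¹' E) ≤ ENNReal.ofReal (d ^ (σ : ℝ)) := by
    intro d hd hd1 E hE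
    have hds : d / s ≤ 1 := by
      rw [div_le_one hs0]
      exact hd1.trans (mul_le_of_le_one_right hs0.le (pow_le_one₀ hb.le S.b_lt_one.le))
    obtain ⟨n, hn1, hn2⟩ := exists_nat_pow_near_of_lt_one (div_pos hd hs0) hds hb S.b_lt_one
    rw [lt_div_iff₀ hs0] at hn1
    rw [div_le_iff₀ hs0] at hn2
    have hnn : n₁ ≤ n := by
      by_contra! hcon
      have : S.b ^ (n₁ + 1) ≤ S.b ^ (n + 1) :=
        pow_le_pow_of_le_one hb.le S.b_lt_one.le (by omega)
      have := mul_le_mul_of_nonneg_right this hs0.le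
      rw [hd₁] at hd1
      linarith
    set m := ⌊n * θ⌋₊ with hm
    have hm1 : (m : ℝ) ≤ n * θ := Nat.floor_le (by positivity)
    have hm2 : n * θ - 1 < m := Nat.sub_one_lt_floor _
    have hγm : S.γ ^ n ≤ S.A ^ m := by
      rw [← Real.exp_log (pow_pos S.γ_pos n), ← Real.exp_log (pow_pos hA m), Real.log_pow,
        Real.log_pow]
      refine Real.exp_le_exp.2 ?_
      have : Real.log S.γ = θ * Real.log S.A := by rw [hθ, div_mul_cancel₀ _ hlA.ne]
      rw [this]
      nlinarith
    have hbn := pow_pos hb n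
    have h1 := wavg_prefix_le (d := d) hC hB hQ.le hcount (n := n) (m := m)
      (hn2.trans (by rw [mul_comm]; gcongr; exact min_le_left _ _))
      (hn2.trans (mul_le_of_le_one_right hbn.le (min_le_right _ _))) hγm (p := fun ω => f ω ∈ E)
      fun ω ω' h h' => by
        have := hE _ h _ h'
        rw [Prod.dist_eq] at this
        exact ⟨(le_max_left _ _).trans this, (le_max_right _ _).trans this⟩
    refine (hPle (fun ω => f ω ∈ E) (n + m)).trans (ENNReal.ofReal_le_ofReal (h1.trans ?_))
    have h2 : 1 / K ^ n * (Q / K) ^ m = Real.exp (-(n * Real.log K) - m * l) := by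
      rw [Real.exp_sub, Real.exp_neg, Real.exp_nat_mul, Real.exp_nat_mul, Real.exp_log hK, hl,
        Real.exp_sub, Real.exp_log hK, Real.exp_log hQ, one_div, div_pow, div_pow]
      field_simp
    have h3 : d ^ (σ : ℝ) = Real.exp (Real.log d * σ) := Real.rpow_def_of_pos hd _
    have h4 : (n + 1) * Real.log S.b + Real.log s ≤ Real.log d := by
      have := Real.log_le_log (by positivity) hn1.le
      rw [Real.log_mul (by positivity) hs0.ne', Real.log_pow] at this
      push_cast at this
      exact this
    rw [h2, h3]
    refine Real.exp_le_exp.2 ?_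
    have h5 : ((n + 1) * Real.log S.b + Real.log s) * σ ≤ Real.log d * σ :=
      mul_le_mul_of_nonneg_right h4 σ.2
    have h6 : (n * θ - 1) * l ≤ m * l := mul_le_mul_of_nonneg_right hm2.le hl0
    have h7 : (n₁ : ℝ) * δ ≤ n * δ := by gcongr
    have h8 : (n : ℝ) * δ = n * Real.log K + n * (θ * l) - n * (σ * -Real.log S.b) := by
      rw [hδ]; ring
    linarith
  have hle : P.map f ≤ μH[(σ : ℝ)] := by
    refine Measure.le_hausdorffMeasure _ _ (ENNReal.ofReal (d₁ / 2)) (by simpa using hd₁0) ?_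
    intro E hE
    have hcl : P.map f E ≤ P (f ⁻¹' closure E) := by
      rw [← Measure.map_apply hfc.measurable isClosed_closure.measurableSet]
      exact measure_mono subset_closure
    refine hcl.trans ?_
    rw [← Metric.ediam_closure]
    rw [← Metric.ediam_closure] at hE
    set F := closure E
    have hfin : Metric.ediam F ≠ ⊤ := (hE.trans_lt ENNReal.ofReal_lt_top).ne
    obtain ⟨D, hD⟩ : ∃ D : NNReal, Metric.ediam F = D := ⟨_, (ENNReal.coe_toNNReal hfin).symm⟩
    have hD1 : (D : ℝ) ≤ d₁ / 2 := by
      rw [hD, ← ENNReal.ofReal_coe_nnreal, ENNReal.ofReal_le_ofReal_iff (by positivity)] at hE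
      exact hE
    have hdist : ∀ x ∈ F, ∀ y ∈ F, dist x y ≤ D := fun x hx y hy => by
      have := Metric.edist_le_ediam_of_mem hx hy
      rw [hD, edist_nndist] at this
      exact_mod_cast this
    rw [hD, ← ENNReal.ofReal_coe_nnreal, ENNReal.ofReal_rpow_of_nonneg D.coe_nonneg σ.coe_nonneg]
    have hcont : Tendsto (fun d : ℝ => ENNReal.ofReal (d ^ (σ : ℝ))) (𝓝[>] (D : ℝ))
        (𝓝 (ENNReal.ofReal ((D : ℝ) ^ (σ : ℝ)))) :=
      (ENNReal.continuous_ofReal.tendsto _).comp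
        ((Real.continuousAt_rpow_const _ _ (Or.inr σ.2)).tendsto.mono_left nhdsWithin_le_nhds)
    refine ge_of_tendsto hcont ?_
    filter_upwards [Ioo_mem_nhdsGT (show (D : ℝ) < d₁ by linarith)] with d hd
    exact hmain d (D.2.trans_lt hd.1) hd.2.le F fun x hx y hy => (hdist x hx y hy).trans hd.1.le
  refine le_dimH_of_hausdorffMeasure_ne_zero (ne_of_gt (lt_of_lt_of_le ?_ (hle S.graph)))
  refine lt_of_lt_of_le ?_ (Measure.le_map_apply hfc.aemeasurable _)
  have : f ⁻¹' S.graph = Set.univ :=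
    Set.eq_univ_of_forall fun ω => ⟨S.code ω, abs_le.1 (S.abs_code_le ω), rfl⟩
  rw [this, measure_univ]
  exact one_pos

end GraphIFS

namespace GraphIFS
variable {ι : Type} {S : GraphIFS ι}

/-- The system generated by a family of words of the same length. -/
noncomputable def sub (S : GraphIFS ι) {κ : Type} (f : κ → List ι) (hf : Function.Injective f)
    (n : ℕ) (hn : n ≠ 0) (hlen : ∀ k, (f k).length = n) : GraphIFS κ where
  b := S.b ^ n
  A := S.A ^ n
  t k := S.pt (f k)
  s k := S.sl (f k)
  T := S.T
  sep := S.b ^ (n - 1) * S.sep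
  b_pos := pow_pos S.b_pos n
  b_lt_A := pow_lt_pow_left₀ S.b_lt_A S.b_pos.le hn
  A_lt_one := pow_lt_one₀ S.A_pos.le S.A_lt_one hn
  T_zero := S.T_zero
  maps k y hy := by simpa [hlen] using S.abs_map_le (f k) y hy
  T_map k y hy := by simpa [hlen] using S.T_word (f k) y hy
  T_cont := S.T_cont
  sep_pos := mul_pos (pow_pos S.b_pos _) S.sep_pos
  separated k k' y y' hk hy hy' := by
    have := S.separated_words (f k) (f k') (by rw [hlen, hlen]) (hf.ne hk) y y' hy hy'
    simpa only [hlen] using this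

lemma SlopeBound.abs_sl_le {C : ℝ} (hC : S.SlopeBound C) (w : List ι) :
    |S.sl w| ≤ (S.A ^ w.length - S.b ^ w.length) * C := by
  have hA := pow_pos S.A_pos w.length
  have h1 := S.act_eq C w
  have h2 := S.act_eq (-C) w
  have h3 := (abs_le.1 (hC.act_le (abs_of_pos hC.1).le w)).1
  have h4 := (abs_le.1 (hC.act_le (c := -C) (by rw [abs_neg, abs_of_pos hC.1]) w)).1
  have h5 := (abs_le.1 (hC.act_le (abs_of_pos hC.1).le w)).2
  have h6 := (abs_le.1 (hC.act_le (c := -C) (by rw [abs_neg, abs_of_pos hC.1]) w)).2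
  rw [abs_le]
  constructor <;> nlinarith

lemma SlopeBound.sub {C : ℝ} (hC : S.SlopeBound C) {κ : Type} (f : κ → List ι)
    (hf : Function.Injective f) (n : ℕ) (hn : n ≠ 0) (hlen : ∀ k, (f k).length = n) :
    (S.sub f hf n hn hlen).SlopeBound C := by
  refine ⟨hC.1, fun k => ?_⟩
  have h := hC.abs_sl_le (f k)
  rw [hlen] at h
  have hA := pow_pos S.A_pos n
  change |S.sl (f k)| / S.A ^ n ≤ (1 - S.b ^ n / S.A ^ n) * C
  rw [div_le_iff₀ hA]
  refine h.trans_eq ?_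
  field_simp

variable [Fintype ι]

open Classical in
/-- The indicator of the words of length `L` whose neighbourhood at scale `A ^ L` carries more
than the proportion `p` of the words. -/
noncomputable def heavy (S : GraphIFS ι) (L : ℕ) (p c : ℝ) (w : List ι) : ℝ :=
  if p < S.g L c (S.U c (S.pt w) / S.A ^ L) then 1 else 0

lemma heavy_nonneg (L : ℕ) (p c : ℝ) (w : List ι) : 0 ≤ S.heavy L p c w := by
  unfold heavy; split_ifs <;> norm_num

lemma heavy_le_one (L : ℕ) (p c : ℝ) (w : List ι) : S.heavy L p c w ≤ 1 := by
  unfold heavy; split_ifs <;> norm_num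

/-- The number of heavy blocks in a concatenation of `N` words of length `L`. -/
noncomputable def heavyCount (S : GraphIFS ι) (L : ℕ) (p : ℝ) : ℕ → ℝ → List ι → ℝ
  | 0, _, _ => 0
  | N + 1, c, w => S.heavy L p c (w.take L) + heavyCount S L p N (S.act c (w.take L)) (w.drop L)

lemma heavyCount_append {L : ℕ} {u : List ι} (hu : u.length = L) (p : ℝ) (N : ℕ) (c : ℝ)
    (v : List ι) :
    S.heavyCount L p (N + 1) c (u ++ v) = S.heavy L p c u + S.heavyCount L p N (S.act c u) v := by
  subst hu; simp [heavyCount]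

lemma heavyCount_nonneg (L : ℕ) (p : ℝ) (N : ℕ) (c : ℝ) (w : List ι) :
    0 ≤ S.heavyCount L p N c w := by
  induction N generalizing c w with
  | zero => exact le_rfl
  | succ N ih => exact add_nonneg (heavy_nonneg _ _ _ _) (ih _ _)

lemma heavyCount_le (L : ℕ) (p : ℝ) (N : ℕ) (c : ℝ) (w : List ι) : S.heavyCount L p N c w ≤ N := by
  induction N generalizing c w with
  | zero => simp [heavyCount]
  | succ N ih =>
    push_cast
    have := add_le_add (S.heavy_le_one L p c (w.take L)) (ih (S.act c (w.take L)) (w.drop L))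
    rw [heavyCount]; linarith

variable [Nonempty ι]

lemma heavy_le_of_near {L : ℕ} {p c c' : ℝ} (h : |c - c'| ≤ S.A ^ L) (w : List ι) :
    S.heavy L (Real.exp 2 * p) c w ≤ S.heavy L p c' w := by
  unfold heavy
  split_ifs with h1 h2 h2 <;> norm_num
  refine h2 ?_
  have hA := pow_pos S.A_pos L
  obtain ⟨τ, rfl⟩ : ∃ τ, c = c' + τ := ⟨c - c', by ring⟩
  rw [add_sub_cancel_left] at h
  have h3 : |τ| / S.A ^ L ≤ 1 := (div_le_one hA).2 h
  have h4 : |-(τ * S.pt w) / S.A ^ L| ≤ 1 := by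
    rw [abs_div, abs_neg, abs_mul, abs_of_pos hA, div_le_one hA]
    exact (mul_le_of_le_one_right (abs_nonneg _) (S.abs_pt_le w)).trans h
  have h5 := S.g_slope L c' τ (S.U (c' + τ) (S.pt w) / S.A ^ L)
  have h6 := S.g_shift L c' (S.U c' (S.pt w) / S.A ^ L) (-(τ * S.pt w) / S.A ^ L)
  rw [← add_div, ← sub_eq_add_neg, ← S.U_add] at h6
  have h7 : S.g L (c' + τ) (S.U (c' + τ) (S.pt w) / S.A ^ L) ≤
      Real.exp 2 * S.g L c' (S.U c' (S.pt w) / S.A ^ L) := by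
    have hg := (S.g_pos L c' (S.U c' (S.pt w) / S.A ^ L)).le
    have hg' := (S.g_pos L c' (S.U (c' + τ) (S.pt w) / S.A ^ L)).le
    rw [show (2 : ℝ) = 1 + 1 by norm_num, Real.exp_add, mul_assoc]
    refine h5.trans (mul_le_mul (Real.exp_le_exp.2 h3) (h6.trans ?_) hg' (Real.exp_pos _).le)
    exact mul_le_mul_of_nonneg_right (Real.exp_le_exp.2 h4) hg
  exact lt_of_mul_lt_mul_left (h1.trans_le h7) (Real.exp_pos 2).le

lemma heavyCount_le_of_near {L : ℕ} {p : ℝ} (N : ℕ) {c c' : ℝ} (h : |c - c'| ≤ S.A ^ L)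
    (w : List ι) :
    S.heavyCount L (Real.exp 2 * p) N c w ≤ S.heavyCount L p N c' w := by
  induction N generalizing c c' w with
  | zero => exact le_rfl
  | succ N ih =>
    refine add_le_add (heavy_le_of_near h _) (ih ?_ _)
    have := S.act_add c' (c - c') (w.take L)
    rw [add_sub_cancel] at this
    rw [this, add_sub_cancel_left, abs_mul, abs_of_pos (pow_pos S.γ_pos _)]
    exact (mul_le_of_le_one_left (abs_nonneg _)
      (pow_le_one₀ S.γ_pos.le S.γ_lt_one.le)).trans h

open Classical in
lemma wavg_light_le {L : ℕ} {p c y C' : ℝ} (hp : 0 ≤ p) :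
    (wavg L fun u => if |S.U c (S.pt u) - y| ≤ C' * S.A ^ L ∧ S.heavy L p c u = 0
      then (1 : ℝ) else 0) ≤ Real.exp (2 * C') * p := by
  have hA := pow_pos S.A_pos L
  by_cases hex : ∃ u : List ι, |S.U c (S.pt u) - y| ≤ C' * S.A ^ L ∧ S.heavy L p c u = 0
  · obtain ⟨u, hu1, hu2⟩ := hex
    have hgu : S.g L c (S.U c (S.pt u) / S.A ^ L) ≤ p := by
      by_contra! h
      simp [heavy, h] at hu2
    refine le_trans ?_ (mul_le_mul_of_nonneg_left hgu (Real.exp_pos _).le)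
    rw [g, ← wavg_mul_left]
    refine wavg_mono fun v _ => ?_
    split_ifs with hv
    · rw [← Real.exp_add, Real.one_le_exp_iff, ← sub_div, abs_div, abs_of_pos hA]
      have h1 : |S.U c (S.pt u) - S.U c (S.pt v)| / S.A ^ L ≤ 2 * C' := by
        rw [div_le_iff₀ hA]
        have := abs_sub (S.U c (S.pt u) - y) (S.U c (S.pt v) - y)
        rw [sub_sub_sub_cancel_right] at this
        linarith [hv.1]
      linarith
    · positivity
  · have : ∀ u : List ι, ¬(|S.U c (S.pt u) - y| ≤ C' * S.A ^ L ∧ S.heavy L p c u = 0) :=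
      fun u hu => hex ⟨u, hu⟩
    simp only [this, if_false, wavg_const]
    positivity

open Classical in
lemma wavg_close_heavyCount_le {B C C₃ p : ℝ} (hC : S.SlopeBound C)
    (hB : ∀ c y, |c| ≤ C → |y| ≤ 1 → |S.U c y| ≤ B) (hp : 0 ≤ p) (hC₃ : 0 ≤ C₃) (L N : ℕ)
    {c : ℝ} (hc : |c| ≤ C) (y : ℝ) :
    (wavg (L * N) fun w => if |S.U c (S.pt w) - y| ≤ C₃ * S.A ^ (L * N)
      then (S.A ^ L) ^ (S.heavyCount L p N c w) else 0) ≤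
      (Real.exp (2 * (B + C₃)) * p + S.A ^ L) ^ N := by
  have hA := pow_pos S.A_pos L
  set q := Real.exp (2 * (B + C₃)) * p + S.A ^ L with hq
  have hq0 : 0 ≤ q := by positivity
  induction N generalizing c y with
  | zero =>
    simp only [Nat.mul_zero, wavg_zero, heavyCount, Real.rpow_zero, pow_zero]
    split_ifs <;> norm_num
  | succ N ih =>
    rw [show L * (N + 1) = L + L * N by ring, wavg_append, pow_succ, mul_comm (q ^ N)]
    have hstep : ∀ u : List ι, u.length = L → (wavg (L * N) fun v =>
        if |S.U c (S.pt (u ++ v)) - y| ≤ C₃ * S.A ^ (L + L * N)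
        then (S.A ^ L) ^ (S.heavyCount L p (N + 1) c (u ++ v)) else 0) ≤
        ((if |S.U c (S.pt u) - y| ≤ (B + C₃) * S.A ^ L ∧ S.heavy L p c u = 0
      then (1 : ℝ) else 0) + S.A ^ L) * q ^ N := by
      intro u hu
      have hqN := pow_nonneg hq0 N
      by_cases hcl : |S.U c (S.pt u) - y| ≤ (B + C₃) * S.A ^ L
      · have h1 := ih (hC.act_le hc u) ((y - S.U c (S.pt u)) / S.A ^ L)
        have h2 : (wavg (L * N) fun v =>
            if |S.U c (S.pt (u ++ v)) - y| ≤ C₃ * S.A ^ (L + L * N)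
            then (S.A ^ L) ^ (S.heavyCount L p (N + 1) c (u ++ v)) else 0) ≤
            (S.A ^ L) ^ S.heavy L p c u * q ^ N := by
          refine le_trans ?_ (mul_le_mul_of_nonneg_left h1 (by positivity))
          rw [← wavg_mul_left]
          refine wavg_mono fun v _ => ?_
          rw [heavyCount_append hu, S.U_append, hu, Real.rpow_add hA]
          split_ifs with h3 h4 h4
          · exact le_rfl
          · refine absurd ?_ h4
            rw [show S.U (S.act c u) (S.pt v) - (y - S.U c (S.pt u)) / S.A ^ L =
              (S.A ^ L * S.U (S.act c u) (S.pt v) + S.U c (S.pt u) - y) / S.A ^ L by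
                field_simp; ring, abs_div, abs_of_pos hA, div_le_iff₀ hA]
            refine h3.trans_eq ?_
            rw [pow_add]; ring
          · positivity
          · simp
        refine h2.trans (mul_le_mul_of_nonneg_right ?_ hqN)
        by_cases hh : S.heavy L p c u = 0
        · rw [if_pos ⟨hcl, hh⟩, hh, Real.rpow_zero]; linarith
        · have : S.heavy L p c u = 1 := by
            unfold heavy at hh ⊢
            split_ifs at hh ⊢ <;> simp_all
          rw [this, Real.rpow_one]
          split_ifs <;> linarith
      · refine le_trans (wavg_le (r := 0) fun v _ => ?_) ?_
        · rw [if_neg]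
          intro h
          refine hcl ?_
          rw [S.U_append, hu] at h
          have h1 := hB _ (S.pt v) (hC.act_le hc u) (S.abs_pt_le v)
          have h2 : |S.A ^ L * S.U (S.act c u) (S.pt v)| ≤ S.A ^ L * B := by
            rw [abs_mul, abs_of_pos hA]; gcongr
          have h3 : C₃ * S.A ^ (L + L * N) ≤ C₃ * S.A ^ L :=
            mul_le_mul_of_nonneg_left
              (pow_le_pow_of_le_one S.A_pos.le S.A_lt_one.le (by omega)) hC₃
          have h4 := abs_sub (S.A ^ L * S.U (S.act c u) (S.pt v) + S.U c (S.pt u) - y)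
            (S.A ^ L * S.U (S.act c u) (S.pt v))
          rw [show S.A ^ L * S.U (S.act c u) (S.pt v) + S.U c (S.pt u) - y -
            S.A ^ L * S.U (S.act c u) (S.pt v) = S.U c (S.pt u) - y by ring] at h4
          linarith
        · split_ifs <;> positivity
    refine (wavg_mono hstep).trans ?_
    rw [wavg_mul_right, wavg_add, wavg_const]
    refine mul_le_mul_of_nonneg_right ?_ (pow_nonneg hq0 N)
    rw [hq]
    gcongr
    exact wavg_light_le hp

end GraphIFS

namespace GraphIFS
variable {ι : Type} {S : GraphIFS ι} [Fintype ι] [Nonempty ι]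

lemma bddOn_heavyCount (C : ℝ) (L : ℕ) (p : ℝ) (N m : ℕ) :
    BddOn C fun c => wavg m (S.heavyCount L p N c) :=
  BddOn.of_le (R := N) (fun _ _ => wavg_nonneg fun _ _ => heavyCount_nonneg _ _ _ _ _)
    fun _ _ => wavg_le fun _ _ => heavyCount_le _ _ _ _ _

lemma SlopeBound.Lam_heavyCount {C : ℝ} (hC : S.SlopeBound C) (L : ℕ) (p : ℝ) (N : ℕ) :
    S.Lam (fun c => wavg (L * N) (S.heavyCount L p N c)) =
      N * S.Lam fun c => wavg L (S.heavy L p c) := by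
  have hb : BddOn C fun c => wavg L (S.heavy L p c) :=
    BddOn.of_le (R := 1) (fun _ _ => wavg_nonneg fun _ _ => heavy_nonneg _ _ _ _)
      fun _ _ => wavg_le fun _ _ => heavy_le_one _ _ _ _
  induction N with
  | zero => simpa [heavyCount, wavg_zero] using hC.Lam_const 0
  | succ N ih =>
    have h1 : ∀ c, wavg (L * (N + 1)) (S.heavyCount L p (N + 1) c) = wavg L (S.heavy L p c) +
        wavg L fun u => wavg (L * N) (S.heavyCount L p N (S.act c u)) := by
      intro c
      rw [show L * (N + 1) = L + L * N by ring, wavg_append, ← wavg_add]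
      refine wavg_congr fun u hu => ?_
      simp only [heavyCount_append hu, wavg_add, wavg_const]
    simp only [h1]
    rw [hC.Lam_add hb (hC.bddOn_wavg (bddOn_heavyCount C L p N _) L),
      hC.Lam_wavg (bddOn_heavyCount C L p N _) L, ih]
    push_cast; ring

lemma SlopeBound.exists_lt_of_Lam_lt {C : ℝ} (hC : S.SlopeBound C) {f : ℝ → ℝ} {x : ℝ}
    (hf : BddOn C f) (hx : S.Lam f < x) : ∃ c, |c| ≤ C ∧ f c < x := by
  by_contra! hcon
  have := hC.Lam_mono (BddOn.const C x) hf hcon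
  rw [hC.Lam_const] at this
  linarith

/-- For many words of length `n = M + L * N`, the points of the corresponding cylinders are
spread out over the values of `U c`. -/
lemma exists_sub_count {B C ε : ℝ} {M L N : ℕ} (hC : S.SlopeBound C)
    (hB : ∀ c y, |c| ≤ C → |y| ≤ 1 → |S.U c y| ≤ B) (hB0 : 0 < B) (hε : 0 < ε)
    (hM : S.γ ^ M * (2 * C) ≤ S.A ^ L) (hN : 0 < N) (hn : M + L * N ≠ 0)
    (hLam : S.Lam (fun c => wavg L (S.hv L ε c)) ≤ ε) :
    ∃ (κ : Type) (_ : Fintype κ) (_ : Nonempty κ) (f : κ → List ι) (hf : Function.Injective f)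
      (hlen : ∀ k, (f k).length = M + L * N),
      (Fintype.card ι : ℝ) ^ (M + L * N) / 2 ≤ Fintype.card κ ∧
      open Classical in ∀ c, |c| ≤ C → ∀ y, ((Finset.univ.filter fun a =>
        |(S.sub f hf _ hn hlen).U c ((S.sub f hf _ hn hlen).t a) - y| ≤
          (B + 1) * (S.sub f hf _ hn hlen).A).card : ℝ) ≤
        (Fintype.card ι : ℝ) ^ (M + L * N) * (((S.A ^ L) ^ (4 * ε * N))⁻¹ *
          (Real.exp (2 * (B + (B + 1))) * (Real.exp 2 * S.A ^ ((L : ℝ) * (1 - ε))) +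
            S.A ^ L) ^ N) := by
  classical
  have hA := S.A_pos
  have hAL := pow_pos hA L
  have hAM := pow_pos hA M
  have hK : (0 : ℝ) < Fintype.card ι := by exact_mod_cast Fintype.card_pos
  have hNr : (0 : ℝ) < N := by exact_mod_cast hN
  set p := S.A ^ ((L : ℝ) * (1 - ε)) with hp
  set n := M + L * N with hndef
  have hb := bddOn_heavyCount (S := S) C L p N (L * N)
  have hlt : S.Lam (fun c => wavg M fun u => wavg (L * N) (S.heavyCount L p N (S.act c u))) <
      2 * ε * N := by
    rw [hC.Lam_wavg hb, hC.Lam_heavyCount]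
    calc _ ≤ (N : ℝ) * ε := mul_le_mul_of_nonneg_left hLam hNr.le
      _ < 2 * ε * N := by nlinarith
  obtain ⟨c₁, hc₁, hlt⟩ := hC.exists_lt_of_Lam_lt (hC.bddOn_wavg hb M) hlt
  set good : List ι → Prop := fun w =>
    S.heavyCount L p N (S.act c₁ (w.take M)) (w.drop M) ≤ 4 * ε * N with hgood
  set κ := {v : Fin n → ι // good (List.ofFn v)} with hκ
  have hcard : (Fintype.card ι : ℝ) ^ n / 2 ≤ Fintype.card κ := by
    have h1 : 1 - (wavg n fun w => if good w then (1 : ℝ) else 0) ≤ 1 / 2 := by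
      have h2 : (wavg n fun w : List ι => (1 : ℝ) - if good w then (1 : ℝ) else 0) ≤
          wavg n fun w => S.heavyCount L p N (S.act c₁ (w.take M)) (w.drop M) *
            (4 * ε * N)⁻¹ := by
        refine wavg_mono fun w _ => ?_
        have h0 := S.heavyCount_nonneg L p N (S.act c₁ (w.take M)) (w.drop M)
        split_ifs with hw
        · rw [sub_self]; positivity
        · rw [sub_zero, ← div_eq_mul_inv, le_div_iff₀ (by positivity), one_mul]
          exact (not_le.1 hw).le
      rw [wavg_sub, wavg_const, wavg_mul_right] at h2
      have h3 : (wavg n fun w => S.heavyCount L p N (S.act c₁ (w.take M)) (w.drop M)) =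
          wavg M fun u => wavg (L * N) (S.heavyCount L p N (S.act c₁ u)) := by
        rw [hndef, wavg_append]
        refine wavg_congr fun u hu => ?_
        subst hu
        simp
      rw [h3, ← div_eq_mul_inv] at h2
      refine h2.trans ?_
      rw [div_le_iff₀ (by positivity)]
      linarith
    have h4 : (wavg n fun w => if good w then (1 : ℝ) else 0) =
        Fintype.card κ / (Fintype.card ι : ℝ) ^ n := by
      rw [wavg, Finset.sum_boole, ← Fintype.card_subtype]
    rw [h4] at h1
    have h5 : (1 / 2 : ℝ) ≤ Fintype.card κ / (Fintype.card ι : ℝ) ^ n := by linarith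
    rw [le_div_iff₀ (by positivity)] at h5
    linarith
  have hne : Nonempty κ := by
    have : (0 : ℝ) < Fintype.card κ := lt_of_lt_of_le (by positivity) hcard
    exact Fintype.card_pos_iff.1 (by exact_mod_cast this)
  refine ⟨κ, inferInstance, hne, fun k => List.ofFn k.1,
    fun k k' h => Subtype.ext (List.ofFn_injective h), fun k => by rw [List.length_ofFn], hcard, ?_⟩
  intro c hc y
  change ((Finset.univ.filter fun a : κ => |S.U c (S.pt (List.ofFn a.1)) - y| ≤
    (B + 1) * S.A ^ n).card : ℝ) ≤ _
  set q := Real.exp (2 * (B + (B + 1))) * (Real.exp 2 * p) + S.A ^ L with hq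
  have hcount : ((Finset.univ.filter fun a : κ => |S.U c (S.pt (List.ofFn a.1)) - y| ≤
      (B + 1) * S.A ^ n).card : ℝ) ≤ (Fintype.card ι : ℝ) ^ n * wavg n fun w =>
      if |S.U c (S.pt w) - y| ≤ (B + 1) * S.A ^ n ∧ good w then (1 : ℝ) else 0 := by
    rw [wavg, mul_div_cancel₀ _ (by positivity), Finset.sum_boole]
    norm_cast
    rw [← Finset.card_map (Function.Embedding.subtype _)]
    refine Finset.card_le_card fun v hv => ?_
    simp only [Finset.mem_map, Finset.mem_filter, Finset.mem_univ, true_and,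
      Function.Embedding.subtype_apply] at hv ⊢
    obtain ⟨a, ha, rfl⟩ := hv
    exact ⟨ha, a.2⟩
  refine hcount.trans (mul_le_mul_of_nonneg_left ?_ (by positivity))
  rw [hndef, wavg_append]
  refine wavg_le fun u hu => ?_
  have hcu := hC.act_le hc u
  refine le_trans ?_ (mul_le_mul_of_nonneg_left (wavg_close_heavyCount_le hC hB
    (show 0 ≤ Real.exp 2 * p by positivity) (show 0 ≤ B + 1 by linarith) L N hcu
    ((y - S.U c (S.pt u)) / S.A ^ M)) (by positivity))
  rw [← wavg_mul_left]
  refine wavg_mono fun v _ => ?_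
  have hA1 : S.A ^ L ≤ 1 := pow_le_one₀ hA.le S.A_lt_one.le
  split_ifs with h1 h2 h2
  · have h3 : S.heavyCount L (Real.exp 2 * p) N (S.act c u) v ≤ 4 * ε * N := by
      have h4 := h1.2
      subst hu
      simp only [hgood, List.take_left, List.drop_left] at h4
      refine (heavyCount_le_of_near N ?_ v).trans h4
      have := S.act_add c₁ (c - c₁) u
      rw [add_sub_cancel] at this
      rw [this, add_sub_cancel_left, abs_mul, abs_of_pos (pow_pos S.γ_pos _)]
      refine le_trans (mul_le_mul_of_nonneg_left ?_ (pow_pos S.γ_pos _).le) hM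
      exact (abs_sub _ _).trans (by linarith)
    have h5 := Real.rpow_le_rpow_of_exponent_ge hAL hA1 h3
    rw [← div_eq_inv_mul, le_div_iff₀ (by positivity), one_mul]
    exact h5
  · refine absurd ?_ h2
    have h1 := h1.1
    rw [S.U_append, hu] at h1
    rw [show S.U (S.act c u) (S.pt v) - (y - S.U c (S.pt u)) / S.A ^ M =
      (S.A ^ M * S.U (S.act c u) (S.pt v) + S.U c (S.pt u) - y) / S.A ^ M by
        field_simp; ring, abs_div, abs_of_pos hAM, div_le_iff₀ hAM]
    refine h1.trans_eq ?_
    rw [pow_add]; ring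
  · positivity
  · simp

set_option maxHeartbeats 1600000 in
lemma le_dimH_graph (hs : ∃ a a', S.s a ≠ S.s a') (hK : 1 < Fintype.card ι * S.A)
    {σ : NNReal} (hσ : σ * -Real.log S.b < Real.log (Fintype.card ι) + Real.log S.A -
      Real.log S.b) : (σ : ENNReal) ≤ dimH S.graph := by
  have hA := S.A_pos
  obtain ⟨C, hC⟩ := S.exists_slopeBound
  obtain ⟨B, hB0, hB⟩ := S.exists_U_bound C hC.1.le
  have hK0 : (0 : ℝ) < Fintype.card ι := by exact_mod_cast Fintype.card_pos
  set K : ℝ := (Fintype.card ι : ℝ) with hKdef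
  set a := -Real.log S.A with ha
  have ha0 : 0 < a := by rw [ha, neg_pos]; exact Real.log_neg hA S.A_lt_one
  have hlγ : Real.log S.γ < 0 := Real.log_neg S.γ_pos S.γ_lt_one
  have hlγ' : Real.log S.γ = Real.log S.b - Real.log S.A := Real.log_div S.b_pos.ne' hA.ne'
  set θ := Real.log S.γ / Real.log S.A with hθ
  have hθ0 : 0 < θ := div_pos_of_neg_of_neg hlγ (by linarith)
  have hθa : θ * a = -Real.log S.γ := by
    have : Real.log S.A ≠ 0 := by linarith
    rw [hθ, ha]; field_simp
  set s' := (σ : ℝ) * -Real.log S.b with hs'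
  set δ := Real.log K + θ * a - s' with hδ
  have hδ0 : 0 < δ := by rw [hδ, hθa, hlγ']; linarith
  set ε := min (1 / 2) (δ / (12 * (θ * a))) with hε
  have hε0 : 0 < ε := lt_min (by norm_num) (by positivity)
  have hε1 : ε ≤ 1 / 2 := min_le_left _ _
  have hε2 : 6 * ε * (θ * a) ≤ δ / 2 := by
    have : ε ≤ δ / (12 * (θ * a)) := min_le_right _ _
    rw [le_div_iff₀ (by positivity)] at this
    linarith
  set C₀ := Real.log (Real.exp (2 * (B + (B + 1))) * Real.exp 2 + 1) with hC₀
  have hC₀0 : 0 ≤ C₀ := Real.log_nonneg (by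
    have : 0 < Real.exp (2 * (B + (B + 1))) * Real.exp 2 := by positivity
    linarith)
  obtain ⟨L₁, hL₁⟩ := exists_nat_ge (C₀ / (a * ε) + 1)
  obtain ⟨L, hL, hLam⟩ := hC.exists_Lam_hv_le hs hK hε0 (by linarith) L₁
  have hL' : C₀ / (a * ε) + 1 ≤ L := hL₁.trans (by exact_mod_cast hL)
  have hL1 : (1 : ℝ) ≤ L := by
    have : 0 ≤ C₀ / (a * ε) := by positivity
    linarith
  have hLC : C₀ ≤ L * (a * ε) := by
    have : C₀ / (a * ε) ≤ L := by linarith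
    rwa [div_le_iff₀ (by positivity)] at this
  have hAL := pow_pos hA L
  obtain ⟨M, hM⟩ := exists_pow_lt_of_lt_one (show 0 < S.A ^ L / (2 * C) from
    div_pos hAL (by linarith [hC.1])) S.γ_lt_one
  rw [lt_div_iff₀ (by linarith [hC.1])] at hM
  obtain ⟨N, hN⟩ := exists_nat_gt ((|M * (s' - Real.log K)| + (1 + θ) * Real.log 2) / (δ / 2))
  have hlog2 : 0 < Real.log 2 := Real.log_pos (by norm_num)
  have hN0 : (0 : ℝ) < N := lt_of_le_of_lt (by positivity) hN
  rw [div_lt_iff₀ (by positivity)] at hN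
  have hNn : 0 < N := by exact_mod_cast hN0
  have hLn : 0 < L := by exact_mod_cast hL1
  have hn : M + L * N ≠ 0 := by positivity
  obtain ⟨κ, _, _, f, hf, hlen, hcard, hcount⟩ := exists_sub_count hC hB hB0 hε0 hM.le hNn hn hLam
  set n := M + L * N with hndef
  have hnr : (n : ℝ) = M + L * N := by rw [hndef]; push_cast; ring
  set Q := K ^ n * (((S.A ^ L) ^ (4 * ε * N))⁻¹ *
    (Real.exp (2 * (B + (B + 1))) * (Real.exp 2 * S.A ^ ((L : ℝ) * (1 - ε))) +
      S.A ^ L) ^ N) with hQ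
  have hQ0 : 0 < Q := by positivity
  have hκ0 : (0 : ℝ) < Fintype.card κ := by exact_mod_cast Fintype.card_pos
  have hlq : Real.log (Real.exp (2 * (B + (B + 1))) * (Real.exp 2 * S.A ^ ((L : ℝ) * (1 - ε))) +
      S.A ^ L) ≤ C₀ - L * (1 - ε) * a := by
    have h1 : S.A ^ L ≤ S.A ^ ((L : ℝ) * (1 - ε)) := by
      rw [← Real.rpow_natCast]
      refine Real.rpow_le_rpow_of_exponent_ge hA S.A_lt_one.le ?_
      nlinarith
    have h2 : 0 < S.A ^ ((L : ℝ) * (1 - ε)) := by positivity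
    refine (Real.log_le_log (by positivity) (show _ ≤ (Real.exp (2 * (B + (B + 1))) * Real.exp 2
      + 1) * S.A ^ ((L : ℝ) * (1 - ε)) by linarith)).trans_eq ?_
    rw [Real.log_mul (by positivity) h2.ne', Real.log_rpow hA, ha]
    ring
  have hlQ : Real.log Q ≤ n * Real.log K + 4 * ε * N * (L * a) +
      N * (C₀ - L * (1 - ε) * a) := by
    rw [hQ, Real.log_mul (by positivity) (by positivity), Real.log_mul (by positivity)
      (by positivity), Real.log_inv, Real.log_rpow hAL, Real.log_pow, Real.log_pow, Real.log_pow]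
    have := mul_le_mul_of_nonneg_left hlq hN0.le
    have h2 : Real.log S.A = -a := by rw [ha, neg_neg]
    rw [h2]
    linarith
  have hlκ : n * Real.log K - Real.log 2 ≤ Real.log (Fintype.card κ) := by
    have := Real.log_le_log (by positivity) hcard
    rwa [Real.log_div (by positivity) (by norm_num), Real.log_pow] at this
  have hlQ' : Real.log (min Q (Fintype.card κ)) ≤ Real.log Q :=
    Real.log_le_log (lt_min hQ0 hκ0) (min_le_left _ _)
  change (σ : ENNReal) ≤ dimH (S.sub f hf _ hn hlen).graph
  refine le_dimH_of_count (hC.sub f hf _ hn hlen) hB (lt_min hQ0 hκ0) (min_le_right _ _)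
    (fun c hc y => le_min (hcount c hc y) ?_) ?_
  · exact_mod_cast Finset.card_le_univ _
  have h1 : Real.log (S.sub f hf _ hn hlen).γ / Real.log (S.sub f hf _ hn hlen).A = θ := by
    change Real.log (S.b ^ n / S.A ^ n) / Real.log (S.A ^ n) = θ
    have hnn : (n : ℝ) ≠ 0 := by exact_mod_cast hn
    rw [← div_pow, Real.log_pow, Real.log_pow, mul_div_mul_left _ _ hnn]
    rfl
  have h2 : Real.log (S.sub f hf _ hn hlen).b = n * Real.log S.b := Real.log_pow _ _
  rw [h1, h2]
  have h3 : N * (L * a) * (1 - 6 * ε) - Real.log 2 ≤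
      Real.log (Fintype.card κ) - Real.log (min Q (Fintype.card κ)) := by
    have := mul_le_mul_of_nonneg_left hLC hN0.le
    linarith
  have h4 := mul_le_mul_of_nonneg_left h3 hθ0.le
  have h5 : M * (s' - Real.log K) ≤ |M * (s' - Real.log K)| := le_abs_self _
  have h6 : N * (δ / 2) ≤ L * N * (δ / 2) := by
    have : N * (δ / 2) * 1 ≤ N * (δ / 2) * L := mul_le_mul_of_nonneg_left hL1 (by positivity)
    linarith
  have h7 : L * N * (6 * ε * (θ * a)) ≤ L * N * (δ / 2) :=
    mul_le_mul_of_nonneg_left hε2 (by positivity)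
  have h8 : (L * N : ℝ) * δ = L * N * Real.log K + L * N * (θ * a) - L * N * s' := by
    rw [hδ]; ring
  have h9 : (σ : ℝ) * -(n * Real.log S.b) = (M + L * N) * s' := by rw [hs', hnr]; ring
  rw [h9]
  rw [hnr] at hlκ
  linarith

end GraphIFS

namespace GenTakagi

/-- The tent map of slope `β` on `[0, 1 / 2]`. -/
noncomputable def tent (β u : ℝ) : ℝ := min (β * u) (1 - β * u)

/-- The reflection of `[0, 1]` onto `[0, 1 / 2]`. -/
noncomputable def fold (x : ℝ) : ℝ := min x (1 - x)

lemma distInt_eq_fold {x : ℝ} (hx : x ∈ Set.Icc (0 : ℝ) 1) : distInt x = fold x := by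
  rw [distInt, abs_sub_round_eq_min, fold]
  rcases hx.2.lt_or_eq with h | h
  · rw [Int.fract_eq_self.2 ⟨hx.1, h⟩]
  · subst h; simp

lemma fold_mem {x : ℝ} (hx : x ∈ Set.Icc (0 : ℝ) 1) : fold x ∈ Set.Icc (0 : ℝ) (1 / 2) := by
  refine ⟨le_min hx.1 (sub_nonneg.2 hx.2), ?_⟩
  rcases le_total x (1 / 2) with h | h
  · exact (min_le_left _ _).trans h
  · exact (min_le_right _ _).trans (by linarith)

lemma fold_one_sub (x : ℝ) : fold (1 - x) = fold x := by
  rw [fold, fold, sub_sub_cancel, min_comm]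

lemma fold_of_le {x : ℝ} (hx : x ≤ 1 / 2) : fold x = x := min_eq_left (by linarith)

lemma abs_fold_sub_le (x y : ℝ) : |fold x - fold y| ≤ |x - y| := by
  refine (abs_min_sub_min_le_max _ _ _ _).trans (max_le le_rfl ?_)
  rw [sub_sub_sub_cancel_left, abs_sub_comm]

/-- The range of the parameters. -/
structure Params (α β : ℝ) : Prop where
  α_pos : 0 < α
  α_lt : α < 1
  one_lt : 1 < β
  le_two : β ≤ 2
  one_lt_mul : 1 < α * β

variable {α β : ℝ} (P : Params α β)
include P

namespace Params

lemma β_pos : 0 < β := one_pos.trans P.one_lt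

lemma mul_mem {x : ℝ} (h0 : 0 ≤ x) (h1 : x ≤ 1 / 2) : β * x ∈ Set.Icc (0 : ℝ) 1 :=
  ⟨mul_nonneg P.β_pos.le h0, by nlinarith [P.le_two, P.β_pos]⟩

lemma tent_mem {u : ℝ} (hu : u ∈ Set.Icc (0 : ℝ) (1 / 2)) :
    tent β u ∈ Set.Icc (0 : ℝ) (1 / 2) := fold_mem (P.mul_mem hu.1 hu.2)

lemma tent_iterate_mem (k : ℕ) {u : ℝ} (hu : u ∈ Set.Icc (0 : ℝ) (1 / 2)) :
    (tent β)^[k] u ∈ Set.Icc (0 : ℝ) (1 / 2) := by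
  induction k with
  | zero => exact hu
  | succ k ih => rw [Function.iterate_succ_apply']; exact P.tent_mem ih

lemma fold_Bmap {x : ℝ} (hx : x ∈ Set.Icc (0 : ℝ) 1) :
    Bmap β x ∈ Set.Icc (0 : ℝ) 1 ∧ fold (Bmap β x) = tent β (fold x) := by
  unfold Bmap
  split_ifs with h
  · exact ⟨P.mul_mem hx.1 h, by rw [fold_of_le h]; rfl⟩
  · have h1 : 1 - x ≤ 1 / 2 := by linarith
    have h2 := P.mul_mem (sub_nonneg.2 hx.2) h1
    refine ⟨⟨by linarith [h2.2], by linarith [h2.1]⟩, ?_⟩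
    rw [fold_one_sub, ← fold_one_sub x, fold_of_le h1]
    rfl

lemma fold_iterate_Bmap (k : ℕ) {x : ℝ} (hx : x ∈ Set.Icc (0 : ℝ) 1) :
    (Bmap β)^[k] x ∈ Set.Icc (0 : ℝ) 1 ∧ fold ((Bmap β)^[k] x) = (tent β)^[k] (fold x) := by
  induction k with
  | zero => exact ⟨hx, rfl⟩
  | succ k ih =>
    rw [Function.iterate_succ_apply', Function.iterate_succ_apply', ← ih.2]
    exact P.fold_Bmap ih.1

lemma genTakagi_eq {x : ℝ} (hx : x ∈ Set.Icc (0 : ℝ) 1) :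
    genTakagi α β x = ∑' k : ℕ, α ^ k * (tent β)^[k] (fold x) := by
  refine tsum_congr fun k => ?_
  have := P.fold_iterate_Bmap k hx
  rw [distInt_eq_fold this.1, this.2]

lemma summable {u : ℝ} (hu : u ∈ Set.Icc (0 : ℝ) (1 / 2)) :
    Summable fun k : ℕ => α ^ k * (tent β)^[k] u := by
  refine Summable.of_nonneg_of_le (fun k => ?_) (fun k => ?_)
    (summable_geometric_of_lt_one P.α_pos.le P.α_lt)
  · exact mul_nonneg (pow_pos P.α_pos k).le (P.tent_iterate_mem k hu).1
  · exact mul_le_of_le_one_right (pow_pos P.α_pos k).le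
      ((P.tent_iterate_mem k hu).2.trans (by norm_num))

lemma genTakagi_one_sub {x : ℝ} (hx : x ∈ Set.Icc (0 : ℝ) 1) :
    genTakagi α β (1 - x) = genTakagi α β x := by
  rw [P.genTakagi_eq hx, P.genTakagi_eq ⟨sub_nonneg.2 hx.2, by linarith [hx.1]⟩, fold_one_sub]

lemma genTakagi_of_le {x : ℝ} (h0 : 0 ≤ x) (h1 : x ≤ 1 / 2) :
    genTakagi α β x = x + α * genTakagi α β (β * x) := by
  rw [P.genTakagi_eq ⟨h0, by linarith⟩, P.genTakagi_eq (P.mul_mem h0 h1), fold_of_le h1,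
    (P.summable ⟨h0, h1⟩).tsum_eq_zero_add, ← tsum_mul_left]
  simp only [pow_zero, one_mul, Function.iterate_zero, id_eq]
  congr 1
  refine tsum_congr fun k => ?_
  rw [Function.iterate_succ_apply, pow_succ', mul_assoc]
  rfl

lemma genTakagi_mem {x : ℝ} (hx : x ∈ Set.Icc (0 : ℝ) 1) :
    genTakagi α β x ∈ Set.Icc 0 ((1 - α)⁻¹) := by
  rw [P.genTakagi_eq hx]
  have hu := fold_mem hx
  refine ⟨tsum_nonneg fun k => mul_nonneg (pow_pos P.α_pos k).le (P.tent_iterate_mem k hu).1, ?_⟩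
  rw [← tsum_geometric_of_lt_one P.α_pos.le P.α_lt]
  refine (P.summable hu).tsum_le_tsum (fun k => ?_)
    (summable_geometric_of_lt_one P.α_pos.le P.α_lt)
  exact mul_le_of_le_one_right (pow_pos P.α_pos k).le
      ((P.tent_iterate_mem k hu).2.trans (by norm_num))

lemma abs_genTakagi_sub_le_aux (n : ℕ) {x y : ℝ} (hx : x ∈ Set.Icc (0 : ℝ) 1)
    (hy : y ∈ Set.Icc (0 : ℝ) 1) :
    |genTakagi α β x - genTakagi α β y| ≤
      ((α * β) ^ n - 1) / (α * β - 1) * |x - y| + α ^ n * (1 - α)⁻¹ := by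
  have hβ := P.β_pos
  have hα := P.α_pos
  have hlam : 0 < α * β - 1 := sub_pos.2 P.one_lt_mul
  have e : ∀ z ∈ Set.Icc (0 : ℝ) 1, genTakagi α β z = genTakagi α β (fold z) := fun z hz => by
    have h2 := fold_mem hz
    rw [P.genTakagi_eq hz, P.genTakagi_eq ⟨h2.1, h2.2.trans (by norm_num)⟩, fold_of_le h2.2]
  induction n generalizing x y with
  | zero =>
    have hx' := P.genTakagi_mem hx
    have hy' := P.genTakagi_mem hy
    simp only [pow_zero, sub_self, zero_div, zero_mul, one_mul, zero_add]
    exact abs_le.2 ⟨by linarith [hx'.1, hy'.2], by linarith [hx'.2, hy'.1]⟩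
  | succ n ih =>
    have hu := fold_mem hx
    have hv := fold_mem hy
    have h1 := ih (P.mul_mem hu.1 hu.2) (P.mul_mem hv.1 hv.2)
    have hd := abs_fold_sub_le x y
    rw [e x hx, e y hy, P.genTakagi_of_le hu.1 hu.2, P.genTakagi_of_le hv.1 hv.2]
    rw [← mul_sub, abs_mul, abs_of_pos hβ] at h1
    generalize fold x = u at *
    generalize fold y = v at *
    have h2 : |u + α * genTakagi α β (β * u) - (v + α * genTakagi α β (β * v))| ≤
        |u - v| + α * |genTakagi α β (β * u) - genTakagi α β (β * v)| := by
      have h3 : u + α * genTakagi α β (β * u) - (v + α * genTakagi α β (β * v)) =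
        (u - v) + α * (genTakagi α β (β * u) - genTakagi α β (β * v)) := by ring
      rw [h3]
      refine (abs_add_le _ _).trans_eq ?_
      rw [abs_mul, abs_of_pos hα]
    have h3 := mul_le_mul_of_nonneg_left h1 hα.le
    have h4 : ((α * β) ^ (n + 1) - 1) / (α * β - 1) =
        1 + α * β * (((α * β) ^ n - 1) / (α * β - 1)) := by
      field_simp
      ring
    have h5 : 0 ≤ ((α * β) ^ (n + 1) - 1) / (α * β - 1) :=
      div_nonneg (sub_nonneg.2 (one_le_pow₀ P.one_lt_mul.le)) hlam.le
    have h6 := mul_le_mul_of_nonneg_left hd h5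
    rw [h4] at h6 ⊢
    rw [pow_succ]
    linarith

lemma abs_genTakagi_sub_le (n : ℕ) {x y : ℝ} (hx : x ∈ Set.Icc (0 : ℝ) 1)
    (hy : y ∈ Set.Icc (0 : ℝ) 1) (h : |x - y| ≤ (β ^ n)⁻¹) :
    |genTakagi α β x - genTakagi α β y| ≤ ((α * β - 1)⁻¹ + (1 - α)⁻¹) * α ^ n := by
  have hβ := P.β_pos
  have hlam : 0 < α * β - 1 := sub_pos.2 P.one_lt_mul
  refine (P.abs_genTakagi_sub_le_aux n hx hy).trans ?_
  have h1 : ((α * β) ^ n - 1) / (α * β - 1) * |x - y| ≤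
      (α * β) ^ n / (α * β - 1) * (β ^ n)⁻¹ := by
    refine mul_le_mul ?_ h (abs_nonneg _)
      (div_nonneg (by linarith [pow_pos (one_pos.trans P.one_lt_mul) n]) hlam.le)
    exact div_le_div_of_nonneg_right (by linarith) hlam.le
  have h2 : (α * β) ^ n / (α * β - 1) * (β ^ n)⁻¹ = (α * β - 1)⁻¹ * α ^ n := by
    rw [mul_pow]; field_simp
  rw [h2] at h1
  linarith

end Params
end GenTakagi

namespace GenTakagi
variable {α β : ℝ} (P : Params α β)
include P
namespace Params

lemma log_pos : 0 < Real.log β := Real.log_pos P.one_lt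

lemma rpow_dim : β ^ (2 + Real.log α / Real.log β) = α * β ^ 2 := by
  rw [Real.rpow_add P.β_pos, Real.rpow_def_of_pos P.β_pos (Real.log α / Real.log β),
    mul_div_cancel₀ _ P.log_pos.ne', Real.exp_log P.α_pos, mul_comm]
  norm_num

lemma dim_pos : 0 < 2 + Real.log α / Real.log β := by
  have h := Real.log_pos P.one_lt_mul
  rw [Real.log_mul P.α_pos.ne' P.β_pos.ne'] at h
  have : -1 < Real.log α / Real.log β := by
    rw [lt_div_iff₀ P.log_pos]; linarith
  linarith

lemma dimH_graph_le :
    dimH {p : ℝ × ℝ | ∃ x ∈ Set.Icc (0:ℝ) 1, p = (x, genTakagi α β x)} ≤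
      ENNReal.ofReal (2 + Real.log α / Real.log β) := by
  set d : ℝ := 2 + Real.log α / Real.log β with hd
  have hd0 : 0 < d := P.dim_pos
  have hβ := P.β_pos
  have hα := P.α_pos
  set D : ℝ := (α * β - 1)⁻¹ + (1 - α)⁻¹ with hD
  have hD0 : 0 < D := add_pos (inv_pos.2 (sub_pos.2 P.one_lt_mul)) (inv_pos.2 (sub_pos.2 P.α_lt))
  refine dimH_le_of_hausdorffMeasure_ne_top (d := d.toNNReal) ?_
  rw [Real.coe_toNNReal d hd0.le]
  refine ne_top_of_le_ne_top (b := ENNReal.ofReal (2 * (2 * D + 1))) ENNReal.ofReal_ne_top ?_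
  have hediam : ∀ (n : ℕ) (x y : ℝ), Metric.ediam
      (Set.Icc x (x + (β ^ n)⁻¹) ×ˢ Set.Icc y (y + (β ^ n)⁻¹)) ≤ ENNReal.ofReal ((β ^ n)⁻¹) := by
    intro n x y
    refine Metric.ediam_le fun p hp q hq => ?_
    rw [edist_dist]
    refine ENNReal.ofReal_le_ofReal ?_
    rw [Prod.dist_eq]
    obtain ⟨⟨h1, h2⟩, h3, h4⟩ := hp
    obtain ⟨⟨h5, h6⟩, h7, h8⟩ := hq
    refine max_le ?_ ?_ <;> rw [Real.dist_eq] <;> exact abs_le.2 ⟨by linarith, by linarith⟩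
  refine (Measure.hausdorffMeasure_le_liminf_sum (β := ℕ)
    (ι := fun n => Fin (⌊β ^ n⌋₊ + 1) × Fin (⌊2 * D * (α * β) ^ n⌋₊ + 1)) (l := atTop) d _
    (fun n => ENNReal.ofReal ((β ^ n)⁻¹)) ?_
    (fun n ij => Set.Icc (ij.1 * (β ^ n)⁻¹) (ij.1 * (β ^ n)⁻¹ + (β ^ n)⁻¹) ×ˢ
      Set.Icc (genTakagi α β (ij.1 * (β ^ n)⁻¹) - D * α ^ n + ij.2 * (β ^ n)⁻¹)
        (genTakagi α β (ij.1 * (β ^ n)⁻¹) - D * α ^ n + ij.2 * (β ^ n)⁻¹ + (β ^ n)⁻¹))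
    (Eventually.of_forall fun n ij => hediam n _ _) (Eventually.of_forall fun n => ?_)).trans ?_
  · rw [← ENNReal.ofReal_zero]
    exact ENNReal.tendsto_ofReal
      (tendsto_inv_atTop_zero.comp (tendsto_pow_atTop_atTop_of_one_lt P.one_lt))
  · rintro p ⟨x, hx, rfl⟩
    have hB : 0 < β ^ n := pow_pos hβ n
    have hfl : ∀ z : ℝ, 0 ≤ z → (⌊z * β ^ n⌋₊ : ℝ) * (β ^ n)⁻¹ ≤ z ∧
        z ≤ (⌊z * β ^ n⌋₊ : ℝ) * (β ^ n)⁻¹ + (β ^ n)⁻¹ := fun z hz => by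
      have h1 := Nat.floor_le (mul_nonneg hz hB.le)
      have h2 := Nat.lt_floor_add_one (z * β ^ n)
      refine ⟨by rw [← div_eq_mul_inv, div_le_iff₀ hB]; exact h1, ?_⟩
      rw [← add_one_mul, ← div_eq_mul_inv, le_div_iff₀ hB]; exact h2.le
    obtain ⟨h1, h2⟩ := hfl x hx.1
    set i := ⌊x * β ^ n⌋₊ with hi
    have hT := P.abs_genTakagi_sub_le n hx (y := i * (β ^ n)⁻¹)
      ⟨by positivity, h1.trans hx.2⟩ (abs_le.2 ⟨by linarith [inv_pos.2 hB], by linarith⟩)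
    rw [← hD, abs_le] at hT
    have hz : 0 ≤ genTakagi α β x - (genTakagi α β (i * (β ^ n)⁻¹) - D * α ^ n) := by linarith
    obtain ⟨h3, h4⟩ := hfl _ hz
    set j := ⌊(genTakagi α β x - (genTakagi α β (i * (β ^ n)⁻¹) - D * α ^ n)) * β ^ n⌋₊ with hj
    refine Set.mem_iUnion.2 ⟨(⟨i, Nat.lt_succ_of_le (Nat.floor_le_floor ?_)⟩,
      ⟨j, Nat.lt_succ_of_le (Nat.floor_le_floor ?_)⟩), ⟨h1, h2⟩, ?_, ?_⟩
    · exact mul_le_of_le_one_left hB.le hx.2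
    · rw [mul_pow, ← mul_assoc]
      exact mul_le_mul_of_nonneg_right (by linarith) hB.le
    · simp only; linarith
    · simp only; linarith
  · refine (liminf_le_liminf (v := fun _ => ENNReal.ofReal (2 * (2 * D + 1)))
      (Eventually.of_forall fun n => ?_)).trans_eq (liminf_const _)
    refine (Finset.sum_le_sum fun ij _ => ENNReal.rpow_le_rpow (hediam n _ _) hd0.le).trans ?_
    have hB : 0 < β ^ n := pow_pos hβ n
    rw [Finset.sum_const, Finset.card_univ, Fintype.card_prod, Fintype.card_fin, Fintype.card_fin,
      ENNReal.ofReal_rpow_of_pos (inv_pos.2 hB), nsmul_eq_mul, ← ENNReal.ofReal_natCast,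
      ← ENNReal.ofReal_mul (Nat.cast_nonneg _)]
    refine ENNReal.ofReal_le_ofReal ?_
    have h1 : ((β ^ n)⁻¹) ^ d = (β ^ n)⁻¹ * ((α * β) ^ n)⁻¹ := by
      rw [Real.inv_rpow hB.le, ← Real.rpow_natCast, ← Real.rpow_mul hβ.le, mul_comm,
        Real.rpow_mul hβ.le, P.rpow_dim, Real.rpow_natCast, Real.rpow_natCast, ← mul_inv,
        ← mul_pow]
      congr 2
      ring
    have hA : 0 < (α * β) ^ n := pow_pos (mul_pos hα hβ) n
    have h2 : (⌊β ^ n⌋₊ : ℝ) + 1 ≤ 2 * β ^ n := by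
      linarith [Nat.floor_le hB.le, one_le_pow₀ P.one_lt.le (n := n)]
    have h3 : (⌊2 * D * (α * β) ^ n⌋₊ : ℝ) + 1 ≤ (2 * D + 1) * (α * β) ^ n := by
      have := Nat.floor_le (show 0 ≤ 2 * D * (α * β) ^ n by positivity)
      linarith [one_le_pow₀ P.one_lt_mul.le (n := n)]
    rw [h1]
    push_cast
    have h4 := mul_le_mul h2 h3 (by positivity) (by positivity)
    have h5 : 0 ≤ (β ^ n)⁻¹ * ((α * β) ^ n)⁻¹ := by positivity
    refine (mul_le_mul_of_nonneg_right h4 h5).trans_eq ?_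
    field_simp

end Params
end GenTakagi

namespace GenTakagi

lemma dimH_graph_le_of_affine {f g : ℝ → ℝ} {s t : Set ℝ} {x₀ L k m : ℝ} (hL : L ≠ 0) (hk : k ≠ 0)
    (h : ∀ x ∈ s, x₀ + L * x ∈ t ∧ g (x₀ + L * x) = k * f x + m) :
    dimH {p : ℝ × ℝ | ∃ x ∈ s, p = (x, f x)} ≤ dimH {p : ℝ × ℝ | ∃ x ∈ t, p = (x, g x)} := by
  have hlip : ∀ a b : ℝ, LipschitzWith ‖a‖₊ fun x : ℝ => a * (x - b) := fun a b => by
    refine LipschitzWith.of_dist_le_mul fun x y => ?_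
    rw [Real.dist_eq, Real.dist_eq, ← mul_sub, abs_mul, sub_sub_sub_cancel_right]
    rfl
  have hΦ := ((hlip L⁻¹ x₀).comp LipschitzWith.prod_fst).prodMk
    ((hlip k⁻¹ m).comp LipschitzWith.prod_snd)
  refine (dimH_mono ?_).trans (hΦ.dimH_image_le _)
  rintro _ ⟨x, hx, rfl⟩
  refine ⟨_, ⟨_, (h x hx).1, rfl⟩, ?_⟩
  simp only [Function.comp_apply, (h x hx).2, add_sub_cancel_left, add_sub_cancel_right]
  rw [inv_mul_cancel_left₀ hL, inv_mul_cancel_left₀ hk]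

variable {α β : ℝ} (P : Params α β)
include P
namespace Params

lemma sq (hβ : β ^ 2 ≤ 2) : Params (α ^ 2) (β ^ 2) where
  α_pos := pow_pos P.α_pos 2
  α_lt := pow_lt_one₀ P.α_pos.le P.α_lt two_ne_zero
  one_lt := one_lt_pow₀ P.one_lt two_ne_zero
  le_two := hβ
  one_lt_mul := by rw [← mul_pow]; exact one_lt_pow₀ P.one_lt_mul two_ne_zero

/-- The fixed point of the tent map. -/
lemma fixed_pos : 0 < (1 + β)⁻¹ ∧ (1 + β)⁻¹ < 1 / 2 ∧ β * (1 + β)⁻¹ = 1 - (1 + β)⁻¹ := by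
  have h := P.one_lt
  have h1 : 0 < 1 + β := by linarith
  refine ⟨inv_pos.2 h1, ?_, ?_⟩
  · rw [one_div]; exact inv_strictAnti₀ two_pos (by linarith)
  · field_simp; ring

lemma genTakagi_renormalize (hβ : β ^ 2 ≤ 2) {ξ : ℝ} (hξ : ξ ∈ Set.Icc (0 : ℝ) 1) :
    genTakagi α β ((1 + β)⁻¹ + (β - 1) / (β + 1) * ξ) =
      (1 - α * β) * ((β - 1) / (β + 1)) * genTakagi (α ^ 2) (β ^ 2) ξ +
        (1 + β)⁻¹ / (1 - α) := by
  obtain ⟨hx0, hx1, hx2⟩ := P.fixed_pos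
  have Q := P.sq hβ
  have h1 := P.one_lt
  have hβ0 := P.β_pos
  have hα := P.α_pos
  have hα1 : 0 < 1 - α := sub_pos.2 P.α_lt
  have hL : (β - 1) / (β + 1) = 1 - 2 * (1 + β)⁻¹ := by
    have : 1 + β ≠ 0 := by linarith
    have : β + 1 ≠ 0 := by linarith
    field_simp
    ring
  set x₀ := (1 + β)⁻¹ with hx₀
  set L := (β - 1) / (β + 1) with hLdef
  have hL0 : 0 < L := by rw [hL]; linarith
  have hmem : ∀ ξ ∈ Set.Icc (0 : ℝ) 1, x₀ + L * ξ ∈ Set.Icc (0 : ℝ) 1 := fun ξ hξ => by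
    have := mul_le_mul_of_nonneg_left hξ.2 hL0.le
    have := mul_nonneg hL0.le hξ.1
    exact ⟨by linarith, by linarith⟩
  set Δ : ℝ → ℝ := fun ξ => genTakagi α β (x₀ + L * ξ) -
    ((1 - α * β) * L * genTakagi (α ^ 2) (β ^ 2) ξ + x₀ / (1 - α)) with hΔ
  have hsymm : ∀ ξ ∈ Set.Icc (0 : ℝ) 1, Δ (1 - ξ) = Δ ξ := fun ξ hξ => by
    simp only [hΔ]
    rw [Q.genTakagi_one_sub hξ, ← P.genTakagi_one_sub (hmem ξ hξ)]
    congr 2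
    rw [hL]; ring
  have hstep : ∀ ξ, 0 ≤ ξ → ξ ≤ 1 / 2 → Δ ξ = α ^ 2 * Δ (β ^ 2 * ξ) := fun ξ h0 h2 => by
    have m1 : x₀ + L * ξ ≤ 1 / 2 := by
      have := mul_le_mul_of_nonneg_left h2 hL0.le
      linarith
    have m0 : 0 ≤ x₀ + L * ξ := by have := mul_nonneg hL0.le h0; linarith
    have m2 := P.mul_mem m0 m1
    have e1 : 1 - β * (x₀ + L * ξ) = x₀ - β * (L * ξ) := by linear_combination -hx2
    have m3 : 0 ≤ x₀ - β * (L * ξ) := by rw [← e1]; linarith [m2.2]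
    have m4 : x₀ - β * (L * ξ) ≤ 1 / 2 := by
      have := mul_nonneg hβ0.le (mul_nonneg hL0.le h0); linarith
    have m5 := P.mul_mem m3 m4
    have e2 : 1 - β * (x₀ - β * (L * ξ)) = x₀ + L * (β ^ 2 * ξ) := by linear_combination -hx2
    simp only [hΔ]
    rw [P.genTakagi_of_le m0 m1, ← P.genTakagi_one_sub m2, e1, P.genTakagi_of_le m3 m4,
      ← P.genTakagi_one_sub m5, e2, Q.genTakagi_of_le h0 h2]
    have e3 : x₀ / (1 - α) = (1 + α) * x₀ + α ^ 2 * (x₀ / (1 - α)) := by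
      field_simp; ring
    linear_combination -e3
  obtain ⟨M, hM⟩ : ∃ M, ∀ ξ ∈ Set.Icc (0 : ℝ) 1, |Δ ξ| ≤ M := by
    refine ⟨(1 - α)⁻¹ + (|(1 - α * β) * L| * (1 - α ^ 2)⁻¹ + |x₀ / (1 - α)|), fun ξ hξ => ?_⟩
    have a1 := P.genTakagi_mem (hmem ξ hξ)
    have a2 := Q.genTakagi_mem hξ
    refine (abs_sub _ _).trans (add_le_add ((abs_of_nonneg a1.1).trans_le a1.2)
      ((abs_add_le _ _).trans (add_le_add_left ?_ _)))
    rw [abs_mul]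
    exact mul_le_mul_of_nonneg_left ((abs_of_nonneg a2.1).trans_le a2.2) (abs_nonneg _)
  have hn : ∀ n : ℕ, ∀ ξ ∈ Set.Icc (0 : ℝ) 1, |Δ ξ| ≤ (α ^ 2) ^ n * M := by
    intro n
    induction n with
    | zero => simpa using hM
    | succ n ih =>
      have half : ∀ ξ, 0 ≤ ξ → ξ ≤ 1 / 2 → |Δ ξ| ≤ (α ^ 2) ^ (n + 1) * M := fun ξ h0 h2 => by
        rw [hstep ξ h0 h2, abs_mul, abs_of_pos Q.α_pos, pow_succ' (α ^ 2) n, mul_assoc (α ^ 2)]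
        exact mul_le_mul_of_nonneg_left (ih _ (Q.mul_mem h0 h2)) Q.α_pos.le
      intro ξ hξ
      rcases le_total ξ (1 / 2) with h | h
      · exact half ξ hξ.1 h
      · rw [← hsymm ξ hξ]
        exact half _ (by linarith [hξ.2]) (by linarith)
  have hzero : |Δ ξ| ≤ 0 := by
    refine ge_of_tendsto' (f := fun n : ℕ => (α ^ 2) ^ n * M) (x := atTop) ?_ fun n => hn n ξ hξ
    simpa using (tendsto_pow_atTop_nhds_zero_of_lt_one Q.α_pos.le Q.α_lt).mul_const M
  exact sub_eq_zero.1 (abs_nonpos_iff.1 hzero)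

lemma dimH_graph_sq_le (hβ : β ^ 2 ≤ 2) :
    dimH {p : ℝ × ℝ | ∃ x ∈ Set.Icc (0:ℝ) 1, p = (x, genTakagi (α ^ 2) (β ^ 2) x)} ≤
      dimH {p : ℝ × ℝ | ∃ x ∈ Set.Icc (0:ℝ) 1, p = (x, genTakagi α β x)} := by
  have h1 := P.one_lt
  have hL : 0 < (β - 1) / (β + 1) := div_pos (by linarith) (by linarith)
  refine dimH_graph_le_of_affine (x₀ := (1 + β)⁻¹) hL.ne'
    (mul_ne_zero (sub_neg.2 P.one_lt_mul).ne hL.ne')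
    fun ξ hξ => ⟨⟨?_, ?_⟩, P.genTakagi_renormalize hβ hξ⟩
  · have := P.fixed_pos.1
    have := mul_nonneg hL.le hξ.1
    linarith
  · have h2 := mul_le_mul_of_nonneg_left hξ.2 hL.le
    have : (1 + β)⁻¹ + (β - 1) / (β + 1) ≤ 1 := by
      rw [add_comm 1 β, ← one_div, ← add_div, div_le_one (by linarith)]
      linarith
    linarith

end Params
end GenTakagi

namespace GenTakagi

/-- The interval of radius `ρ` around the fixed point of the tent map is compactly contained in
the core `(1 - β / 2, 1 / 2)`. -/
structure Window (β ρ : ℝ) : Prop where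
  pos : 0 < ρ
  lo : 1 - β / 2 < (1 + β)⁻¹ - ρ
  hi : (1 + β)⁻¹ + ρ < 1 / 2

/-- `y ↦ y / β ^ N + r` maps the window of radius `ρ` into `(a, b)`; it is an inverse branch of the
`N`-th iterate of the tent map, along which the graph of `genTakagi α β` is self-affine with
slope `k`. -/
structure IsBranch (α β ρ : ℝ) (N : ℕ) (r k a b : ℝ) : Prop where
  mem : ∀ y, |y - (1 + β)⁻¹| ≤ ρ → y / β ^ N + r ∈ Set.Ioo a b
  tent_iterate : ∀ y, |y - (1 + β)⁻¹| ≤ ρ → (tent β)^[N] (fold (y / β ^ N + r)) = y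
  map_eq : ∃ m, ∀ y, |y - (1 + β)⁻¹| ≤ ρ →
    genTakagi α β (y / β ^ N + r) = α ^ N * genTakagi α β y + k * y + m

variable {α β ρ : ℝ}

namespace IsBranch
variable {N N' : ℕ} {r r' k k' a b c d : ℝ}

lemma mono (h : IsBranch α β ρ N r k c d) (ha : a ≤ c) (hb : d ≤ b) :
    IsBranch α β ρ N r k a b :=
  ⟨fun y hy => Set.Ioo_subset_Ioo ha hb (h.mem y hy), h.tent_iterate, h.map_eq⟩

lemma slope_unique (hρ : 0 < ρ) (h : IsBranch α β ρ N r k a b)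
    (h' : IsBranch α β ρ N r k' c d) : k = k' := by
  obtain ⟨m, hm⟩ := h.map_eq
  obtain ⟨m', hm'⟩ := h'.map_eq
  have e0 : |(1 + β)⁻¹ - (1 + β)⁻¹| ≤ ρ := by simpa using hρ.le
  have e1 : |(1 + β)⁻¹ + ρ - (1 + β)⁻¹| ≤ ρ := by
    rw [add_sub_cancel_left, abs_of_pos hρ]
  have h0 := (hm _ e0).symm.trans (hm' _ e0)
  have h1 := (hm _ e1).symm.trans (hm' _ e1)
  have h2 : (k - k') * ρ = 0 := by linarith
  exact sub_eq_zero.1 ((mul_eq_zero.1 h2).resolve_right hρ.ne')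

lemma le_abs_sub (hβ : 0 < β) (h : IsBranch α β ρ N r k a b)
    (h' : IsBranch α β ρ N r' k' c d) (hne : r ≠ r') : 2 * ρ / β ^ N ≤ |r - r'| := by
  have hB : 0 < β ^ N := pow_pos hβ N
  by_contra! hlt
  rw [lt_div_iff₀ hB] at hlt
  set δ := (r - r') * β ^ N with hδ
  have h1 : |δ| < 2 * ρ := by rwa [hδ, abs_mul, abs_of_pos hB]
  rw [abs_lt] at h1
  have e0 : |(1 + β)⁻¹ - δ / 2 - (1 + β)⁻¹| ≤ ρ := abs_le.2 ⟨by linarith, by linarith⟩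
  have e1 : |(1 + β)⁻¹ + δ / 2 - (1 + β)⁻¹| ≤ ρ := abs_le.2 ⟨by linarith, by linarith⟩
  have h2 := h.tent_iterate _ e0
  have h3 := h'.tent_iterate _ e1
  have h4 : ((1 + β)⁻¹ - δ / 2) / β ^ N + r = ((1 + β)⁻¹ + δ / 2) / β ^ N + r' := by
    rw [hδ]; field_simp; ring
  rw [h4, h3] at h2
  have h5 : (r - r') * β ^ N = 0 := by linarith
  exact hne (sub_eq_zero.1 ((mul_eq_zero.1 h5).resolve_right hB.ne'))

end IsBranch

namespace Window
variable (w : Window β ρ) {y : ℝ} (hβ : β ≤ 2) (hy : |y - (1 + β)⁻¹| ≤ ρ)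
include w hβ hy

lemma mem : y ∈ Set.Icc (0 : ℝ) (1 / 2) := by
  rw [abs_le] at hy
  exact ⟨by linarith [w.lo], by linarith [w.hi]⟩

end Window

variable (P : Params α β) (w : Window β ρ)
include P w

namespace Params
variable {N N' : ℕ} {r r' k k' a b c d : ℝ}

lemma isBranch_zero (ha : a < (1 + β)⁻¹ - ρ) (hb : (1 + β)⁻¹ + ρ < b) :
    IsBranch α β ρ 0 0 0 a b where
  mem y hy := by
    rw [abs_le] at hy
    simp only [pow_zero, div_one, add_zero]
    exact ⟨by linarith, by linarith⟩
  tent_iterate y hy := by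
    simp only [pow_zero, div_one, add_zero, Function.iterate_zero, id_eq]
    exact fold_of_le (w.mem P.le_two hy).2
  map_eq := ⟨0, fun y _ => by simp⟩

omit w in
lemma isBranch_left (h : IsBranch α β ρ N r k c d) (hc : 0 ≤ c) (hd : d ≤ β / 2) :
    IsBranch α β ρ (N + 1) (r / β) (α * k + (β ^ (N + 1))⁻¹) (c / β) (d / β) := by
  have hβ := P.β_pos
  have e : ∀ y, y / β ^ (N + 1) + r / β = (y / β ^ N + r) / β := fun y => by
    field_simp; ring
  have hx : ∀ y, |y - (1 + β)⁻¹| ≤ ρ →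
      0 ≤ (y / β ^ N + r) / β ∧ (y / β ^ N + r) / β ≤ 1 / 2 := fun y hy => by
    have := h.mem y hy
    refine ⟨div_nonneg (by linarith [this.1]) hβ.le, ?_⟩
    rw [div_le_iff₀ hβ]; linarith [this.2]
  refine ⟨fun y hy => ?_, fun y hy => ?_, ?_⟩
  · rw [e]
    exact ⟨div_lt_div_of_pos_right (h.mem y hy).1 hβ, div_lt_div_of_pos_right (h.mem y hy).2 hβ⟩
  · rw [e, fold_of_le (hx y hy).2, Function.iterate_succ_apply, tent, mul_div_cancel₀ _ hβ.ne']
    exact h.tent_iterate y hy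
  · obtain ⟨m, hm⟩ := h.map_eq
    refine ⟨r / β + α * m, fun y hy => ?_⟩
    rw [e, P.genTakagi_of_le (hx y hy).1 (hx y hy).2, mul_div_cancel₀ _ hβ.ne', hm y hy, ← e]
    rw [pow_succ α]
    ring

omit w in
lemma isBranch_right (h : IsBranch α β ρ N r k c d) (hc : 1 - β / 2 ≤ c) (hd : d ≤ 1) :
    IsBranch α β ρ (N + 1) (r / β + 1 - 1 / β) (α * k - (β ^ (N + 1))⁻¹)
      (1 - (1 - c) / β) (1 - (1 - d) / β) := by
  have hβ := P.β_pos
  have e : ∀ y, y / β ^ (N + 1) + (r / β + 1 - 1 / β) = 1 - (1 - (y / β ^ N + r)) / β :=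
    fun y => by field_simp; ring
  have hx : ∀ y, |y - (1 + β)⁻¹| ≤ ρ →
      0 ≤ (1 - (y / β ^ N + r)) / β ∧ (1 - (y / β ^ N + r)) / β ≤ 1 / 2 := fun y hy => by
    have := h.mem y hy
    refine ⟨div_nonneg (by linarith [this.2]) hβ.le, ?_⟩
    rw [div_le_iff₀ hβ]; linarith [this.1]
  refine ⟨fun y hy => ?_, fun y hy => ?_, ?_⟩
  · rw [e]
    have := h.mem y hy
    exact ⟨sub_lt_sub_left (div_lt_div_of_pos_right (by linarith [this.1]) hβ) _,
      sub_lt_sub_left (div_lt_div_of_pos_right (by linarith [this.2]) hβ) _⟩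
  · rw [e, fold_one_sub, fold_of_le (hx y hy).2, Function.iterate_succ_apply, tent,
      mul_div_cancel₀ _ hβ.ne']
    change (tent β)^[N] (fold (1 - (y / β ^ N + r))) = y
    rw [fold_one_sub]
    exact h.tent_iterate y hy
  · obtain ⟨m, hm⟩ := h.map_eq
    refine ⟨(1 - r) / β + α * m, fun y hy => ?_⟩
    have h1 := hx y hy
    have h2 := P.mul_mem h1.1 h1.2
    rw [mul_div_cancel₀ _ hβ.ne'] at h2
    rw [e, P.genTakagi_one_sub ⟨h1.1, by linarith [h1.2]⟩, P.genTakagi_of_le h1.1 h1.2,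
      mul_div_cancel₀ _ hβ.ne', ← P.genTakagi_one_sub h2, sub_sub_cancel, hm y hy]
    rw [pow_succ α, pow_succ β]
    field_simp
    ring

lemma isBranch_comp (h : IsBranch α β ρ N r k a b)
    (h' : IsBranch α β ρ N' r' k' ((1 + β)⁻¹ - ρ) ((1 + β)⁻¹ + ρ)) :
    IsBranch α β ρ (N' + N) (r' / β ^ N + r) (α ^ N * k' + k / β ^ N') a b := by
  have hβ := P.β_pos
  have e : ∀ y, y / β ^ (N' + N) + (r' / β ^ N + r) = (y / β ^ N' + r') / β ^ N + r :=
    fun y => by rw [pow_add]; field_simp; ring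
  have hx : ∀ y, |y - (1 + β)⁻¹| ≤ ρ → |(y / β ^ N' + r') - (1 + β)⁻¹| ≤ ρ := fun y hy => by
    have := h'.mem y hy
    exact abs_le.2 ⟨by linarith [this.1], by linarith [this.2]⟩
  refine ⟨fun y hy => ?_, fun y hy => ?_, ?_⟩
  · rw [e]; exact h.mem _ (hx y hy)
  · rw [e, Function.iterate_add_apply, h.tent_iterate _ (hx y hy)]
    have := h'.tent_iterate y hy
    rwa [fold_of_le (w.mem P.le_two (hx y hy)).2] at this
  · obtain ⟨m, hm⟩ := h.map_eq
    obtain ⟨m', hm'⟩ := h'.map_eq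
    refine ⟨α ^ N * m' + k * r' + m, fun y hy => ?_⟩
    rw [e, hm _ (hx y hy), hm' y hy, pow_add]
    ring

lemma isBranch_reflect (h : IsBranch α β ρ N r k a b) (ha : 0 ≤ a) (hb : b ≤ 1) :
    IsBranch α β ρ (N + 1) (1 - r - (β ^ (N + 1))⁻¹) (-(α ^ N + k) / β) (1 - b) (1 - a) := by
  have hβ := P.β_pos
  have e : ∀ y, y / β ^ (N + 1) + (1 - r - (β ^ (N + 1))⁻¹) = 1 - ((1 - y) / β / β ^ N + r) :=
    fun y => by field_simp; ring
  have hx : ∀ y, |y - (1 + β)⁻¹| ≤ ρ → |(1 - y) / β - (1 + β)⁻¹| ≤ ρ := fun y hy => by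
    have h1 : (1 - y) / β - (1 + β)⁻¹ = ((1 + β)⁻¹ - y) / β := by
      have : (1 : ℝ) + β ≠ 0 := by linarith
      field_simp
      ring
    rw [h1, abs_div, abs_of_pos hβ, abs_sub_comm, div_le_iff₀ hβ]
    have := mul_le_mul_of_nonneg_left P.one_lt.le w.pos.le
    linarith
  refine ⟨fun y hy => ?_, fun y hy => ?_, ?_⟩
  · rw [e]
    have := h.mem _ (hx y hy)
    exact ⟨by linarith [this.2], by linarith [this.1]⟩
  · rw [e, fold_one_sub, Function.iterate_succ_apply', h.tent_iterate _ (hx y hy), tent,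
      mul_div_cancel₀ _ hβ.ne', min_comm, sub_sub_cancel]
    exact fold_of_le (w.mem P.le_two hy).2
  · obtain ⟨m, hm⟩ := h.map_eq
    refine ⟨(α ^ N + k) / β + m, fun y hy => ?_⟩
    have h1 := h.mem _ (hx y hy)
    have h2 := w.mem P.le_two (hx y hy)
    have h3 := w.mem P.le_two hy
    rw [e, P.genTakagi_one_sub ⟨by linarith [h1.1], by linarith [h1.2]⟩, hm _ (hx y hy),
      P.genTakagi_of_le h2.1 h2.2, mul_div_cancel₀ _ hβ.ne',
      P.genTakagi_one_sub ⟨h3.1, by linarith [h3.2]⟩]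
    rw [pow_succ]
    field_simp
    ring

end Params
end GenTakagi

namespace GenTakagi
variable {α β ρ : ℝ} (P : Params α β) (w : Window β ρ)
include P

namespace Params
variable {N N' : ℕ} {r r' k k' a b c d : ℝ}

include w in
lemma exists_isBranch_of_lt (j : ℕ) {a b : ℝ} (ha : 0 ≤ a) (hb : b ≤ 1)
    (hab : 1 < (β ^ 2 / 2) ^ j * (b - a)) : ∃ N r k, IsBranch α β ρ N r k a b := by
  have hβ := P.β_pos
  have h1 := P.one_lt
  have h2 := P.le_two
  have hle : β ^ 2 / 2 ≤ β := by nlinarith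
  have hj : 0 < (β ^ 2 / 2) ^ j := by positivity
  induction j generalizing a b with
  | zero => rw [pow_zero, one_mul] at hab; linarith
  | succ j ih =>
    replace ih := fun {a b : ℝ} ha hb hab => @ih a b ha hb hab (by positivity)
    have hq : 0 < (β ^ 2 / 2) ^ j := by positivity
    rw [pow_succ, mul_assoc] at hab
    have hlen : 0 < b - a := by
      by_contra! h
      have := mul_nonpos_of_nonneg_of_nonpos hq.le
        (mul_nonpos_of_nonneg_of_nonpos (show 0 ≤ β ^ 2 / 2 by positivity) h)
      linarith
    have grow : ∀ {a' b' : ℝ}, β ^ 2 / 2 * (b - a) ≤ b' - a' →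
        1 < (β ^ 2 / 2) ^ j * (b' - a') := fun h =>
      hab.trans_le (mul_le_mul_of_nonneg_left h hq.le)
    have cancel : ∀ z : ℝ, β * z / β = z := fun z => mul_div_cancel_left₀ z hβ.ne'
    have left : ∀ {c d : ℝ}, 0 ≤ c → d ≤ 1 / 2 →
        (∃ N r k, IsBranch α β ρ N r k (β * c) (β * d)) → ∃ N r k, IsBranch α β ρ N r k c d := by
      rintro c d hc hd ⟨N, r, k, h⟩
      have := P.isBranch_left h (by positivity) (by nlinarith)
      rw [cancel, cancel] at this
      exact ⟨_, _, _, this⟩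
    have right : ∀ {c d : ℝ}, 1 / 2 ≤ c → d ≤ 1 →
        (∃ N r k, IsBranch α β ρ N r k (1 - β * (1 - c)) (1 - β * (1 - d))) →
        ∃ N r k, IsBranch α β ρ N r k c d := by
      rintro c d hc hd ⟨N, r, k, h⟩
      have := P.isBranch_right h (by nlinarith) (by nlinarith)
      rw [sub_sub_cancel, sub_sub_cancel, cancel, cancel, sub_sub_cancel, sub_sub_cancel] at this
      exact ⟨_, _, _, this⟩
    rcases le_or_gt b (1 / 2) with hb2 | hb2
    · refine left ha hb2 (ih (by positivity) (by nlinarith) (grow ?_))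
      rw [← mul_sub]
      exact mul_le_mul_of_nonneg_right hle hlen.le
    rcases le_or_gt (1 / 2) a with ha2 | ha2
    · refine right ha2 hb (ih (by nlinarith) (by nlinarith) (grow ?_))
      have := mul_le_mul_of_nonneg_right hle hlen.le
      linarith
    obtain ⟨N₀, r₀, k₀, hz⟩ : ∃ N r k, IsBranch α β ρ N r k (1 - β / 2) (1 / 2) :=
      ⟨0, 0, 0, P.isBranch_zero w w.lo w.hi⟩
    rcases le_total (b - 1 / 2) (1 / 2 - a) with hh | hh
    · suffices ∃ N r k, IsBranch α β ρ N r k a (1 / 2) by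
        obtain ⟨N, r, k, h⟩ := this
        exact ⟨N, r, k, h.mono le_rfl hb2.le⟩
      refine left ha le_rfl ?_
      rcases lt_or_ge (β * a) (1 / 2) with h | h
      · have h3 := P.isBranch_right hz le_rfl (by norm_num)
        refine ⟨_, _, _, h3.mono ?_ ?_⟩
        · have : (1 - (1 - β / 2)) / β = 1 / 2 := by field_simp; ring
          rw [this]; linarith
        · rw [sub_le_iff_le_add, ← sub_le_iff_le_add', le_div_iff₀ hβ]
          nlinarith [sq_nonneg (β - 1)]
      · refine right h (by linarith) (ih ?_ ?_ (grow ?_))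
        · nlinarith
        · nlinarith
        · have h3 := mul_le_mul_of_nonneg_left hh (sq_nonneg β)
          linarith
    · suffices ∃ N r k, IsBranch α β ρ N r k (1 / 2) b by
        obtain ⟨N, r, k, h⟩ := this
        exact ⟨N, r, k, h.mono ha2.le le_rfl⟩
      refine right le_rfl hb ?_
      rcases lt_or_ge (1 / 2) (1 - β * (1 - b)) with h | h
      · exact ⟨_, _, _, hz.mono (by linarith) h.le⟩
      · refine left (by linarith) h (ih ?_ ?_ (grow ?_))
        · have : 0 ≤ 1 - β * (1 - 1 / 2) := by linarith
          positivity
        · nlinarith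
        · have h3 := mul_le_mul_of_nonneg_left hh (sq_nonneg β)
          linarith

include w in
lemma exists_isBranch (hβ2 : 2 < β ^ 2) {a b : ℝ} (ha : 0 ≤ a) (hab : a < b) (hb : b ≤ 1) :
    ∃ N r k, IsBranch α β ρ N r k a b := by
  obtain ⟨j, hj⟩ := pow_unbounded_of_one_lt (b - a)⁻¹ (show 1 < β ^ 2 / 2 by linarith)
  refine P.exists_isBranch_of_lt w j ha hb ?_
  rwa [inv_lt_iff_one_lt_mul₀ (sub_pos.2 hab)] at hj

lemma isBranch_left_right (h : IsBranch α β ρ N r k c d) (hc : 1 - β / 2 ≤ c)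
    (hd : d ≤ 1 - β + β ^ 2 / 2) : ∃ r',
      IsBranch α β ρ (N + 2) r' (α * (α * k - (β ^ (N + 1))⁻¹) + (β ^ (N + 2))⁻¹)
        ((1 + β)⁻¹ + (c - (1 + β)⁻¹) / β ^ 2) ((1 + β)⁻¹ + (d - (1 + β)⁻¹) / β ^ 2) := by
  have hβ := P.β_pos
  have h1 := P.one_lt
  have h2 := P.le_two
  have e : ∀ z, (1 - (1 - z) / β) / β = (1 + β)⁻¹ + (z - (1 + β)⁻¹) / β ^ 2 := fun z => by
    have : 1 + β ≠ 0 := by linarith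
    field_simp
    ring
  have h3 := P.isBranch_right h hc (by nlinarith)
  have h4 := P.isBranch_left h3 ?_ ?_
  · rw [e, e] at h4
    exact ⟨_, h4⟩
  · have : (1 - c) / β ≤ 1 := by rw [div_le_one hβ]; linarith
    linarith
  · rw [sub_le_iff_le_add, ← sub_le_iff_le_add', le_div_iff₀ hβ]
    nlinarith

/-- The commutator of a branch with the square of the central branch vanishes precisely when this
quantity does. -/
noncomputable def defect (α β : ℝ) (N : ℕ) (k : ℝ) : ℝ :=
  β ^ N * k * (1 + α * β) + (α * β) ^ N - 1

end Params
end GenTakagi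

namespace GenTakagi
variable {α β ρ : ℝ} (P : Params α β) (w : Window β ρ)
include P

namespace Params
variable {N N' : ℕ} {r r' k k' a b c d : ℝ}

include w in
lemma exists_isBranch_defect_ne_zero (hβ2 : 2 < β ^ 2) :
    ∃ N r k, IsBranch α β ρ N r k (1 - β / 2) (1 - β + β ^ 2 / 2) ∧ defect α β N k ≠ 0 := by
  have hβ := P.β_pos
  have h1 := P.one_lt
  have h2 := P.le_two
  have he : 1 / 2 < 1 - β + β ^ 2 / 2 := by nlinarith [mul_pos (sub_pos.2 h1) (sub_pos.2 h1)]
  have he1 : 1 - β + β ^ 2 / 2 ≤ β / 2 := by nlinarith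
  obtain ⟨N, r, k, h⟩ := P.exists_isBranch w hβ2 (by norm_num) he (by linarith)
  by_cases hG : defect α β N k = 0
  · refine ⟨_, _, _, (P.isBranch_reflect w h (by norm_num) (by linarith)).mono (by linarith)
      (by linarith), ?_⟩
    have : defect α β (N + 1) (-(α ^ N + k) / β) = -defect α β N k - 2 := by
      simp only [defect, mul_pow, pow_succ]
      field_simp
      ring
    rw [this, hG]
    norm_num
  · exact ⟨N, r, k, h.mono (by linarith) le_rfl, hG⟩

include w in
lemma exists_isBranch_near_defect_ne_zero (hβ2 : 2 < β ^ 2) (j : ℕ) :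
    ∃ N r k, IsBranch α β ρ N r k ((1 + β)⁻¹ + (1 - β / 2 - (1 + β)⁻¹) / (β ^ 2) ^ j)
      ((1 + β)⁻¹ + (1 - β + β ^ 2 / 2 - (1 + β)⁻¹) / (β ^ 2) ^ j) ∧ defect α β N k ≠ 0 := by
  have hβ := P.β_pos
  have h1 := P.one_lt
  induction j with
  | zero =>
    simp only [pow_zero, div_one, add_sub_cancel]
    exact P.exists_isBranch_defect_ne_zero w hβ2
  | succ j ih =>
    obtain ⟨N, r, k, h, hG⟩ := ih
    have hle : 1 ≤ (β ^ 2) ^ j := one_le_pow₀ (by linarith)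
    have hp : 0 ≤ (1 + β)⁻¹ - (1 - β / 2) := by linarith [w.lo, w.pos]
    have hq : 0 ≤ 1 - β + β ^ 2 / 2 - (1 + β)⁻¹ := by
      nlinarith [w.hi, w.pos, sq_nonneg (β - 1)]
    have h3 := div_le_self hp hle
    have h4 := div_le_self hq hle
    obtain ⟨r', h'⟩ := P.isBranch_left_right h (by
      rw [← neg_sub (1 + β)⁻¹, neg_div]; linarith) (by linarith)
    rw [add_sub_cancel_left, add_sub_cancel_left, div_div, div_div, ← pow_succ] at h'
    refine ⟨_, _, _, h', ?_⟩
    have : defect α β (N + 2) (α * (α * k - (β ^ (N + 1))⁻¹) + (β ^ (N + 2))⁻¹) =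
        (α * β) ^ 2 * defect α β N k := by
      simp only [defect, mul_pow, pow_succ]
      field_simp
      ring
    rw [this]
    exact mul_ne_zero (pow_pos (one_pos.trans P.one_lt_mul) 2).ne' hG

include w in
lemma exists_isBranch_window_defect_ne_zero (hβ2 : 2 < β ^ 2) {δ : ℝ} (hδ : 0 < δ) :
    ∃ N r k, IsBranch α β ρ N r k ((1 + β)⁻¹ - δ) ((1 + β)⁻¹ + δ) ∧ defect α β N k ≠ 0 := by
  have hlim : ∀ x : ℝ, Tendsto (fun j : ℕ => x / (β ^ 2) ^ j) atTop (𝓝 0) := fun x =>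
    tendsto_const_nhds.div_atTop (tendsto_pow_atTop_atTop_of_one_lt (by linarith))
  obtain ⟨j, h1, h2⟩ := (((hlim (1 - β / 2 - (1 + β)⁻¹)).eventually_const_lt
    (neg_lt_zero.2 hδ)).and ((hlim (1 - β + β ^ 2 / 2 - (1 + β)⁻¹)).eventually_lt_const hδ)).exists
  obtain ⟨N, r, k, h, hG⟩ := P.exists_isBranch_near_defect_ne_zero w hβ2 j
  exact ⟨N, r, k, h.mono (by linarith) (by linarith), hG⟩

include w in
lemma exists_isBranch_central (hβ2 : 2 < β ^ 2) :
    ∃ r, IsBranch α β ρ 2 r ((1 - α * β) / β ^ 2) ((1 + β)⁻¹ - ρ / 2) ((1 + β)⁻¹ + ρ / 2) := by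
  have hβ := P.β_pos
  have h1 := P.one_lt
  set δ := min (β ^ 2 * (ρ / 2)) (min ((1 + β)⁻¹ - (1 - β / 2)) (1 / 2 - (1 + β)⁻¹)) with hδ
  have hρ : ρ < δ :=
    lt_min (by nlinarith [w.pos]) (lt_min (by linarith [w.lo]) (by linarith [w.hi]))
  have d1 : δ ≤ β ^ 2 * (ρ / 2) := min_le_left _ _
  have d2 : δ ≤ (1 + β)⁻¹ - (1 - β / 2) := (min_le_right _ _).trans (min_le_left _ _)
  have d3 : δ ≤ 1 / 2 - (1 + β)⁻¹ := (min_le_right _ _).trans (min_le_right _ _)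
  obtain ⟨r, h⟩ := P.isBranch_left_right (P.isBranch_zero w (a := (1 + β)⁻¹ - δ)
    (b := (1 + β)⁻¹ + δ) (by linarith) (by linarith)) (by linarith)
    (by nlinarith [sq_nonneg (β - 1)])
  have e1 : δ / β ^ 2 ≤ ρ / 2 := by rwa [div_le_iff₀' (by positivity)]
  have e2 : (1 - α * β) / β ^ 2 = α * (α * 0 - (β ^ (0 + 1))⁻¹) + (β ^ (0 + 2))⁻¹ := by
    field_simp; ring
  refine ⟨r, ?_⟩
  rw [e2]
  refine h.mono ?_ ?_
  · rw [sub_sub_cancel_left, neg_div]; linarith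
  · rw [add_sub_cancel_left]; linarith

include w in
lemma exists_isBranch_pair (hβ2 : 2 < β ^ 2) : ∃ N r k r' k',
    IsBranch α β ρ N r k ((1 + β)⁻¹ - ρ / 2) ((1 + β)⁻¹ + ρ / 2) ∧
    IsBranch α β ρ N r' k' ((1 + β)⁻¹ - ρ / 2) ((1 + β)⁻¹ + ρ / 2) ∧ k ≠ k' := by
  have hβ := P.β_pos
  obtain ⟨rz, hz⟩ := P.exists_isBranch_central w hβ2
  obtain ⟨N, r, k, h, hG⟩ := P.exists_isBranch_window_defect_ne_zero w hβ2 (half_pos w.pos)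
  have hw := w.pos
  have hzy := P.isBranch_comp w hz (h.mono (by linarith) (by linarith))
  have hyz := P.isBranch_comp w h (hz.mono (by linarith) (by linarith))
  rw [add_comm 2 N] at hyz
  refine ⟨_, _, _, _, _, hzy, hyz, fun heq => ?_⟩
  have : (α * β - 1) * defect α β N k = 0 := by
    have h2 : (α * β - 1) * defect α β N k = β ^ (N + 2) * ((α ^ 2 * k +
        (1 - α * β) / β ^ 2 / β ^ N) - (α ^ N * ((1 - α * β) / β ^ 2) + k / β ^ 2)) := by
      simp only [defect, mul_pow, pow_add]
      field_simp
      ring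
    rw [h2, heq, sub_self, mul_zero]
  exact mul_ne_zero (sub_pos.2 P.one_lt_mul).ne' hG this

end Params
end GenTakagi

namespace GenTakagi

/-- The transfer operator of `Bmap β` on functions of the open interval `(a, b)`: the value on an
interval is the sum of the values on the images of its monotone pieces. -/
noncomputable def transfer (β : ℝ) : Module.End ℝ (ℝ → ℝ → ℝ) where
  toFun f a b :=
    if b ≤ 1 / 2 then f (β * a) (β * b)
    else if 1 / 2 ≤ a then f (1 - β * (1 - a)) (1 - β * (1 - b))
    else f (β * a) (β / 2) + f (1 - β / 2) (1 - β * (1 - b))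
  map_add' f g := by
    ext a b
    simp only [Pi.add_apply]
    split_ifs
    · rfl
    · rfl
    · ring
  map_smul' c f := by
    ext a b
    simp only [Pi.smul_apply, RingHom.id_apply, smul_eq_mul]
    split_ifs
    · rfl
    · rfl
    · ring

lemma transfer_apply (β : ℝ) (f : ℝ → ℝ → ℝ) (a b : ℝ) : transfer β f a b =
    if b ≤ 1 / 2 then f (β * a) (β * b)
    else if 1 / 2 ≤ a then f (1 - β * (1 - a)) (1 - β * (1 - b))
    else f (β * a) (β / 2) + f (1 - β / 2) (1 - β * (1 - b)) := rfl

lemma transfer_len (β : ℝ) : transfer β (fun a b => b - a) = β • fun a b => b - a := by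
  ext a b
  simp only [transfer_apply, Pi.smul_apply, smul_eq_mul]
  split_ifs <;> ring

lemma transfer_pow_len (β : ℝ) (n : ℕ) :
    (transfer β ^ n) (fun a b => b - a) = β ^ n • fun a b => b - a := by
  induction n with
  | zero => simp
  | succ n ih => rw [pow_succ', Module.End.mul_apply, ih, map_smul, transfer_len, smul_smul,
      pow_succ]

variable {α β ρ : ℝ} (P : Params α β)
include P

namespace Params

lemma transfer_induction {f : ℝ → ℝ → ℝ} {p : ℝ → ℝ → ℝ → Prop} {q : ℝ → ℝ → ℝ → Prop}
    (h : ∀ a b, 0 ≤ a → a < b → b ≤ 1 → p a b (f a b))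
    (hl : ∀ a b x, 0 ≤ a → a < b → b ≤ 1 / 2 → p (β * a) (β * b) x → q a b x)
    (hr : ∀ a b x, 1 / 2 ≤ a → a < b → b ≤ 1 → p (1 - β * (1 - a)) (1 - β * (1 - b)) x → q a b x)
    (hadd : ∀ a b x y, 0 ≤ a → a < 1 / 2 → 1 / 2 < b → b ≤ 1 → q a (1 / 2) x → q (1 / 2) b y →
      q a b (x + y)) {a b : ℝ} (ha : 0 ≤ a) (hab : a < b) (hb : b ≤ 1) :
    q a b (transfer β f a b) := by
  have hβ := P.β_pos
  have h1 := P.one_lt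
  have h2 := P.le_two
  have left : ∀ {c d : ℝ}, 0 ≤ c → c < d → d ≤ 1 / 2 → q c d (f (β * c) (β * d)) :=
    fun hc hcd hd => hl _ _ _ hc hcd hd
      (h _ _ (mul_nonneg hβ.le hc) (mul_lt_mul_of_pos_left hcd hβ) (by nlinarith))
  have right : ∀ {c d : ℝ}, 1 / 2 ≤ c → c < d → d ≤ 1 →
      q c d (f (1 - β * (1 - c)) (1 - β * (1 - d))) :=
    fun hc hcd hd => hr _ _ _ hc hcd hd (h _ _ (by nlinarith) (by nlinarith) (by nlinarith))
  rw [transfer_apply]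
  split_ifs with hb2 ha2
  · exact left ha hab hb2
  · exact right ha2 hab hb
  · rw [not_le] at hb2 ha2
    have e1 := left ha ha2 le_rfl
    have e2 := right le_rfl hb2 hb
    rw [mul_one_div] at e1
    rw [show 1 - β * (1 - 1 / 2) = 1 - β / 2 by ring] at e2
    exact hadd _ _ _ _ ha ha2 hb2 hb e1 e2

lemma transfer_mono {f g : ℝ → ℝ → ℝ} (h : ∀ a b, 0 ≤ a → a < b → b ≤ 1 → f a b ≤ g a b)
    {a b : ℝ} (ha : 0 ≤ a) (hab : a < b) (hb : b ≤ 1) : transfer β f a b ≤ transfer β g a b := by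
  have h0 : ∀ a b, 0 ≤ a → a < b → b ≤ 1 → 0 ≤ (g - f) a b := fun a b ha hab hb =>
    sub_nonneg.2 (h a b ha hab hb)
  have := P.transfer_induction (p := fun _ _ x => 0 ≤ x) (q := fun _ _ x => 0 ≤ x) h0
    (fun _ _ _ _ _ _ h => h) (fun _ _ _ _ _ _ h => h) (fun _ _ _ _ _ _ _ _ => add_nonneg)
    ha hab hb
  rw [map_sub] at this
  exact sub_nonneg.1 this

lemma transfer_pow_mono (n : ℕ) {f g : ℝ → ℝ → ℝ}
    (h : ∀ a b, 0 ≤ a → a < b → b ≤ 1 → f a b ≤ g a b)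
    {a b : ℝ} (ha : 0 ≤ a) (hab : a < b) (hb : b ≤ 1) :
    (transfer β ^ n) f a b ≤ (transfer β ^ n) g a b := by
  induction n generalizing a b with
  | zero => exact h a b ha hab hb
  | succ n ih =>
    rw [pow_succ', Module.End.mul_apply, Module.End.mul_apply]
    exact P.transfer_mono (fun a b ha hab hb => ih ha hab hb) ha hab hb

/-- The number of monotone pieces is controlled by the number of discontinuities. -/
lemma exists_transfer_pow_one_le_card (n : ℕ) : ∃ D : Finset ℝ, ∀ a b, 0 ≤ a → a < b → b ≤ 1 →
    (transfer β ^ n) 1 a b ≤ 1 + (D.filter fun x => a < x ∧ x < b).card := by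
  classical
  have hβ := P.β_pos
  induction n with
  | zero => exact ⟨∅, fun a b _ _ _ => by simp⟩
  | succ n ih =>
    obtain ⟨D, hD⟩ := ih
    let D' : Finset ℝ :=
      insert (1 / 2) (D.image (fun x => x / β) ∪ D.image fun x => 1 - (1 - x) / β)
    refine ⟨D', fun a b ha hab hb => ?_⟩
    rw [pow_succ', Module.End.mul_apply]
    refine P.transfer_induction (p := fun a b x => x ≤ 1 + (D.filter fun x => a < x ∧ x < b).card)
      (q := fun a b x => x ≤ 1 + (D'.filter fun x => a < x ∧ x < b).card) hD ?_ ?_ ?_ ha hab hb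
    · intro a b x ha hab hb hx
      refine hx.trans (add_le_add le_rfl (Nat.cast_le.2 ?_))
      refine Finset.card_le_card_of_injOn (fun x => x / β) (fun x hx => ?_)
        fun x _ y _ hxy => (div_left_inj' hβ.ne').1 hxy
      simp only [Finset.coe_filter, Set.mem_ofPred_eq] at hx ⊢
      refine ⟨Finset.mem_insert_of_mem (Finset.mem_union_left _ (Finset.mem_image_of_mem _ hx.1)),
        ?_, ?_⟩
      · rw [lt_div_iff₀' hβ]; exact hx.2.1
      · rw [div_lt_iff₀' hβ]; exact hx.2.2
    · intro a b x ha hab hb hx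
      refine hx.trans (add_le_add le_rfl (Nat.cast_le.2 ?_))
      refine Finset.card_le_card_of_injOn (fun x => 1 - (1 - x) / β) (fun x hx => ?_)
        fun x _ y _ hxy => ?_
      · simp only [Finset.coe_filter, Set.mem_ofPred_eq] at hx ⊢
        refine ⟨Finset.mem_insert_of_mem (Finset.mem_union_right _
          (Finset.mem_image_of_mem _ hx.1)), ?_, ?_⟩
        · rw [lt_sub_comm, div_lt_iff₀' hβ]; linarith [hx.2.1]
        · rw [sub_lt_comm, lt_div_iff₀' hβ]; linarith [hx.2.2]
      · have := (div_left_inj' hβ.ne').1 (sub_right_injective hxy)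
        linarith
    · intro a b x y ha ha2 hb2 hb hx hy
      have hcard : (D'.filter fun x => a < x ∧ x < 1 / 2).card +
          (D'.filter fun x => 1 / 2 < x ∧ x < b).card + 1 ≤
          (D'.filter fun x => a < x ∧ x < b).card := by
        rw [← Finset.card_union_of_disjoint, ← Finset.card_insert_of_notMem (a := (1 / 2 : ℝ))]
        · refine Finset.card_le_card fun z hz => ?_
          simp only [Finset.mem_insert, Finset.mem_union, Finset.mem_filter] at hz
          rw [Finset.mem_filter]
          rcases hz with rfl | ⟨h1, h2, h3⟩ | ⟨h1, h2, h3⟩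
          · exact ⟨Finset.mem_insert_self _ _, ha2, hb2⟩
          · exact ⟨h1, h2, h3.trans hb2⟩
          · exact ⟨h1, ha2.trans h2, h3⟩
        · simp
        · rw [Finset.disjoint_left]
          intro z hz hz'
          exact lt_asymm (Finset.mem_filter.1 hz).2.2 (Finset.mem_filter.1 hz').2.1
      have hcard' : ((D'.filter fun x => a < x ∧ x < 1 / 2).card : ℝ) +
          (D'.filter fun x => 1 / 2 < x ∧ x < b).card + 1 ≤
          (D'.filter fun x => a < x ∧ x < b).card := by exact_mod_cast hcard
      linarith

end Params
end GenTakagi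

namespace GenTakagi

lemma exists_card_filter_le (D : Finset ℝ) : ∃ C : ℝ, 0 ≤ C ∧ ∀ a b : ℝ, a < b →
    ((D.filter fun x => a < x ∧ x < b).card : ℝ) ≤ 1 + C * (b - a) := by
  obtain ⟨δ, hδ, h⟩ : ∃ δ > 0, ∀ x ∈ D, ∀ y ∈ D, x < y → δ ≤ y - x := by
    rcases D.offDiag.eq_empty_or_nonempty with h0 | h0
    · refine ⟨1, one_pos, fun x hx y hy hxy => ?_⟩
      have : (x, y) ∈ D.offDiag := Finset.mem_offDiag.2 ⟨hx, hy, hxy.ne⟩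
      rw [h0] at this
      exact absurd this (Finset.notMem_empty _)
    · obtain ⟨p, hp, hmin⟩ := Finset.exists_min_image D.offDiag (fun p => |p.2 - p.1|) h0
      refine ⟨|p.2 - p.1|, abs_pos.2 (sub_ne_zero.2 (Finset.mem_offDiag.1 hp).2.2.symm),
        fun x hx y hy hxy => ?_⟩
      have := hmin (x, y) (Finset.mem_offDiag.2 ⟨hx, hy, hxy.ne⟩)
      rwa [abs_of_pos (sub_pos.2 hxy)] at this
  refine ⟨D.card / δ, by positivity, fun a b hab => ?_⟩
  rcases le_or_gt (D.filter fun x => a < x ∧ x < b).card 1 with h1 | h1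
  · have : ((D.filter fun x => a < x ∧ x < b).card : ℝ) ≤ 1 := by exact_mod_cast h1
    have : 0 ≤ D.card / δ * (b - a) := mul_nonneg (by positivity) (sub_pos.2 hab).le
    linarith
  · obtain ⟨x, hx, y, hy, hxy⟩ := Finset.one_lt_card.1 h1
    rw [Finset.mem_filter] at hx hy
    have hlen : δ ≤ b - a := by
      rcases lt_or_gt_of_ne hxy with hlt | hlt
      · linarith [h x hx.1 y hy.1 hlt]
      · linarith [h y hy.1 x hx.1 hlt]
    have h2 : ((D.filter fun x => a < x ∧ x < b).card : ℝ) ≤ D.card := by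
      exact_mod_cast Finset.card_filter_le _ _
    have h3 : (D.card : ℝ) ≤ D.card / δ * (b - a) := by
      rw [div_mul_eq_mul_div, le_div_iff₀ hδ]
      exact mul_le_mul_of_nonneg_left hlen (Nat.cast_nonneg _)
    linarith

variable {α β ρ : ℝ} (P : Params α β)
include P

namespace Params

/-- Along a subsequence of iterates, the number of monotone pieces is at most of the order of the
expansion rate. -/
lemma exists_transfer_pow_one_le : ∃ (k : ℕ) (D : ℝ), 0 < k ∧ 0 < D ∧ ∀ j : ℕ, ∀ a b, 0 ≤ a →
    a < b → b ≤ 1 → (transfer β ^ (k * j)) 1 a b ≤ D * β ^ (k * j) := by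
  have hβ := P.β_pos
  obtain ⟨k, hk⟩ := pow_unbounded_of_one_lt 4 P.one_lt
  have hk0 : 0 < k := Nat.pos_of_ne_zero fun h => by rw [h, pow_zero] at hk; norm_num at hk
  obtain ⟨E, hE⟩ := P.exists_transfer_pow_one_le_card k
  obtain ⟨C, hC, hEC⟩ := exists_card_filter_le E
  refine ⟨k, 1 + C, hk0, by positivity, fun j => ?_⟩
  induction j with
  | zero => intro a b _ _ _; simpa using hC
  | succ j ih =>
    intro a b ha hab hb
    have h1 : (transfer β ^ (k * j)) ((transfer β ^ k) 1) a b ≤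
        (transfer β ^ (k * j)) ((2 : ℝ) • 1 + C • fun a b => b - a) a b := by
      refine P.transfer_pow_mono _ (fun a b ha hab hb => ?_) ha hab hb
      have := hE a b ha hab hb
      have := hEC a b hab
      simp only [Pi.add_apply, Pi.smul_apply, Pi.one_apply, smul_eq_mul]
      linarith
    rw [map_add, map_smul, map_smul, transfer_pow_len] at h1
    simp only [Pi.add_apply, Pi.smul_apply, smul_eq_mul] at h1
    have h2 := ih a b ha hab hb
    rw [mul_add_one, pow_add, Module.End.mul_apply]
    refine h1.trans ?_
    have hB : 0 < β ^ (k * j) := pow_pos hβ _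
    have h3 : C * (β ^ (k * j) * (b - a)) ≤ C * β ^ (k * j) :=
      mul_le_mul_of_nonneg_left (mul_le_of_le_one_right hB.le (by linarith)) hC
    have h4 : (1 + C) * β ^ (k * j) * 4 ≤ (1 + C) * β ^ (k * j) * β ^ k :=
      mul_le_mul_of_nonneg_left hk.le (by positivity)
    rw [pow_add]
    have : 0 ≤ C * β ^ (k * j) := by positivity
    linarith

end Params
end GenTakagi

namespace GenTakagi

/-- The indicator of the intervals that contain the image of a branch of order `N`. -/
noncomputable def branchInd (α β ρ : ℝ) (N : ℕ) (a b : ℝ) : ℝ :=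
  open Classical in if ∃ r k, IsBranch α β ρ N r k a b then 1 else 0

lemma branchInd_nonneg (α β ρ : ℝ) (N : ℕ) (a b : ℝ) : 0 ≤ branchInd α β ρ N a b := by
  unfold branchInd; split_ifs <;> norm_num

variable {α β ρ : ℝ} (P : Params α β) (w : Window β ρ)
include P w

namespace Params

lemma exists_family (N n : ℕ) {a b : ℝ} (ha : 0 ≤ a) (hab : a < b) (hb : b ≤ 1) :
    ∃ W : Finset ℝ, (∀ r ∈ W, ∃ k, IsBranch α β ρ (N + n) r k a b) ∧
      (transfer β ^ n) (branchInd α β ρ N) a b ≤ W.card := by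
  classical
  have hβ := P.β_pos
  induction n generalizing a b with
  | zero =>
    rw [pow_zero, Module.End.one_apply, branchInd, add_zero]
    split_ifs with h
    · obtain ⟨r, k, h⟩ := h
      exact ⟨{r}, fun r' hr' => ⟨k, by rwa [Finset.mem_singleton.1 hr']⟩, by simp⟩
    · exact ⟨∅, by simp, by simp⟩
  | succ n ih =>
    rw [pow_succ', Module.End.mul_apply]
    refine P.transfer_induction
      (p := fun a b x => ∃ W : Finset ℝ, (∀ r ∈ W, ∃ k, IsBranch α β ρ (N + n) r k a b) ∧
        x ≤ W.card)
      (q := fun a b x => ∃ W : Finset ℝ, (∀ r ∈ W, ∃ k, IsBranch α β ρ (N + (n + 1)) r k a b) ∧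
        x ≤ W.card) (fun a b ha hab hb => ih ha hab hb) ?_ ?_ ?_ ha hab hb
    · rintro a b x ha hab hb ⟨W, hW, hx⟩
      refine ⟨W.image fun r => r / β, fun r' hr' => ?_, ?_⟩
      · obtain ⟨r, hr, rfl⟩ := Finset.mem_image.1 hr'
        obtain ⟨k, h⟩ := hW r hr
        have := P.isBranch_left h (mul_nonneg hβ.le ha) (by nlinarith)
        rw [mul_div_cancel_left₀ _ hβ.ne', mul_div_cancel_left₀ _ hβ.ne'] at this
        exact ⟨_, this⟩
      · rwa [Finset.card_image_of_injective _ fun x y hxy => (div_left_inj' hβ.ne').1 hxy]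
    · rintro a b x ha hab hb ⟨W, hW, hx⟩
      refine ⟨W.image fun r => r / β + 1 - 1 / β, fun r' hr' => ?_, ?_⟩
      · obtain ⟨r, hr, rfl⟩ := Finset.mem_image.1 hr'
        obtain ⟨k, h⟩ := hW r hr
        have := P.isBranch_right h (by nlinarith) (by nlinarith)
        rw [sub_sub_cancel, sub_sub_cancel, mul_div_cancel_left₀ _ hβ.ne',
          mul_div_cancel_left₀ _ hβ.ne', sub_sub_cancel, sub_sub_cancel] at this
        exact ⟨_, this⟩
      · rwa [Finset.card_image_of_injective _ fun x y hxy => (div_left_inj' hβ.ne').1 (by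
          linarith [show x / β + 1 - 1 / β = y / β + 1 - 1 / β from hxy])]
    · rintro a b x y ha ha2 hb2 hb ⟨W, hW, hx⟩ ⟨W', hW', hy⟩
      refine ⟨W ∪ W', fun r hr => ?_, ?_⟩
      · rcases Finset.mem_union.1 hr with hr | hr
        · obtain ⟨k, h⟩ := hW r hr
          exact ⟨k, h.mono le_rfl hb2.le⟩
        · obtain ⟨k, h⟩ := hW' r hr
          exact ⟨k, h.mono ha2.le le_rfl⟩
      · rw [Finset.card_union_of_disjoint, Nat.cast_add]
        · exact add_le_add hx hy
        · rw [Finset.disjoint_left]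
          intro r hr hr'
          obtain ⟨k, h⟩ := hW r hr
          obtain ⟨k', h'⟩ := hW' r hr'
          have e0 : |(1 + β)⁻¹ - (1 + β)⁻¹| ≤ ρ := by simpa using w.pos.le
          exact lt_asymm (h.mem _ e0).2 (h'.mem _ e0).1

/-- Long intervals contain images of branches of bounded order. -/
lemma exists_forall_le_sum_branchInd (hβ2 : 2 < β ^ 2) {η : ℝ} (hη : 0 < η) :
    ∃ M : ℕ, ∀ a b, 0 ≤ a → b ≤ 1 → η ≤ b - a →
      1 ≤ ∑ N ∈ Finset.range M, branchInd α β ρ N a b := by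
  obtain ⟨m, hm⟩ := exists_nat_gt (2 / η)
  have hm0 : (0 : ℝ) < m := lt_trans (by positivity) hm
  rw [div_lt_iff₀ hη] at hm
  have hcell : ∀ i : ℕ, ∃ N, i < m → ∃ r k, IsBranch α β ρ N r k (i / m) ((i + 1) / m) := by
    intro i
    by_cases hi : i < m
    · obtain ⟨N, h⟩ := P.exists_isBranch w hβ2 (a := i / m) (b := (i + 1) / m) (by positivity)
        (div_lt_div_of_pos_right (by linarith) hm0)
        ((div_le_one hm0).2 (by exact_mod_cast hi))
      exact ⟨N, fun _ => h⟩
    · exact ⟨0, fun h => absurd h hi⟩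
  choose f hf using hcell
  refine ⟨(Finset.range m).sup f + 1, fun a b ha hb hab => ?_⟩
  have h1 := Nat.le_ceil (a * m)
  have h2 := Nat.ceil_lt_add_one (mul_nonneg ha hm0.le)
  set i := ⌈a * m⌉₊ with hi
  have h3 : (i : ℝ) + 1 ≤ b * m := by nlinarith
  have h4 : i < m := by
    have : (i : ℝ) < m := by nlinarith
    exact_mod_cast this
  obtain ⟨r, k, h⟩ := hf i h4
  have h5 : branchInd α β ρ (f i) a b = 1 := by
    rw [branchInd, if_pos]
    refine ⟨r, k, h.mono ?_ ?_⟩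
    · rwa [le_div_iff₀ hm0]
    · rwa [div_le_iff₀ hm0]
  rw [← h5]
  exact Finset.single_le_sum (fun N _ => branchInd_nonneg α β ρ N a b)
    (Finset.mem_range.2 (Nat.lt_succ_of_le (Finset.le_sup (f := f) (Finset.mem_range.2 h4))))

/-- Branches into a given interval are as numerous as the expansion rate allows. -/
lemma exists_large_family (hβ2 : 2 < β ^ 2) {a b : ℝ} (ha : 0 ≤ a) (hab : a < b) (hb : b ≤ 1) :
    ∃ c : ℝ, 0 < c ∧ ∀ n₀ : ℕ, ∃ N, n₀ ≤ N ∧ ∃ W : Finset ℝ,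
      (∀ r ∈ W, ∃ k, IsBranch α β ρ N r k a b) ∧ c * β ^ N ≤ W.card := by
  have hβ := P.β_pos
  obtain ⟨k, D, hk, hD, hkD⟩ := P.exists_transfer_pow_one_le
  set ℓ := b - a with hℓ
  have hℓ0 : 0 < ℓ := sub_pos.2 hab
  obtain ⟨M, hM⟩ := P.exists_forall_le_sum_branchInd w hβ2 (η := ℓ / (2 * D)) (by positivity)
  have main : ∀ j : ℕ, ℓ / 2 * β ^ (k * j) ≤
      ∑ N ∈ Finset.range M, (transfer β ^ (k * j)) (branchInd α β ρ N) a b := by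
    intro j
    have h1 : (transfer β ^ (k * j)) (fun a b => b - a) a b ≤ (transfer β ^ (k * j))
        ((ℓ / (2 * D)) • 1 + ∑ N ∈ Finset.range M, branchInd α β ρ N) a b := by
      refine P.transfer_pow_mono _ (fun a b ha hab hb => ?_) ha hab hb
      simp only [Pi.add_apply, Pi.smul_apply, Pi.one_apply, smul_eq_mul, mul_one, Finset.sum_apply]
      have hs : 0 ≤ ∑ N ∈ Finset.range M, branchInd α β ρ N a b :=
        Finset.sum_nonneg fun N _ => branchInd_nonneg _ _ _ _ _ _
      rcases le_total (ℓ / (2 * D)) (b - a) with h | h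
      · have := hM a b ha hb h
        have : 0 < ℓ / (2 * D) := by positivity
        linarith
      · linarith
    rw [transfer_pow_len, map_add, map_smul, map_sum] at h1
    simp only [Pi.add_apply, Pi.smul_apply, smul_eq_mul, Finset.sum_apply] at h1
    have h2 := mul_le_mul_of_nonneg_left (hkD j a b ha hab hb)
      (show 0 ≤ ℓ / (2 * D) by positivity)
    have h3 : ℓ / (2 * D) * (D * β ^ (k * j)) = ℓ / 2 * β ^ (k * j) := by
      field_simp
    rw [h3] at h2
    rw [← hℓ] at h1
    linarith
  have hM0 : 0 < M := by
    rcases Nat.eq_zero_or_pos M with h | h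
    · have h1 := main 0
      rw [h] at h1
      simp only [mul_zero, pow_zero, Finset.range_zero, Finset.sum_empty] at h1
      linarith
    · exact h
  have hM0' : (0 : ℝ) < M := Nat.cast_pos.2 hM0
  refine ⟨ℓ / 2 / M / β ^ M, by positivity, fun n₀ => ?_⟩
  obtain ⟨N, hN, hle⟩ : ∃ N ∈ Finset.range M, ℓ / 2 * β ^ (k * n₀) / M ≤
      (transfer β ^ (k * n₀)) (branchInd α β ρ N) a b := by
    refine Finset.exists_le_of_sum_le (Finset.nonempty_range_iff.2 hM0.ne') ?_
    rw [Finset.sum_const, Finset.card_range, nsmul_eq_mul, mul_div_cancel₀ _ hM0'.ne']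
    exact main n₀
  obtain ⟨W, hW, hcard⟩ := P.exists_family w N (k * n₀) ha hab hb
  refine ⟨_, (Nat.le_mul_of_pos_left n₀ hk).trans (Nat.le_add_left _ N), W, hW,
    le_trans ?_ (hle.trans hcard)⟩
  have h5 : β ^ N ≤ β ^ M := pow_le_pow_right₀ P.one_lt.le (Finset.mem_range.1 hN).le
  rw [pow_add, div_mul_eq_mul_div, div_le_iff₀ (pow_pos hβ M)]
  have h6 := mul_le_mul_of_nonneg_left h5 (show 0 ≤ ℓ / 2 * β ^ (k * n₀) / M by positivity)
  refine le_trans (le_of_eq ?_) h6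
  ring

end Params
end GenTakagi

namespace GenTakagi
variable {α β ρ : ℝ} (P : Params α β) (w : Window β ρ)
include P

namespace Params

lemma continuousOn_genTakagi : ContinuousOn (genTakagi α β) (Set.Icc 0 1) := by
  have hβ := P.β_pos
  rw [Metric.continuousOn_iff]
  intro x hx ε hε
  have hlim : Tendsto (fun n : ℕ => ((α * β - 1)⁻¹ + (1 - α)⁻¹) * α ^ n) atTop (𝓝 0) := by
    simpa using (tendsto_pow_atTop_nhds_zero_of_lt_one P.α_pos.le P.α_lt).const_mul
      ((α * β - 1)⁻¹ + (1 - α)⁻¹)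
  obtain ⟨n, hn⟩ := (hlim.eventually_lt_const hε).exists
  exact ⟨(β ^ n)⁻¹, inv_pos.2 (pow_pos hβ n), fun y hy hxy =>
    (P.abs_genTakagi_sub_le n hy hx hxy.le).trans_lt hn⟩

include w

/-- The self-affine system carried by a family of branches of the same order. -/
noncomputable def graphIFS {N : ℕ} (hN : 1 ≤ N) (W : Finset ℝ) (k : ℝ → ℝ)
    (h : ∀ r ∈ W, IsBranch α β ρ N r (k r) ((1 + β)⁻¹ - ρ / 2) ((1 + β)⁻¹ + ρ / 2)) :
    GraphIFS W :=
  have hβ := P.β_pos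
  have hρ : 0 < ρ / 2 := half_pos w.pos
  have hρ' : ρ ≠ 0 := w.pos.ne'
  have hB : 0 < β ^ N := pow_pos hβ N
  have e : ∀ (r y : ℝ), (1 + β)⁻¹ + ρ / 2 * ((β ^ N)⁻¹ * y +
      ((1 + β)⁻¹ / β ^ N + r - (1 + β)⁻¹) / (ρ / 2)) = ((1 + β)⁻¹ + ρ / 2 * y) / β ^ N + r := by
    intro r y
    rw [mul_add, mul_div_cancel₀ _ hρ.ne']
    ring
  have hwin : ∀ y : ℝ, |y| ≤ 1 → |(1 + β)⁻¹ + ρ / 2 * y - (1 + β)⁻¹| ≤ ρ / 2 := fun y hy => by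
    rw [add_sub_cancel_left, abs_mul, abs_of_pos hρ]
    exact mul_le_of_le_one_right hρ.le hy
  { b := (β ^ N)⁻¹
    A := α ^ N
    t := fun r => ((1 + β)⁻¹ / β ^ N + r - (1 + β)⁻¹) / (ρ / 2)
    s := fun r => k r * (ρ / 2)
    T := fun y => genTakagi α β ((1 + β)⁻¹ + ρ / 2 * y) - genTakagi α β (1 + β)⁻¹
    sep := 2 / β ^ N
    b_pos := inv_pos.2 hB
    b_lt_A := by
      rw [inv_lt_iff_one_lt_mul₀ hB, ← mul_pow]
      exact one_lt_pow₀ P.one_lt_mul (Nat.one_le_iff_ne_zero.1 hN)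
    A_lt_one := pow_lt_one₀ P.α_pos.le P.α_lt (Nat.one_le_iff_ne_zero.1 hN)
    T_zero := by simp
    maps := fun r y hy => by
      have h1 := (h r r.2).mem _ ((hwin y hy).trans (by linarith))
      rw [← e] at h1
      refine abs_le.2 ⟨?_, ?_⟩
      · have := h1.1; nlinarith
      · have := h1.2; nlinarith
    T_map := fun r y hy => by
      obtain ⟨m, hm⟩ := (h r r.2).map_eq
      have h1 := hm _ ((hwin y hy).trans (by linarith))
      have h2 := hm _ ((hwin 0 (by simp)).trans (by linarith))
      rw [← e] at h1 h2
      rw [mul_zero, zero_add, mul_zero, add_zero] at h2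
      rw [h1, h2]
      ring
    T_cont := by
      refine ((P.continuousOn_genTakagi).comp (by fun_prop) fun y hy => ?_).sub continuousOn_const
      have h1 := w.mem P.le_two ((hwin y (abs_le.2 hy)).trans (by linarith))
      exact ⟨h1.1, by linarith [h1.2]⟩
    sep_pos := div_pos two_pos hB
    separated := fun r r' y y' hne hy hy' => by
      have h1 := (h r r.2).le_abs_sub hβ (h r' r'.2) fun h => hne (Subtype.ext h)
      have h2 : ((β ^ N)⁻¹ * y + ((1 + β)⁻¹ / β ^ N + r - (1 + β)⁻¹) / (ρ / 2)) -
          ((β ^ N)⁻¹ * y' + ((1 + β)⁻¹ / β ^ N + r' - (1 + β)⁻¹) / (ρ / 2)) =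
          ((r - r' : ℝ) - (y' - y) * (ρ / 2) / β ^ N) / (ρ / 2) := by
        field_simp
        ring
      rw [h2, abs_div, abs_of_pos hρ, le_div_iff₀ hρ]
      have h3 := abs_sub_abs_le_abs_sub (r - r' : ℝ) ((y' - y) * (ρ / 2) / β ^ N)
      have h4 : |(y' - y) * (ρ / 2) / β ^ N| ≤ ρ / β ^ N := by
        rw [abs_div, abs_of_pos hB, abs_mul, abs_of_pos hρ]
        refine div_le_div_of_nonneg_right ?_ hB.le
        have := abs_sub y' y
        nlinarith
      have h5 : 2 / β ^ N * (ρ / 2) = ρ / β ^ N := by ring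
      have h6 : 2 * ρ / β ^ N = ρ / β ^ N + ρ / β ^ N := by ring
      linarith }

lemma dimH_graphIFS_le {N : ℕ} (hN : 1 ≤ N) (W : Finset ℝ) (k : ℝ → ℝ)
    (h : ∀ r ∈ W, IsBranch α β ρ N r (k r) ((1 + β)⁻¹ - ρ / 2) ((1 + β)⁻¹ + ρ / 2)) :
    dimH (P.graphIFS w hN W k h).graph ≤
      dimH {p : ℝ × ℝ | ∃ x ∈ Set.Icc (0:ℝ) 1, p = (x, genTakagi α β x)} := by
  have hρ : 0 < ρ / 2 := half_pos w.pos
  refine dimH_graph_le_of_affine (x₀ := (1 + β)⁻¹) (L := ρ / 2) (k := 1)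
    (m := genTakagi α β (1 + β)⁻¹) hρ.ne' one_ne_zero fun y hy => ⟨?_, ?_⟩
  · have h1 : |(1 + β)⁻¹ + ρ / 2 * y - (1 + β)⁻¹| ≤ ρ := by
      rw [add_sub_cancel_left, abs_mul, abs_of_pos hρ]
      linarith [mul_le_of_le_one_right hρ.le (abs_le.2 hy)]
    have h2 := w.mem P.le_two h1
    exact ⟨h2.1, by linarith [h2.2]⟩
  · rw [one_mul]
    exact (sub_add_cancel _ _).symm

/-- Families of branches of the full exponential size with two distinct slopes. -/
lemma exists_large_family_pair (hβ2 : 2 < β ^ 2) : ∃ c : ℝ, 0 < c ∧ ∀ n₀ : ℕ, ∃ N, n₀ ≤ N ∧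
    ∃ (W : Finset ℝ) (k : ℝ → ℝ),
      (∀ r ∈ W, IsBranch α β ρ N r (k r) ((1 + β)⁻¹ - ρ / 2) ((1 + β)⁻¹ + ρ / 2)) ∧
      c * β ^ N ≤ W.card ∧ ∃ r ∈ W, ∃ r' ∈ W, k r ≠ k r' := by
  classical
  have hβ := P.β_pos
  have hw := w.pos
  obtain ⟨N₁, r₁, k₁, r₂, k₂, h₁, h₂, hne⟩ := P.exists_isBranch_pair w hβ2
  obtain ⟨c, hc, hfam⟩ := P.exists_large_family w hβ2 (a := (1 + β)⁻¹ - ρ / 2)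
    (b := (1 + β)⁻¹ + ρ / 2) (by linarith [w.lo, P.le_two]) (by linarith) (by linarith [w.hi])
  refine ⟨c / β ^ N₁, by positivity, fun n₀ => ?_⟩
  obtain ⟨N, hN, W, hW, hcard⟩ := hfam n₀
  have hcard0 : 0 < (W.card : ℝ) := lt_of_lt_of_le (by positivity) hcard
  obtain ⟨u, hu⟩ := Finset.card_pos.1 (Nat.cast_pos.1 hcard0)
  let W' : Finset ℝ := insert (r₂ / β ^ N + u) (W.image fun v => r₁ / β ^ N + v)
  have hW' : ∀ r ∈ W', ∃ k,
      IsBranch α β ρ (N₁ + N) r k ((1 + β)⁻¹ - ρ / 2) ((1 + β)⁻¹ + ρ / 2) := by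
    intro r hr
    rcases Finset.mem_insert.1 hr with rfl | hr
    · obtain ⟨k, h⟩ := hW u hu
      exact ⟨_, P.isBranch_comp w h (h₂.mono (by linarith) (by linarith))⟩
    · obtain ⟨v, hv, rfl⟩ := Finset.mem_image.1 hr
      obtain ⟨k, h⟩ := hW v hv
      exact ⟨_, P.isBranch_comp w h (h₁.mono (by linarith) (by linarith))⟩
  choose! k hk using hW'
  refine ⟨N₁ + N, by lia, W', k, hk, ?_, r₁ / β ^ N + u,
    Finset.mem_insert_of_mem (Finset.mem_image_of_mem (fun v => r₁ / β ^ N + v) hu), r₂ / β ^ N + u,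
    Finset.mem_insert_self _ _, ?_⟩
  · have h3 : W.card ≤ W'.card := by
      rw [← Finset.card_image_of_injective W (add_right_injective (r₁ / β ^ N))]
      exact Finset.card_le_card (Finset.subset_insert _ _)
    have h4 : (W.card : ℝ) ≤ W'.card := by exact_mod_cast h3
    have h5 : c / β ^ N₁ * β ^ (N₁ + N) = c * β ^ N := by
      rw [pow_add]; field_simp
    rw [h5]
    exact hcard.trans h4
  · obtain ⟨ku, h⟩ := hW u hu
    have e1 := (hk _ (Finset.mem_insert_of_mem
      (Finset.mem_image_of_mem (fun v => r₁ / β ^ N + v) hu))).slope_unique hw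
      (P.isBranch_comp w h (h₁.mono (by linarith) (by linarith)))
    have e2 := (hk _ (Finset.mem_insert_self _ _)).slope_unique hw
      (P.isBranch_comp w h (h₂.mono (by linarith) (by linarith)))
    rw [e1, e2]
    intro heq
    have := mul_left_cancel₀ (pow_pos P.α_pos N).ne' (add_right_cancel heq)
    exact hne this

end Params
end GenTakagi

namespace GenTakagi
variable {α β : ℝ} (P : Params α β)
include P

namespace Params

lemma le_dimH_graph_of_two_lt_sq (hβ2 : 2 < β ^ 2) :
    ENNReal.ofReal (2 + Real.log α / Real.log β) ≤
      dimH {p : ℝ × ℝ | ∃ x ∈ Set.Icc (0:ℝ) 1, p = (x, genTakagi α β x)} := by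
  have hβ := P.β_pos
  have hα := P.α_pos
  have hlog := P.log_pos
  obtain ⟨ρ, w⟩ : ∃ ρ, Window β ρ := by
    have h1 : 1 - β / 2 < (1 + β)⁻¹ := by
      rw [← one_div, lt_div_iff₀ (by linarith)]
      nlinarith [P.one_lt]
    have h2 := P.fixed_pos.2.1
    have h3 : 0 < min ((1 + β)⁻¹ - (1 - β / 2)) (1 / 2 - (1 + β)⁻¹) :=
      lt_min (by linarith) (by linarith)
    have h4 := min_le_left ((1 + β)⁻¹ - (1 - β / 2)) (1 / 2 - (1 + β)⁻¹)
    have h5 := min_le_right ((1 + β)⁻¹ - (1 - β / 2)) (1 / 2 - (1 + β)⁻¹)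
    exact ⟨_ / 2, half_pos h3, by linarith, by linarith⟩
  refine ENNReal.le_of_forall_nnreal_lt fun σ hσ => ?_
  have hσ' : (σ : ℝ) < 2 + Real.log α / Real.log β := by
    rwa [← ENNReal.ofReal_coe_nnreal, ENNReal.ofReal_lt_ofReal_iff P.dim_pos] at hσ
  obtain ⟨c, hc, hfam⟩ := P.exists_large_family_pair w hβ2
  have hgap : 0 < (2 + Real.log α / Real.log β - σ) * Real.log β :=
    mul_pos (sub_pos.2 hσ') hlog
  have l1 : ∀ᶠ N : ℕ in atTop, -Real.log c < N * ((2 + Real.log α / Real.log β - σ) * Real.log β) :=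
    (tendsto_natCast_atTop_atTop.atTop_mul_const hgap).eventually_gt_atTop _
  have l2 : ∀ᶠ N : ℕ in atTop, c⁻¹ < (α * β) ^ N :=
    (tendsto_pow_atTop_atTop_of_one_lt P.one_lt_mul).eventually_gt_atTop _
  obtain ⟨n₀, hn₀⟩ := eventually_atTop.1 ((l1.and l2).and (eventually_ge_atTop 1))
  obtain ⟨N, hN, W, k, hW, hcard, r, hr, r', hr', hne⟩ := hfam n₀
  obtain ⟨⟨h1, h2⟩, h3⟩ := hn₀ N hN
  have hB : 0 < β ^ N := pow_pos hβ N
  have hA : 0 < α ^ N := pow_pos hα N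
  have : Nonempty W := ⟨⟨r, hr⟩⟩
  refine le_trans (GraphIFS.le_dimH_graph (S := P.graphIFS w h3 W k hW)
    ⟨⟨r, hr⟩, ⟨r', hr'⟩, fun h => hne ?_⟩ ?_ ?_) (P.dimH_graphIFS_le w h3 W k hW)
  · exact mul_right_cancel₀ (half_pos w.pos).ne' h
  · rw [Fintype.card_coe]
    change 1 < (W.card : ℝ) * α ^ N
    rw [inv_lt_iff_one_lt_mul₀ hc, mul_pow] at h2
    have := mul_le_mul_of_nonneg_right hcard hA.le
    linarith
  · rw [Fintype.card_coe]
    change (σ : ℝ) * -Real.log ((β ^ N)⁻¹) <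
      Real.log W.card + Real.log (α ^ N) - Real.log ((β ^ N)⁻¹)
    have h4 := Real.log_le_log (by positivity) hcard
    rw [Real.log_mul hc.ne' hB.ne', Real.log_pow] at h4
    rw [Real.log_inv, Real.log_pow, Real.log_pow]
    have h5 : (2 + Real.log α / Real.log β - σ) * Real.log β =
        2 * Real.log β + Real.log α - σ * Real.log β := by
      field_simp
    rw [h5] at h1
    linarith

lemma le_dimH_graph : ENNReal.ofReal (2 + Real.log α / Real.log β) ≤
    dimH {p : ℝ × ℝ | ∃ x ∈ Set.Icc (0:ℝ) 1, p = (x, genTakagi α β x)} := by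
  obtain ⟨n, hn⟩ := pow_unbounded_of_one_lt 2 P.one_lt
  replace hn : 2 < β ^ 2 ^ n := hn.trans_le (pow_le_pow_right₀ P.one_lt.le Nat.lt_two_pow_self.le)
  induction n generalizing α β with
  | zero =>
    rw [pow_zero, pow_one] at hn
    exact absurd P.le_two (not_le.2 hn)
  | succ n ih =>
    rcases lt_or_ge 2 (β ^ 2) with h | h
    · exact P.le_dimH_graph_of_two_lt_sq h
    · refine le_trans ?_ (P.dimH_graph_sq_le h)
      have h1 := ih (P.sq h) (by rwa [← pow_mul, ← pow_succ'])
      rwa [Real.log_pow, Real.log_pow, mul_div_mul_left _ _ (by norm_num)] at h1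

end Params
end GenTakagi

end

/-- For every `α ∈ (0,1)` and `β ∈ (1,2]` with `αβ > 1`, the Hausdorff dimension of the graph
of the generalized `(α,β)`-Takagi function over `[0,1]` equals `2 + log α / log β`. -/
theorem genTakagi_graph_dimH (α β : ℝ) (hα₀ : 0 < α) (hα₁ : α < 1)
    (hβ₁ : 1 < β) (hβ₂ : β ≤ 2) (hαβ : 1 < α * β) :
    dimH {p : ℝ × ℝ | ∃ x ∈ Set.Icc (0:ℝ) 1, p = (x, genTakagi α β x)} =
      ENNReal.ofReal (2 + Real.log α / Real.log β) := by
  have P : GenTakagi.Params α β := ⟨hα₀, hα₁, hβ₁, hβ₂, hαβ⟩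
  exact le_antisymm P.dimH_graph_le P.le_dimH_graph
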